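/- arXiv:1502.00765 — 10 statements merged into one kernel-verified Lean document; each statement's English description precedes it below -/
import Mathlib

section
/- There exist constants σ > 0, T_s > 0 and M₁ > 0 with the following property: for every partition {τ_i}_{i=0}^∞ of [0,∞) with sup_{i≥0}(τ_{i+1} − τ_i) ≤ T_s, every measurable essentially bounded input u : [−r−τ, ∞) → U, every integer l > 0 with τ_l ≥ r, and all functions x : [−r,∞) → ℝ^n, z : [0,∞) → ℝ^n, w : [0,∞) → ℝ^k satisfying (i) ẋ(t) = f(x(t), u(t−τ)) for t ≥ 0 a.e., (ii) ż(t) = f(z(t), u(t−r−τ)) + k̂(z(t), w(t), u(t−r−τ)) for t ≥ 0 a.e., (iii) ẇ(t) = ∇h(z(t)) f(z(t), u(t−r−τ)) on each [τ_i, τ_{i+1}) a.e. with w(τ_i) = h(x(τ_i − r)) for all i, and (iv) x(t−r) ∈ S₁ and z(t) ∈ S₂ for all t ≥ τ_l, one has sup_{τ_l ≤ s ≤ t} (exp(σ s) |z(s) − x(s−r)|) ≤ M₁ exp(σ τ_l) |z(τ_l) − x(τ_l − r)| for all t ≥ τ_l. -/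
open MeasureTheory Set Filter
open scoped RealInnerProductSpace Topology

section Primitive

variable {E F : Type*} [NormedAddCommGroup E] [NormedSpace ℝ E] [NormedAddCommGroup F]
  [NormedSpace ℝ F] {a b : ℝ} {y g : ℝ → E}

/-- A function with bounded integrable density is Lipschitz. -/
theorem lipschitzOnWith_of_eq_add_integral {B : ℝ}
    (hg : IntervalIntegrable g volume a b) (hB : ∀ t ∈ Icc a b, ‖g t‖ ≤ B)
    (hy : ∀ t ∈ Icc a b, y t = y a + ∫ s in a..t, g s) :
    LipschitzOnWith B.toNNReal y (Icc a b) := by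
  refine LipschitzOnWith.of_dist_le_mul fun s hs t ht => ?_
  have hab : a ≤ b := hs.1.trans hs.2
  have hB0 : 0 ≤ B := (norm_nonneg _).trans (hB s hs)
  have hint : ∀ t ∈ Icc a b, IntervalIntegrable g volume a t := fun t ht =>
    hg.mono_set (by rw [uIcc_of_le hab, uIcc_of_le ht.1]; exact Icc_subset_Icc_right ht.2)
  rw [hy s hs, hy t ht, dist_eq_norm, Real.coe_toNNReal _ hB0, Real.dist_eq,
    add_sub_add_left_eq_sub, intervalIntegral.integral_interval_sub_left (hint s hs) (hint t ht)]
  refine intervalIntegral.norm_integral_le_of_norm_le_const fun r hr => hB r ?_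
  have := uIoc_subset_uIcc hr
  exact uIcc_subset_Icc ht hs this

theorem ae_hasDerivAt_of_eq_add_integral [CompleteSpace E] (hab : a ≤ b)
    (hg : IntervalIntegrable g volume a b)
    (hy : ∀ t ∈ Icc a b, y t = y a + ∫ s in a..t, g s) :
    ∀ᵐ t, t ∈ Icc a b → HasDerivAt y (g t) t := by
  have h₁ : ∀ᵐ x : ℝ, x ≠ a := by simp [ae_iff, measure_singleton]
  have h₂ : ∀ᵐ x : ℝ, x ≠ b := by simp [ae_iff, measure_singleton]
  filter_upwards [hg.ae_hasDerivAt_integral, h₁, h₂] with t ht hta htb htI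
  have h := (ht (by rwa [uIcc_of_le hab]) a left_mem_uIcc).const_add (y a)
  refine h.congr_of_eventuallyEq ?_
  filter_upwards [Icc_mem_nhds (lt_of_le_of_ne htI.1 hta.symm) (lt_of_le_of_ne htI.2 htb)]
    with s hs using hy s hs

omit [NormedSpace ℝ E] [NormedSpace ℝ F] in
/-- A locally Lipschitz function composed with a Lipschitz curve on a compact interval is
Lipschitz. -/
theorem LocallyLipschitz.exists_lipschitzOnWith_comp_Icc {Φ : E → F} (hΦ : LocallyLipschitz Φ)
    {K : NNReal} (hy : LipschitzOnWith K y (Icc a b)) :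
    ∃ K', LipschitzOnWith K' (fun t => Φ (y t)) (Icc a b) := by
  obtain ⟨C, hC⟩ := LocallyLipschitzOn.exists_lipschitzOnWith_of_compact
    (isCompact_Icc.image_of_continuousOn hy.continuousOn)
    (hΦ.locallyLipschitzOn (s := y '' Icc a b))
  exact ⟨C * K, hC.comp hy (mapsTo_image _ _)⟩

/-- The fundamental theorem of calculus for Lipschitz functions with an a.e. derivative. -/
theorem LipschitzOnWith.sub_eq_integral_of_ae_hasDerivAt [CompleteSpace E] {K : NNReal} {B : ℝ}
    (hab : a ≤ b) (hy : LipschitzOnWith K y (Icc a b)) (hg : IntervalIntegrable g volume a b)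
    (hB : ∀ t ∈ Icc a b, ‖g t‖ ≤ B) (hd : ∀ᵐ t, t ∈ Icc a b → HasDerivAt y (g t) t) :
    y b - y a = ∫ s in a..b, g s := by
  have hI : LipschitzOnWith B.toNNReal (fun t => ∫ s in a..t, g s) (Icc a b) :=
    lipschitzOnWith_of_eq_add_integral hg hB (by simp)
  have hId := ae_hasDerivAt_of_eq_add_integral (y := fun t => ∫ s in a..t, g s) hab hg (by simp)
  have hac : AbsolutelyContinuousOnInterval (y - fun t => ∫ s in a..t, g s) a b := by
    rw [← uIcc_of_le hab] at hy hI
    exact hy.absolutelyContinuousOnInterval.sub hI.absolutelyContinuousOnInterval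
  obtain ⟨C, hC⟩ := hac.const_of_ae_hasDerivAt_zero (by
    rw [uIcc_of_le hab]
    filter_upwards [hd, hId] with t h1 h2 ht
    simpa using (h1 ht).sub (h2 ht))
  have h1 := hC a left_mem_uIcc
  have h2 := hC b right_mem_uIcc
  simp only [Pi.sub_apply, intervalIntegral.integral_same, sub_zero] at h1 h2
  rw [h1, ← h2]; abel

/-- A Lipschitz real function with a.e. nonpositive derivative does not increase. -/
theorem LipschitzOnWith.le_of_ae_hasDerivAt_nonpos {y g : ℝ → ℝ} {K : NNReal} (hab : a ≤ b)
    (hy : LipschitzOnWith K y (Icc a b)) (hd : ∀ᵐ t, t ∈ Icc a b → HasDerivAt y (g t) t)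
    (hg : ∀ t ∈ Icc a b, g t ≤ 0) : y b ≤ y a := by
  rw [← uIcc_of_le hab] at hy
  have h := hy.absolutelyContinuousOnInterval.integral_deriv_eq_sub
  rw [intervalIntegral.integral_of_le hab] at h
  have : ∫ t in Ioc a b, deriv y t ≤ 0 := by
    refine integral_nonpos_of_ae ?_
    filter_upwards [ae_restrict_of_ae hd, ae_restrict_mem measurableSet_Ioc] with t ht hm
    have hm' := Ioc_subset_Icc_self hm
    simpa [(ht hm').deriv] using hg t hm'
  linarith

omit [NormedSpace ℝ E] in
/-- A measurable function that is bounded on `[a, b]` is interval integrable. -/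
theorem intervalIntegrable_of_norm_le {B : ℝ} (hab : a ≤ b)
    (hm : AEStronglyMeasurable g (volume.restrict (Icc a b)))
    (hB : ∀ t ∈ Icc a b, ‖g t‖ ≤ B) : IntervalIntegrable g volume a b := by
  rw [intervalIntegrable_iff_integrableOn_Icc_of_le hab]
  exact Integrable.of_bound hm B ((ae_restrict_mem measurableSet_Icc).mono hB)

end Primitive

section Halanay

variable {E : Type*} [NormedAddCommGroup E] [InnerProductSpace ℝ E] [CompleteSpace E]

/-- If `⟪e, Q e'⟫` is dissipative up to a small multiple of the supremum of `‖e‖` over a delay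
window of length `T`, then `e` decays exponentially. -/
theorem exp_weighted_bound_of_delayed_dissipation (Q : E →L[ℝ] E)
    (hQ : ∀ v w : E, ⟪Q v, w⟫ = ⟪v, Q w⟫) {q₁ q₂ α K T : ℝ} (hq₁ : 0 < q₁) (hq₂ : 0 < q₂)
    (hQ₁ : ∀ v, q₁ * ‖v‖ ^ 2 ≤ ⟪v, Q v⟫) (hQ₂ : ∀ v, ⟪v, Q v⟫ ≤ q₂ * ‖v‖ ^ 2)
    (hα : 0 < α) {σ : ℝ} (hσ : σ = α / (2 * q₂))
    (hsmall : 8 * q₂ * (K * T * Real.exp (σ * T)) ^ 2 ≤ q₁ * α ^ 2)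
    {a b B : ℝ} {e g : ℝ → E} (hg : IntervalIntegrable g volume a b)
    (hB : ∀ t ∈ Icc a b, ‖g t‖ ≤ B) (he : ∀ t ∈ Icc a b, e t = e a + ∫ s in a..t, g s)
    (hdiss : ∀ t ∈ Icc a b, ∀ m, (∀ s ∈ Icc a t, t - T ≤ s → ‖e s‖ ≤ m) →
      ⟪e t, Q (g t)⟫ ≤ -α * ‖e t‖ ^ 2 + K * T * m * ‖e t‖) :
    ∀ t ∈ Icc a b,
      Real.exp (σ * t) * ‖e t‖ ≤ √(2 * q₂ / q₁) * (Real.exp (σ * a) * ‖e a‖) := by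
  intro t₀ ht₀
  have hab : a ≤ b := ht₀.1.trans ht₀.2
  have hσ0 : 0 < σ := by rw [hσ]; positivity
  have hα' : α = 2 * q₂ * σ := by rw [hσ]; field_simp
  have hLip := lipschitzOnWith_of_eq_add_integral hg hB he
  have hder := ae_hasDerivAt_of_eq_add_integral hab hg he
  obtain ⟨s₀, hs₀, hmax⟩ := isCompact_Icc.exists_isMaxOn (nonempty_Icc.2 hab)
    (f := fun t => Real.exp (σ * t) * ‖e t‖) (by
      have := hLip.continuousOn
      fun_prop)
  set M := Real.exp (σ * s₀) * ‖e s₀‖ with hM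
  have hM0 : 0 ≤ M := by positivity
  have hmax' : ∀ t ∈ Icc a b, Real.exp (σ * t) * ‖e t‖ ≤ M := fun t ht => hmax ht
  refine (hmax' t₀ ht₀).trans ?_
  set β := K * T * Real.exp (σ * T) with hβ
  set N := 4 * q₂ * β ^ 2 / α ^ 2 * M ^ 2 with hN
  let H : ℝ → ℝ := fun t =>
    Real.exp (σ * t) * (Real.exp (σ * t) * Real.exp (σ * t) * ⟪e t, Q (e t)⟫ - N)
  let H' : ℝ → ℝ := fun t =>
    Real.exp (σ * t) * (3 * σ * (Real.exp (σ * t) * Real.exp (σ * t) * ⟪e t, Q (e t)⟫)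
      + 2 * (Real.exp (σ * t) * Real.exp (σ * t) * ⟪e t, Q (g t)⟫) - σ * N)
  have hsub : Icc a s₀ ⊆ Icc a b := Icc_subset_Icc_right hs₀.2
  obtain ⟨C, hC⟩ : ∃ C, LipschitzOnWith C H (Icc a s₀) := by
    have hΦ : LocallyLipschitz fun q : ℝ × E => Real.exp (σ * q.1) *
        (Real.exp (σ * q.1) * Real.exp (σ * q.1) * ⟪q.2, Q q.2⟫ - N) := by
      apply ContDiff.locallyLipschitz (𝕂 := ℝ)
      have hQ' : ContDiff ℝ 1 (fun q : ℝ × E => Q q.2) := Q.contDiff.comp contDiff_snd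
      have : ContDiff ℝ 1 (fun q : ℝ × E => ⟪q.2, Q q.2⟫) := contDiff_snd.inner ℝ hQ'
      fun_prop
    exact hΦ.exists_lipschitzOnWith_comp_Icc
      ((LipschitzWith.id.lipschitzOnWith (s := Icc a s₀)).prodMk (hLip.mono hsub))
  have hHd : ∀ᵐ t, t ∈ Icc a s₀ → HasDerivAt H (H' t) t := by
    filter_upwards [hder] with t ht htm
    have h1 := ht (hsub htm)
    have h2 : HasDerivAt (fun t => Real.exp (σ * t)) (Real.exp (σ * t) * (σ * 1)) t :=
      ((hasDerivAt_id t).const_mul σ).exp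
    have h3 : HasDerivAt (fun t => Q (e t)) (Q (g t)) t := Q.hasFDerivAt.comp_hasDerivAt t h1
    have h4 := h2.mul ((((h2.mul h2).mul (h1.inner ℝ h3))).sub_const N)
    refine h4.congr_deriv ?_
    have : ⟪g t, Q (e t)⟫ = ⟪e t, Q (g t)⟫ := by rw [← hQ, real_inner_comm]
    simp only [H', Pi.mul_apply, this]
    ring
  have hH' : ∀ t ∈ Icc a s₀, H' t ≤ 0 := by
    intro t ht
    have htb := hsub ht
    refine mul_nonpos_of_nonneg_of_nonpos (Real.exp_pos _).le ?_
    set E₁ := Real.exp (σ * t) with hE₁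
    have hE₁0 : 0 < E₁ := Real.exp_pos _
    have hd := hdiss t htb (M * (Real.exp (σ * T) / E₁)) (by
      intro s hs hsT
      have h1 := hmax' s ⟨hs.1, hs.2.trans htb.2⟩
      have h2 : E₁ ≤ Real.exp (σ * s) * Real.exp (σ * T) := by
        rw [← Real.exp_add]
        apply Real.exp_le_exp.2
        nlinarith
      rw [← mul_div_assoc, le_div_iff₀ hE₁0]
      calc ‖e s‖ * E₁ ≤ ‖e s‖ * (Real.exp (σ * s) * Real.exp (σ * T)) := by gcongr
        _ = Real.exp (σ * s) * ‖e s‖ * Real.exp (σ * T) := by ring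
        _ ≤ M * Real.exp (σ * T) := by gcongr)
    set v := E₁ * ‖e t‖ with hv
    have h1 : E₁ * E₁ * ⟪e t, Q (g t)⟫ ≤ -α * v ^ 2 + β * M * v := by
      calc _ ≤ E₁ * E₁ * (-α * ‖e t‖ ^ 2 + K * T * (M * (Real.exp (σ * T) / E₁)) * ‖e t‖) := by
            gcongr
        _ = _ := by rw [hv, hβ]; field_simp
    have h2 : E₁ * E₁ * ⟪e t, Q (e t)⟫ ≤ q₂ * v ^ 2 := by
      calc _ ≤ E₁ * E₁ * (q₂ * ‖e t‖ ^ 2) := by gcongr; exact hQ₂ _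
        _ = _ := by rw [hv]; ring
    have h3 : σ * N = 2 * β ^ 2 * M ^ 2 / α := by
      rw [hN, hσ]; field_simp; ring
    have h4 : 2 * (β * M * v) ≤ 2 * β ^ 2 * M ^ 2 / α + α / 2 * v ^ 2 := by
      have : 2 * β ^ 2 * M ^ 2 / α + α / 2 * v ^ 2 - 2 * (β * M * v)
          = (2 * β * M - α * v) ^ 2 / (2 * α) := by field_simp; ring
      have : 0 ≤ (2 * β * M - α * v) ^ 2 / (2 * α) := by positivity
      linarith
    have h5 : 3 * σ * (E₁ * E₁ * ⟪e t, Q (e t)⟫) ≤ 3 * σ * (q₂ * v ^ 2) := by gcongr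
    have h6 : 3 * σ * (q₂ * v ^ 2) = 3 / 2 * α * v ^ 2 := by rw [hα']; ring
    rw [h3]
    linarith
  have hfin := hC.le_of_ae_hasDerivAt_nonpos hs₀.1 hHd hH'
  have hN0 : 0 ≤ N := by positivity
  set F := Real.exp (σ * s₀) * Real.exp (σ * s₀) * ⟪e s₀, Q (e s₀)⟫ with hF
  set F₀ := Real.exp (σ * a) * Real.exp (σ * a) * ⟪e a, Q (e a)⟫ with hF₀
  have hF₀0 : 0 ≤ F₀ := by
    have := hQ₁ (e a)
    have : 0 ≤ ⟪e a, Q (e a)⟫ := le_trans (by positivity) this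
    positivity
  have hle : F ≤ F₀ + N := by
    by_contra! hcon
    have h1 : Real.exp (σ * s₀) * (F - N) ≤ Real.exp (σ * a) * (F₀ - N) := hfin
    have h2 : Real.exp (σ * a) ≤ Real.exp (σ * s₀) := Real.exp_le_exp.2 (by nlinarith [hs₀.1])
    have h3 : Real.exp (σ * a) * (F - N) ≤ Real.exp (σ * s₀) * (F - N) := by
      gcongr; linarith
    have h4 : F - N ≤ F₀ - N := le_of_mul_le_mul_left (h3.trans h1) (Real.exp_pos _)
    linarith
  have hFl : q₁ * M ^ 2 ≤ F := by
    calc q₁ * M ^ 2 = Real.exp (σ * s₀) * Real.exp (σ * s₀) * (q₁ * ‖e s₀‖ ^ 2) := by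
          rw [hM]; ring
      _ ≤ _ := by rw [hF]; gcongr; exact hQ₁ _
  have hFu : F₀ ≤ q₂ * (Real.exp (σ * a) * ‖e a‖) ^ 2 := by
    calc F₀ ≤ Real.exp (σ * a) * Real.exp (σ * a) * (q₂ * ‖e a‖ ^ 2) := by
          rw [hF₀]; gcongr; exact hQ₂ _
      _ = _ := by ring
  have hNle : N ≤ q₁ / 2 * M ^ 2 := by
    rw [hN]
    refine mul_le_mul_of_nonneg_right ?_ (by positivity)
    rw [div_le_iff₀ (by positivity)]
    linarith
  refine le_of_sq_le_sq ?_ (by positivity)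
  rw [mul_pow √_, Real.sq_sqrt (by positivity), div_mul_eq_mul_div, le_div_iff₀ hq₁]
  linarith

end Halanay

/-- The chain rule in integral form along a curve with bounded integrable density. -/
theorem ContDiff.comp_eq_add_integral {E F : Type*} [NormedAddCommGroup E]
    [NormedSpace ℝ E] [CompleteSpace E] [NormedAddCommGroup F] [NormedSpace ℝ F] [CompleteSpace F]
    {a b B B' : ℝ} {y g : ℝ → E} {q : ℝ → F} {Φ : E → F} (hab : a ≤ b) (hΦ : ContDiff ℝ 1 Φ)
    (hg : IntervalIntegrable g volume a b) (hB : ∀ t ∈ Icc a b, ‖g t‖ ≤ B)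
    (hy : ∀ t ∈ Icc a b, y t = y a + ∫ s in a..t, g s)
    (hqg : ∀ t, q t = fderiv ℝ Φ (y t) (g t))
    (hq : IntervalIntegrable q volume a b) (hB' : ∀ t ∈ Icc a b, ‖q t‖ ≤ B') :
    Φ (y b) = Φ (y a) + ∫ s in a..b, q s := by
  obtain ⟨C, hC⟩ := hΦ.locallyLipschitz.exists_lipschitzOnWith_comp_Icc
    (lipschitzOnWith_of_eq_add_integral hg hB hy)
  rw [← hC.sub_eq_integral_of_ae_hasDerivAt hab hq hB']
  · abel
  · filter_upwards [ae_hasDerivAt_of_eq_add_integral hab hg hy] with t ht hm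
    rw [hqg]
    exact ((hΦ.differentiable one_ne_zero _).hasFDerivAt).comp_hasDerivAt t (ht hm)

theorem exists_forall_norm_comp_le {E P F : Type*} [NormedAddCommGroup E] [NormedAddCommGroup P]
    [NormedAddCommGroup F] {Ψ : E × P → F} (hΨ : Continuous Ψ) {U : Set P} (hU : IsCompact U)
    {a b : ℝ} {y : ℝ → E} (hy : ContinuousOn y (Icc a b)) {v : ℝ → P} (hvU : ∀ t, v t ∈ U) :
    ∃ B, ∀ t ∈ Icc a b, ‖Ψ (y t, v t)‖ ≤ B := by
  obtain ⟨B, hB⟩ := ((isCompact_Icc.image_of_continuousOn hy).prod hU).exists_bound_of_continuousOn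
    hΨ.continuousOn
  exact ⟨B, fun t ht => hB _ ⟨mem_image_of_mem y ht, hvU t⟩⟩

theorem aestronglyMeasurable_comp_Icc {E P F : Type*} [NormedAddCommGroup E]
    [NormedAddCommGroup P] [MeasurableSpace P] [BorelSpace P] [SecondCountableTopology P]
    [NormedAddCommGroup F] {Ψ : E × P → F} (hΨ : Continuous Ψ)
    {a b : ℝ} {y : ℝ → E} (hy : ContinuousOn y (Icc a b)) {v : ℝ → P} (hv : Measurable v) :
    AEStronglyMeasurable (fun t => Ψ (y t, v t)) (volume.restrict (Icc a b)) :=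
  hΨ.comp_aestronglyMeasurable
    ((hy.aestronglyMeasurable measurableSet_Icc).prodMk hv.aestronglyMeasurable)

theorem exists_pos_mul_sq_le_inner {E : Type*} [NormedAddCommGroup E] [InnerProductSpace ℝ E]
    [FiniteDimensional ℝ E] (Q : E →L[ℝ] E) (hQ : ∀ v, v ≠ 0 → 0 < ⟪v, Q v⟫) :
    ∃ q : ℝ, 0 < q ∧ ∀ v, q * ‖v‖ ^ 2 ≤ ⟪v, Q v⟫ := by
  have key : ∃ q : ℝ, 0 < q ∧ ∀ v ∈ Metric.sphere (0 : E) 1, q ≤ ⟪v, Q v⟫ := by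
    rcases (Metric.sphere (0 : E) 1).eq_empty_or_nonempty with h | h
    · exact ⟨1, one_pos, by simp [h]⟩
    · obtain ⟨v, hv, hmin⟩ := (isCompact_sphere (0 : E) 1).exists_isMinOn h
        (f := fun v => ⟪v, Q v⟫) (by fun_prop)
      exact ⟨_, hQ v (by rintro rfl; simp at hv), fun w hw => hmin hw⟩
  obtain ⟨q, hq, hqv⟩ := key
  refine ⟨q, hq, fun v => ?_⟩
  by_cases hv : v = 0
  · simp [hv]
  have hn : 0 < ‖v‖ := norm_pos_iff.2 hv
  have := hqv (‖v‖⁻¹ • v) (by simp [norm_smul, hn.ne'])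
  rw [map_smul, inner_smul_left, inner_smul_right] at this
  simp only [conj_trivial] at this
  calc q * ‖v‖ ^ 2 ≤ (‖v‖⁻¹ * (‖v‖⁻¹ * ⟪v, Q v⟫)) * ‖v‖ ^ 2 := by gcongr
    _ = _ := by field_simp

section Correction

variable {E : Type*} [NormedAddCommGroup E] [InnerProductSpace ℝ E]

/-- Pointwise dissipation for the observer with a gradient correction: the correction costs at
most the fraction `1 - c` of the decay `D`. -/
theorem inner_gradient_correction_le (Q : E →L[ℝ] E) (hQ : ∀ v w : E, ⟪Q v, w⟫ = ⟪v, Q w⟫)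
    {e v d l g : E} {c P w : ℝ} (hc : c ≤ 1) (hP : P ∈ Icc (0 : ℝ) 1) (hv : v ≠ 0)
    (hA : ⟪v, d⟫ + w ≤ 0) (hD : ⟪e, Q (d + l - g)⟫ ≤ 0)
    (hH : P ≠ 0 → ⟪v, Q e⟫ < 0 →
      ⟪v, d + l⟫ ≤ -w + (1 - c) * ‖v‖ ^ 2 * ⟪e, Q (d + l - g)⟫ / ⟪v, Q e⟫) :
    ⟪e, Q (d + (l - (max 0 (⟪v, d⟫ + w + P * ⟪v, l⟫) / ‖v‖ ^ 2) • v) - g)⟫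
      ≤ c * ⟪e, Q (d + l - g)⟫ := by
  set D := ⟪e, Q (d + l - g)⟫ with hDdef
  set μ := max 0 (⟪v, d⟫ + w + P * ⟪v, l⟫) with hμ
  have hn : 0 < ‖v‖ ^ 2 := by positivity
  have hμ0 : 0 ≤ μ := le_max_left _ _
  have hsplit : d + (l - (μ / ‖v‖ ^ 2) • v) - g = (d + l - g) - (μ / ‖v‖ ^ 2) • v := by abel
  have hcomm : ⟪e, Q v⟫ = ⟪v, Q e⟫ := by rw [← hQ, real_inner_comm]
  rw [hsplit, map_sub, inner_sub_right, map_smul, inner_smul_right, hcomm, ← hDdef]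
  have hcD : D ≤ c * D := by nlinarith
  rcases le_or_gt 0 ⟪v, Q e⟫ with hs | hs
  · have : 0 ≤ μ / ‖v‖ ^ 2 * ⟪v, Q e⟫ := by positivity
    linarith
  have hz : 0 ≤ (1 - c) * ‖v‖ ^ 2 * D / ⟪v, Q e⟫ :=
    div_nonneg_of_nonpos (mul_nonpos_of_nonneg_of_nonpos (by nlinarith) hD) hs.le
  have hle : μ ≤ (1 - c) * ‖v‖ ^ 2 * D / ⟪v, Q e⟫ := by
    refine max_le hz ?_
    by_cases hP0 : P = 0
    · rw [hP0]; linarith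
    have h1 := hH hP0 hs
    rw [inner_add_right] at h1
    have h2 : P * (⟪v, d⟫ + w + ⟪v, l⟫) ≤ P * ((1 - c) * ‖v‖ ^ 2 * D / ⟪v, Q e⟫) :=
      mul_le_mul_of_nonneg_left (by linarith) hP.1
    nlinarith [hP.1, hP.2]
  have : μ / ‖v‖ ^ 2 * ⟪v, Q e⟫ ≥ (1 - c) * D := by
    calc μ / ‖v‖ ^ 2 * ⟪v, Q e⟫
        ≥ (1 - c) * ‖v‖ ^ 2 * D / ⟪v, Q e⟫ / ‖v‖ ^ 2 * ⟪v, Q e⟫ :=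
          mul_le_mul_of_nonpos_right (by gcongr) hs.le
      _ = (1 - c) * D := by field_simp [hs.ne]
  linarith

/-- The gradient correction is Lipschitz in the output injection term. -/
theorem norm_gradient_correction_sub_le {v l l' : E} {A P : ℝ} (hP : P ∈ Icc (0 : ℝ) 1)
    (hv : v ≠ 0) :
    ‖(l - (max 0 (A + P * ⟪v, l⟫) / ‖v‖ ^ 2) • v) -
      (l' - (max 0 (A + P * ⟪v, l'⟫) / ‖v‖ ^ 2) • v)‖ ≤ 2 * ‖l - l'‖ := by
  have hn : 0 < ‖v‖ := norm_pos_iff.2 hv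
  have hmax : |max 0 (A + P * ⟪v, l⟫) - max 0 (A + P * ⟪v, l'⟫)| ≤ ‖v‖ * ‖l - l'‖ := by
    calc _ ≤ |(A + P * ⟪v, l⟫) - (A + P * ⟪v, l'⟫)| := by
          rw [max_comm 0, max_comm 0]; exact abs_max_sub_max_le_abs _ _ _
      _ = P * |⟪v, l - l'⟫| := by
          rw [inner_sub_right, ← abs_of_nonneg hP.1, ← abs_mul, abs_of_nonneg hP.1]; ring_nf
      _ ≤ 1 * (‖v‖ * ‖l - l'‖) := by
          gcongr
          · exact hP.2
          · exact abs_real_inner_le_norm _ _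
      _ = _ := one_mul _
  rw [sub_sub_sub_comm, ← sub_smul, ← sub_div]
  refine (norm_sub_le _ _).trans ?_
  rw [norm_smul, norm_div, Real.norm_eq_abs, norm_pow, norm_norm]
  have : |max 0 (A + P * ⟪v, l⟫) - max 0 (A + P * ⟪v, l'⟫)| / ‖v‖ ^ 2 * ‖v‖ ≤ ‖l - l'‖ := by
    calc _ ≤ ‖v‖ * ‖l - l'‖ / ‖v‖ ^ 2 * ‖v‖ := by gcongr
      _ = _ := by field_simp
  linarith

end Correction

section Sampling

variable {π : ℕ → ℝ}

theorem exists_mem_Ico_of_tendsto_atTop (hπ : Tendsto π atTop atTop) {t : ℝ} (ht : π 0 ≤ t) :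
    ∃ i, t ∈ Ico (π i) (π (i + 1)) := by
  classical
  have hex : ∃ j, t < π j := (hπ.eventually_gt_atTop t).exists
  have hne : Nat.find hex ≠ 0 := fun h => ((Nat.find_eq_zero hex).1 h).not_ge ht
  obtain ⟨i, hi⟩ := Nat.exists_eq_succ_of_ne_zero hne
  exact ⟨i, not_lt.1 (Nat.find_min hex (by omega)), by
    have := Nat.find_spec hex
    rwa [hi] at this⟩

variable {F : Type*} [NormedAddCommGroup F] [NormedSpace ℝ F] {q w : ℝ → F} {ξ : ℕ → F} {T : ℝ}

/-- A function that is a primitive of `q` on each sampling interval is measurable. -/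
theorem aestronglyMeasurable_of_eq_add_integral_on_Ico (hπ₀ : π 0 = 0)
    (hπm : StrictMono π) (hπ : Tendsto π atTop atTop)
    (hq : ∀ T, 0 ≤ T → IntervalIntegrable q volume 0 T)
    (hw : ∀ i, ∀ t ∈ Ico (π i) (π (i + 1)), w t = ξ i + ∫ s in (π i)..t, q s) :
    AEStronglyMeasurable w (volume.restrict (Icc 0 T)) := by
  have hsub : Icc 0 T ⊆ ⋃ i, Ico (π i) (π (i + 1)) := fun t ht =>
    mem_iUnion.2 (exists_mem_Ico_of_tendsto_atTop hπ (hπ₀ ▸ ht.1))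
  refine AEStronglyMeasurable.mono_set hsub (aestronglyMeasurable_iUnion_iff.2 fun i => ?_)
  refine ContinuousOn.aestronglyMeasurable ?_ measurableSet_Ico
  have hi : 0 ≤ π i := hπ₀ ▸ hπm.monotone (Nat.zero_le i)
  have hi' : π i ≤ π (i + 1) := hπm.monotone (Nat.le_succ i)
  have hint : IntegrableOn q (Icc (π i) (π (i + 1))) := by
    have h := hq (π (i + 1)) (hi.trans hi')
    rw [intervalIntegrable_iff_integrableOn_Icc_of_le (hi.trans hi')] at h
    exact h.mono_set (Icc_subset_Icc_left hi)
  have hc : ContinuousOn (fun t => ξ i + ∫ s in (π i)..t, q s) (Ico (π i) (π (i + 1))) := by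
    refine continuousOn_const.add ?_
    have := intervalIntegral.continuousOn_primitive_interval (a := π i) (b := π (i + 1))
      (f := q) (μ := volume) (by rwa [uIcc_of_le hi'])
    rw [uIcc_of_le hi'] at this
    exact this.mono Ico_subset_Icc_self
  exact hc.congr (hw i)

theorem exists_bound_of_eq_add_integral_on_Ico {B C : ℝ} (hπ₀ : π 0 = 0)
    (hπm : StrictMono π) (hπ : Tendsto π atTop atTop) (hB : ∀ t ∈ Icc 0 T, ‖q t‖ ≤ B)
    (hw : ∀ i, ∀ t ∈ Ico (π i) (π (i + 1)), w t = ξ i + ∫ s in (π i)..t, q s)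
    (hξ : ∀ i, π i ≤ T → ‖ξ i‖ ≤ C) :
    ∀ t ∈ Icc 0 T, ‖w t‖ ≤ C + B * T := by
  intro t ht
  obtain ⟨i, hi⟩ := exists_mem_Ico_of_tendsto_atTop hπ (hπ₀ ▸ ht.1)
  have hi0 : 0 ≤ π i := hπ₀ ▸ hπm.monotone (Nat.zero_le i)
  have hB0 : 0 ≤ B := (norm_nonneg _).trans (hB t ht)
  rw [hw i t hi]
  refine (norm_add_le _ _).trans (add_le_add (hξ i (hi.1.trans ht.2)) ?_)
  refine (intervalIntegral.norm_integral_le_of_norm_le_const (C := B) fun s hs => ?_).trans ?_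
  · rw [uIoc_of_le hi.1] at hs
    exact hB s ⟨hi0.trans hs.1.le, hs.2.trans ht.2⟩
  · rw [abs_of_nonneg (by linarith [hi.1])]
    gcongr
    linarith [ht.2]

end Sampling

/-- Lemma 3.1: under (H1), (H3), (H4), with the observer correction `k̂`
built from `L`, `p`, `φ`, there exist constants `σ, T_s, M₁ > 0` such that for every
partition with steps `≤ T_s`, every admissible input `u`, every integer `l > 0` with
`τ_l ≥ r`, and every solution `(x, z, w)` of the plant / observer / inter-sample
predictor equations with `x(t−r) ∈ S₁` and `z(t) ∈ S₂` for all `t ≥ τ_l`, one has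
`sup_{τ_l ≤ s ≤ t}(e^{σs}|z(s) − x(s−r)|) ≤ M₁ e^{στ_l}|z(τ_l) − x(τ_l − r)|` for all
`t ≥ τ_l`. -/
theorem stmt_4
    (n m k : ℕ)
    (f : EuclideanSpace ℝ (Fin n) → EuclideanSpace ℝ (Fin m) → EuclideanSpace ℝ (Fin n))
    (hf : ContDiff ℝ (⊤ : ℕ∞) (fun p : EuclideanSpace ℝ (Fin n) × EuclideanSpace ℝ (Fin m) => f p.1 p.2))
    (hf0 : f 0 0 = 0)
    (U : Set (EuclideanSpace ℝ (Fin m))) (hUcomp : IsCompact U) (hU0 : (0 : EuclideanSpace ℝ (Fin m)) ∈ U)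
    (h : EuclideanSpace ℝ (Fin n) → EuclideanSpace ℝ (Fin k)) (hh : ContDiff ℝ (⊤ : ℕ∞) h) (hh0 : h 0 = 0)
    (τ r : ℝ) (hτ : 0 ≤ τ) (hr : 0 ≤ r)
    -- (H1)
    (V : EuclideanSpace ℝ (Fin n) → ℝ) (hV : ContDiff ℝ 2 V) (hVnonneg : ∀ x, 0 ≤ V x)
    (hVradial : ∀ M : ℝ, Bornology.IsBounded {x | V x ≤ M})
    (W : EuclideanSpace ℝ (Fin n) → ℝ) (hW : ContDiff ℝ 1 W)
    (hWpos : W 0 = 0 ∧ ∀ x ≠ 0, 0 < W x)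
    (R : ℝ) (hR : 0 < R)
    (hH1 : ∀ x u, u ∈ U → R ≤ V x → ⟪gradient V x, f x u⟫ ≤ -W x)
    (hS1nhds : {x | V x ≤ R} ∈ 𝓝 (0 : EuclideanSpace ℝ (Fin n)))
    (hgradV : ∀ z, R < V z → gradient V z ≠ 0)
    -- (H3)
    (Q : EuclideanSpace ℝ (Fin n) →L[ℝ] EuclideanSpace ℝ (Fin n))
    (hQsym : ∀ v w : EuclideanSpace ℝ (Fin n), ⟪Q v, w⟫ = ⟪v, Q w⟫)
    (hQpos : ∀ v : EuclideanSpace ℝ (Fin n), v ≠ 0 → 0 < ⟪v, Q v⟫)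
    (ω : ℝ) (hω : 0 < ω) (b : ℝ) (hbR : R < b)
    (L : EuclideanSpace ℝ (Fin k) →L[ℝ] EuclideanSpace ℝ (Fin n))
    (hH3 : ∀ u z x, u ∈ U → V z ≤ b → V x ≤ R →
      ⟪z - x, Q (f z u + L (h z - h x) - f x u)⟫ ≤ -ω * ‖z - x‖ ^ 2)
    -- (H4)
    (c : ℝ) (hc : c ∈ Ioo (0:ℝ) 1) (a : ℝ) (haR : R ≤ a) (hab : a < b)
    (hH4 : ∀ u z x, u ∈ U → a < V z → V z ≤ b → ⟪gradient V z, Q (z - x)⟫ < 0 → V x ≤ R →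
      ⟪gradient V z, f z u + L (h z - h x)⟫ ≤ -W z +
        (1 - c) * ‖gradient V z‖ ^ 2 *
          ⟪z - x, Q (f z u + L (h z - h x) - f x u)⟫ / ⟪gradient V z, Q (z - x)⟫)
    -- the function `p`
    (p : ℝ → ℝ) (hp : LocallyLipschitz p) (hp01 : ∀ s, p s ∈ Icc (0:ℝ) 1)
    (hpb : ∀ s, b ≤ s → p s = 1) (hpa : ∀ s, s ≤ a → p s = 0)
    -- the functions `φ` and `k̂`
    (φ : EuclideanSpace ℝ (Fin n) → EuclideanSpace ℝ (Fin k) → EuclideanSpace ℝ (Fin m) → ℝ)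
    (hφ : ∀ z y u, φ z y u =
      max 0 (⟪gradient V z, f z u⟫ + W z + p (V z) * ⟪gradient V z, L (h z - y)⟫))
    (khat : EuclideanSpace ℝ (Fin n) → EuclideanSpace ℝ (Fin k) → EuclideanSpace ℝ (Fin m) →
      EuclideanSpace ℝ (Fin n))
    (hkhat1 : ∀ z y u, V z ≤ R → khat z y u = L (h z - y))
    (hkhat2 : ∀ z y u, R < V z →
      khat z y u = L (h z - y) - (φ z y u / ‖gradient V z‖ ^ 2) • gradient V z) :
    ∃ σ : ℝ, 0 < σ ∧ ∃ Ts : ℝ, 0 < Ts ∧ ∃ M₁ : ℝ, 0 < M₁ ∧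
      ∀ π : ℕ → ℝ, π 0 = 0 → StrictMono π → Tendsto π atTop atTop →
        (∀ i, π (i + 1) - π i ≤ Ts) →
        ∀ u : ℝ → EuclideanSpace ℝ (Fin m), Measurable u → (∀ t, u t ∈ U) →
        ∀ l : ℕ, 0 < l → r ≤ π l →
        ∀ x : ℝ → EuclideanSpace ℝ (Fin n), ContinuousOn x (Ici (-r)) →
          (∀ t, 0 ≤ t → x t = x 0 + ∫ s in (0:ℝ)..t, f (x s) (u (s - τ))) →
        ∀ z : ℝ → EuclideanSpace ℝ (Fin n), ContinuousOn z (Ici 0) →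
        ∀ w : ℝ → EuclideanSpace ℝ (Fin k),
          (∀ t, 0 ≤ t → z t = z 0 +
            ∫ s in (0:ℝ)..t, (f (z s) (u (s - r - τ)) + khat (z s) (w s) (u (s - r - τ)))) →
          (∀ i : ℕ, ∀ t ∈ Ico (π i) (π (i + 1)),
            w t = h (x (π i - r)) +
              ∫ s in (π i)..t, fderiv ℝ h (z s) (f (z s) (u (s - r - τ)))) →
          (∀ t, π l ≤ t → V (x (t - r)) ≤ R) →
          (∀ t, π l ≤ t → V (z t) ≤ b) →
          ∀ t, π l ≤ t →
            (⨆ s : Icc (π l) t, Real.exp (σ * s) * ‖z s - x ((s : ℝ) - r)‖) ≤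
              M₁ * Real.exp (σ * π l) * ‖z (π l) - x (π l - r)‖ := by
  have hf' : Continuous fun q : EuclideanSpace ℝ (Fin n) × EuclideanSpace ℝ (Fin m) =>
      f q.1 q.2 := hf.continuous
  have hgrad : Continuous (gradient V) :=
    (InnerProductSpace.toDual ℝ _).symm.continuous.comp (hV.continuous_fderiv two_ne_zero)
  have hkhat_lip : ∀ z y y' u, ‖khat z y u - khat z y' u‖ ≤ 2 * ‖L‖ * ‖y - y'‖ := by
    intro z y y' u
    have hL : ‖L (h z - y) - L (h z - y')‖ ≤ ‖L‖ * ‖y - y'‖ := by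
      rw [← map_sub, sub_sub_sub_cancel_left, norm_sub_rev y]
      exact L.le_opNorm _
    rcases le_or_gt (V z) R with hz | hz
    · rw [hkhat1 _ _ _ hz, hkhat1 _ _ _ hz]
      have := norm_nonneg (L (h z - y) - L (h z - y'))
      linarith
    · rw [hkhat2 _ _ _ hz, hkhat2 _ _ _ hz, hφ, hφ]
      refine (norm_gradient_correction_sub_le (hp01 _) (hgradV z hz)).trans ?_
      linarith
  have hkhat_zero : ∀ z u, u ∈ U → khat z (h z) u = 0 := by
    intro z u hu
    rcases le_or_gt (V z) R with hz | hz
    · rw [hkhat1 _ _ _ hz]; simp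
    · have h1 : ⟪gradient V z, f z u⟫ + W z ≤ 0 := by linarith [hH1 z u hu hz.le]
      rw [hkhat2 _ _ _ hz, hφ]
      rw [sub_self, map_zero, inner_zero_right, mul_zero, add_zero, max_eq_left h1, zero_div,
        zero_smul, sub_zero]
  have hkhat_meas : Measurable fun q : EuclideanSpace ℝ (Fin n) × EuclideanSpace ℝ (Fin k) ×
      EuclideanSpace ℝ (Fin m) => khat q.1 q.2.1 q.2.2 := by
    have hfm : Continuous fun q : EuclideanSpace ℝ (Fin n) × EuclideanSpace ℝ (Fin k) ×
        EuclideanSpace ℝ (Fin m) => f q.1 q.2.2 :=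
      hf'.comp (continuous_fst.prodMk (continuous_snd.comp continuous_snd))
    have hVc := hV.continuous
    have hhc := hh.continuous
    have hWc := hW.continuous
    have hpc := hp.continuous
    have hite : (fun q : EuclideanSpace ℝ (Fin n) × EuclideanSpace ℝ (Fin k) ×
        EuclideanSpace ℝ (Fin m) => khat q.1 q.2.1 q.2.2) = fun q =>
        if V q.1 ≤ R then L (h q.1 - q.2.1) else L (h q.1 - q.2.1) -
          (max 0 (⟪gradient V q.1, f q.1 q.2.2⟫ + W q.1 +
            p (V q.1) * ⟪gradient V q.1, L (h q.1 - q.2.1)⟫) / ‖gradient V q.1‖ ^ 2) •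
              gradient V q.1 := by
      funext q
      split_ifs with hq
      · exact hkhat1 _ _ _ hq
      · rw [hkhat2 _ _ _ (not_le.1 hq), hφ]
    rw [hite]
    refine Measurable.ite (measurableSet_le (by fun_prop) measurable_const)
      (Continuous.measurable (by fun_prop)) ?_
    refine (Continuous.measurable (by fun_prop)).sub
      (Measurable.fun_smul (Measurable.fun_div ?_ ?_) ?_)
    · exact Continuous.measurable (by fun_prop)
    · exact Continuous.measurable (by fun_prop)
    · exact Continuous.measurable (by fun_prop)
  have hkhat_diss : ∀ z x u, u ∈ U → V z ≤ b → V x ≤ R →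
      ⟪z - x, Q (f z u + khat z (h x) u - f x u)⟫ ≤ -(c * ω) * ‖z - x‖ ^ 2 := by
    intro z x u hu hz hx
    have h3 := hH3 u z x hu hz hx
    have h3' : 0 ≤ ω * ‖z - x‖ ^ 2 := by positivity
    have hcD : c * ⟪z - x, Q (f z u + L (h z - h x) - f x u)⟫ ≤ -(c * ω) * ‖z - x‖ ^ 2 := by
      nlinarith [hc.1]
    rcases le_or_gt (V z) R with hzR | hzR
    · rw [hkhat1 _ _ _ hzR]
      nlinarith [hc.2]
    · rw [hkhat2 _ _ _ hzR, hφ]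
      refine (inner_gradient_correction_le Q hQsym hc.2.le (hp01 _) (hgradV z hzR)
        (by linarith [hH1 z u hu hzR.le]) (by linarith) fun hP hs => ?_).trans hcD
      have haz : a < V z := by
        by_contra! hcon
        exact hP (hpa _ hcon)
      have hs' : ⟪gradient V z, Q (z - x)⟫ < 0 := hs
      exact hH4 u z x hu haz hz hs' hx
  have hψ : ContDiff ℝ 1 fun q : EuclideanSpace ℝ (Fin n) × EuclideanSpace ℝ (Fin m) =>
      fderiv ℝ h q.1 (f q.1 q.2) := by
    have h1 : ContDiff ℝ 1 (fderiv ℝ h) := hh.fderiv_right (by norm_cast)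
    exact (h1.comp contDiff_fst).clm_apply (hf.of_le (by norm_cast))
  have hZ : IsCompact {z | V z ≤ b} :=
    Metric.isCompact_of_isClosed_isBounded (isClosed_le hV.continuous continuous_const)
      (hVradial b)
  obtain ⟨G, hG⟩ := LocallyLipschitzOn.exists_lipschitzOnWith_of_compact (hZ.prod hUcomp)
    hψ.locallyLipschitz.locallyLipschitzOn
  have hG' : ∀ z x u, u ∈ U → V z ≤ b → V x ≤ R →
      ‖fderiv ℝ h z (f z u) - fderiv ℝ h x (f x u)‖ ≤ G * ‖z - x‖ := by
    intro z x u hu hz hx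
    have := hG.dist_le_mul (z, u) ⟨hz, hu⟩ (x, u) ⟨hx.trans hbR.le, hu⟩
    simpa [dist_eq_norm, Prod.norm_def] using this
  obtain ⟨q₁, hq₁, hQ₁⟩ := exists_pos_mul_sq_le_inner Q hQpos
  set q₂ := ‖Q‖ + 1 with hq₂def
  have hq₂ : 0 < q₂ := by positivity
  have hQ₂ : ∀ v, ⟪v, Q v⟫ ≤ q₂ * ‖v‖ ^ 2 := by
    intro v
    calc ⟪v, Q v⟫ ≤ ‖v‖ * ‖Q v‖ := real_inner_le_norm _ _
      _ ≤ ‖v‖ * (‖Q‖ * ‖v‖) := by gcongr; exact Q.le_opNorm v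
      _ ≤ _ := by rw [hq₂def]; nlinarith [sq_nonneg ‖v‖]
  set α := c * ω with hαdef
  have hα : 0 < α := mul_pos hc.1 hω
  set σ := α / (2 * q₂) with hσ
  have hσ0 : 0 < σ := by positivity
  set K := ‖Q‖ * (2 * ‖L‖) * G with hK
  obtain ⟨Ts, hsmall, hTs⟩ : ∃ Ts : ℝ,
      8 * q₂ * (K * Ts * Real.exp (σ * Ts)) ^ 2 < q₁ * α ^ 2 ∧ 0 < Ts := by
    have hc : Continuous fun Ts : ℝ => 8 * q₂ * (K * Ts * Real.exp (σ * Ts)) ^ 2 := by fun_prop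
    have h0 : ∀ᶠ Ts in 𝓝 (0 : ℝ), 8 * q₂ * (K * Ts * Real.exp (σ * Ts)) ^ 2 < q₁ * α ^ 2 :=
      hc.continuousAt.eventually_lt continuousAt_const (by simp; positivity)
    exact ((h0.filter_mono nhdsWithin_le_nhds).and
      (self_mem_nhdsWithin (s := Ioi (0 : ℝ)))).exists
  refine ⟨σ, hσ0, Ts, hTs, √(2 * q₂ / q₁), by positivity, ?_⟩
  intro π hπ₀ hπm hπ hπTs u hu huU l _ hrl x hxc hx z hzc w hz hw hxR hzb T hT
  have hl0 : 0 ≤ π l := hr.trans hrl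
  have hT0 : 0 ≤ T := hl0.trans hT
  set v : ℝ → EuclideanSpace ℝ (Fin m) := fun s => u (s - r - τ) with hv
  have hvm : Measurable v := hu.comp (by fun_prop)
  have hvU : ∀ t, v t ∈ U := fun t => huU _
  set y : ℝ → EuclideanSpace ℝ (Fin n) := fun s => x (s - r) with hy
  have hyc : ContinuousOn y (Ici 0) :=
    hxc.comp (by fun_prop) fun s hs => by simp only [mem_Ici] at hs ⊢; linarith
  have hsub0 : ∀ T', Icc 0 T' ⊆ Ici (0 : ℝ) := fun _ => Icc_subset_Ici_self
  have hsubl : Icc (π l) T ⊆ Icc 0 T := Icc_subset_Icc_left hl0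
  have hbound : ∀ {F : Type} [NormedAddCommGroup F]
      {Ψ : EuclideanSpace ℝ (Fin n) × EuclideanSpace ℝ (Fin m) → F}, Continuous Ψ →
      ∀ {a b : ℝ} {y : ℝ → EuclideanSpace ℝ (Fin n)} {v : ℝ → EuclideanSpace ℝ (Fin m)},
      a ≤ b → ContinuousOn y (Icc a b) → Measurable v → (∀ t, v t ∈ U) →
      IntervalIntegrable (fun t => Ψ (y t, v t)) volume a b ∧
        ∃ B, ∀ t ∈ Icc a b, ‖Ψ (y t, v t)‖ ≤ B := by
    intro F _ Ψ hΨ a b y v hab hyc hvm hvU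
    obtain ⟨B, hB⟩ := exists_forall_norm_comp_le hΨ hUcomp hyc hvU
    exact ⟨intervalIntegrable_of_norm_le hab (aestronglyMeasurable_comp_Icc hΨ hyc hvm) hB, B, hB⟩
  have hψz : ∀ T', 0 ≤ T' → IntervalIntegrable (fun s => fderiv ℝ h (z s) (f (z s) (v s)))
      volume 0 T' ∧ ∃ B, ∀ t ∈ Icc 0 T', ‖fderiv ℝ h (z t) (f (z t) (v t))‖ ≤ B := fun T' hT' =>
    hbound hψ.continuous hT' (hzc.mono (hsub0 T')) hvm hvU
  have hψy := hbound hψ.continuous hT0 (hyc.mono (hsub0 T)) hvm hvU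
  have hfz := hbound hf' hT0 (hzc.mono (hsub0 T)) hvm hvU
  have hfy := hbound hf' hT0 (hyc.mono (hsub0 T)) hvm hvU
  obtain ⟨hfzi, Bz, hBz⟩ := hfz
  obtain ⟨hfyi, By, hBy⟩ := hfy
  obtain ⟨hψyi, Bψ, hBψ⟩ := hψy
  have hmono : ∀ {F : Type} [NormedAddCommGroup F] {g : ℝ → F}, IntervalIntegrable g volume 0 T →
      ∀ {s t : ℝ}, s ∈ Icc 0 T → t ∈ Icc 0 T → IntervalIntegrable g volume s t := by
    intro F _ g hg s t hs ht
    exact hg.mono_set (by rw [uIcc_of_le hT0]; exact uIcc_subset_Icc hs ht)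
  have hwm : AEStronglyMeasurable w (volume.restrict (Icc 0 T)) :=
    aestronglyMeasurable_of_eq_add_integral_on_Ico hπ₀ hπm hπ (fun T' hT' => (hψz T' hT').1) hw
  obtain ⟨Bw, hBw⟩ : ∃ Bw, ∀ t ∈ Icc 0 T, ‖w t‖ ≤ Bw := by
    obtain ⟨B, hB⟩ := (hψz T hT0).2
    obtain ⟨C, hC⟩ := (isCompact_Icc (a := (0 : ℝ)) (b := T)).exists_bound_of_continuousOn
      (hh.continuous.comp_continuousOn (hyc.mono (hsub0 T)))
    exact ⟨_, exists_bound_of_eq_add_integral_on_Ico hπ₀ hπm hπ hB hw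
      fun i hi => hC (π i) ⟨hπ₀ ▸ hπm.monotone (Nat.zero_le i), hi⟩⟩
  obtain ⟨Bh, hBh⟩ := (isCompact_Icc (a := (0 : ℝ)) (b := T)).exists_bound_of_continuousOn
    (hh.continuous.comp_continuousOn (hzc.mono (hsub0 T)))
  have hBk : ∀ t ∈ Icc 0 T, ‖khat (z t) (w t) (v t)‖ ≤ 2 * ‖L‖ * (Bw + Bh) := by
    intro t ht
    have h1 := hkhat_lip (z t) (w t) (h (z t)) (v t)
    rw [hkhat_zero _ _ (hvU t), sub_zero] at h1
    refine h1.trans ?_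
    gcongr
    exact (norm_sub_le _ _).trans (add_le_add (hBw t ht) (hBh t ht))
  have hki : IntervalIntegrable (fun t => khat (z t) (w t) (v t)) volume 0 T := by
    refine intervalIntegrable_of_norm_le hT0 ?_ hBk
    have hzm := ((hzc.mono (hsub0 T)).aestronglyMeasurable (μ := volume) measurableSet_Icc)
    exact (hkhat_meas.comp_aemeasurable
      (hzm.aemeasurable.prodMk (hwm.aemeasurable.prodMk hvm.aemeasurable))).aestronglyMeasurable
  have hyint : ∀ s ∈ Icc (π l) T, ∀ t ∈ Icc (π l) T,
      y t = y s + ∫ s' in s..t, f (y s') (v s') := by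
    intro s hs t ht
    have hshift : ∀ t ∈ Icc (π l) T, y t = x 0 + ∫ s' in r..t, f (y s') (v s') := by
      intro t ht
      have h1 := hx (t - r) (by linarith [ht.1])
      have h2 := intervalIntegral.integral_comp_sub_right (a := r) (b := t)
        (fun s => f (x s) (u (s - τ))) r
      rw [sub_self] at h2
      rw [← h2] at h1
      exact h1
    have hr' : r ∈ Icc 0 T := ⟨hr, hrl.trans hT⟩
    rw [hshift t ht, hshift s hs, add_assoc, intervalIntegral.integral_add_adjacent_intervals]
    · exact hmono hfyi hr' (hsubl hs)
    · exact hmono hfyi (hsubl hs) (hsubl ht)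
  have hgzi := hfzi.add hki
  have hzint : ∀ t ∈ Icc (π l) T,
      z t = z (π l) + ∫ s in (π l)..t, (f (z s) (v s) + khat (z s) (w s) (v s)) := by
    intro t ht
    have hlm : π l ∈ Icc (π l) T := ⟨le_rfl, hT⟩
    rw [hz t (hl0.trans ht.1), hz (π l) hl0, add_assoc,
      intervalIntegral.integral_add_adjacent_intervals]
    · exact hmono hgzi ⟨le_rfl, hT0⟩ (hsubl hlm)
    · exact hmono hgzi (hsubl hlm) (hsubl ht)
  have hlm : π l ∈ Icc (π l) T := ⟨le_rfl, hT⟩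
  set e : ℝ → EuclideanSpace ℝ (Fin n) := fun t => z t - y t with he
  set g : ℝ → EuclideanSpace ℝ (Fin n) := fun t =>
    f (z t) (v t) + khat (z t) (w t) (v t) - f (y t) (v t) with hgdef
  have hgi : IntervalIntegrable g volume (π l) T :=
    hmono (hgzi.sub hfyi) (hsubl hlm) ⟨hT0, le_rfl⟩
  have hgB : ∀ t ∈ Icc (π l) T, ‖g t‖ ≤ Bz + 2 * ‖L‖ * (Bw + Bh) + By := by
    intro t ht
    have ht' := hsubl ht
    exact (norm_sub_le _ _).trans
      (add_le_add (norm_add_le_of_le (hBz t ht') (hBk t ht')) (hBy t ht'))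
  have heint : ∀ t ∈ Icc (π l) T, e t = e (π l) + ∫ s in (π l)..t, g s := by
    intro t ht
    have h1 : ∫ s in (π l)..t, g s =
        (∫ s in (π l)..t, (f (z s) (v s) + khat (z s) (w s) (v s))) -
          ∫ s in (π l)..t, f (y s) (v s) :=
      intervalIntegral.integral_sub (hmono hgzi (hsubl hlm) (hsubl ht))
        (hmono hfyi (hsubl hlm) (hsubl ht))
    rw [h1]
    simp only [he]
    rw [hzint t ht, hyint _ hlm t ht]
    abel
  have hpred : ∀ t ∈ Icc (π l) T, ∀ μ, (∀ s ∈ Icc (π l) t, t - Ts ≤ s → ‖e s‖ ≤ μ) →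
      ‖w t - h (y t)‖ ≤ G * μ * Ts := by
    intro t ht μ hμ
    have hμ0 : 0 ≤ μ := (norm_nonneg _).trans (hμ t ⟨ht.1, le_rfl⟩ (by linarith))
    obtain ⟨i, hi⟩ := exists_mem_Ico_of_tendsto_atTop hπ (hπ₀ ▸ (hsubl ht).1)
    have hli : l ≤ i := Nat.lt_succ_iff.1 (hπm.lt_iff_lt.1 (ht.1.trans_lt hi.2))
    have hπi : π i ∈ Icc (π l) T := ⟨hπm.monotone hli, hi.1.trans ht.2⟩
    have hsubi : Icc (π i) t ⊆ Icc 0 T := Icc_subset_Icc (hsubl hπi).1 ht.2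
    have hψyi' := hmono hψyi (hsubl hπi) (hsubl ht)
    have hhy : h (y t) = h (y (π i)) + ∫ s in (π i)..t, fderiv ℝ h (y s) (f (y s) (v s)) :=
      ContDiff.comp_eq_add_integral hi.1 (hh.of_le (by norm_cast))
        (hmono hfyi (hsubl hπi) (hsubl ht)) (fun s hs => hBy s (hsubi hs))
        (fun s hs => hyint _ hπi s ⟨hπi.1.trans hs.1, hs.2.trans ht.2⟩) (fun _ => rfl)
        hψyi' (fun s hs => hBψ s (hsubi hs))
    rw [hw i t hi, hhy, add_sub_add_left_eq_sub,
      ← intervalIntegral.integral_sub (hmono (hψz T hT0).1 (hsubl hπi) (hsubl ht)) hψyi']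
    refine (intervalIntegral.norm_integral_le_of_norm_le_const (C := G * μ) fun s hs => ?_).trans ?_
    · rw [uIoc_of_le hi.1] at hs
      have hls : π l ≤ s := hπi.1.trans hs.1.le
      refine (hG' _ _ _ (hvU s) (hzb s hls) (hxR s hls)).trans ?_
      gcongr
      exact hμ s ⟨hls, hs.2⟩ (by linarith [hπTs i, hi.2, hs.1])
    · rw [abs_of_nonneg (by linarith [hi.1])]
      gcongr
      linarith [hπTs i, hi.2]
  have hmain := exp_weighted_bound_of_delayed_dissipation Q hQsym hq₁ hq₂ hQ₁ hQ₂ hα hσ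
    hsmall.le hgi hgB heint (by
      intro t ht μ hμ
      have hsplit : g t = (f (z t) (v t) + khat (z t) (h (y t)) (v t) - f (y t) (v t)) +
          (khat (z t) (w t) (v t) - khat (z t) (h (y t)) (v t)) := by
        simp only [hgdef]; abel
      rw [hsplit, map_add, inner_add_right]
      refine add_le_add (hkhat_diss _ _ _ (hvU t) (hzb t ht.1) (hxR t ht.1)) ?_
      calc ⟪e t, Q (khat (z t) (w t) (v t) - khat (z t) (h (y t)) (v t))⟫
          ≤ ‖e t‖ * (‖Q‖ * (2 * ‖L‖ * (G * μ * Ts))) := by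
            refine (real_inner_le_norm _ _).trans ?_
            gcongr
            refine (Q.le_opNorm _).trans ?_
            gcongr
            refine (hkhat_lip _ _ _ _).trans ?_
            gcongr
            exact hpred t ht μ hμ
        _ = K * Ts * μ * ‖e t‖ := by rw [hK]; ring)
  have : Nonempty (Icc (π l) T) := ⟨⟨_, hlm⟩⟩
  refine ciSup_le fun s => ?_
  rw [mul_assoc]
  exact hmain s s.2
end

section
/- There exist constants σ > 0, T_H > 0 and M₂, M₃ > 0 with the following property: for every integer j ≥ 0, every measurable essentially bounded input u : [−τ, ∞) → U and every absolutely continuous function x satisfying ẋ(t) = f(x(t), u(t−τ)) a.e. and x(t) ∈ S₁ for all t ≥ τ + jT_H, one has for all t ≥ jT_H: sup_{jT_H ≤ s ≤ t} (|x(s+τ)| exp(σ s)) ≤ M₂ exp(σ j T_H) |x(jT_H + τ)| + M₃ sup_{jT_H ≤ s ≤ t} (|u(s) − k(x(τ + ⌊s/T_H⌋ T_H))| exp(σ s)), where ⌊·⌋ denotes the integer part. -/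
open MeasureTheory Set Filter
open scoped RealInnerProductSpace Topology

/-- An absolutely continuous function with a.e. nonpositive derivative does not increase. -/
theorem AbsolutelyContinuousOnInterval.le_of_ae_hasDerivAt_nonpos {F : ℝ → ℝ} {a b : ℝ}
    (hab : a ≤ b) (hF : AbsolutelyContinuousOnInterval F a b)
    (hF' : ∀ᵐ s, s ∈ Ioo a b → ∃ d ≤ 0, HasDerivAt F d s) : F b ≤ F a := by
  have hint := hF.integral_deriv_eq_sub
  have hb : ∀ᵐ s : ℝ, s ≠ b := by simp [ae_iff, measure_singleton]
  have hnonneg : 0 ≤ ∫ s in a..b, -deriv F s := by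
    rw [intervalIntegral.integral_of_le hab]
    refine setIntegral_nonneg_of_ae_restrict ?_
    rw [EventuallyLE, ae_restrict_iff' measurableSet_Ioc]
    filter_upwards [hF', hb] with s hs hsb hsab
    obtain ⟨d, hd, hFd⟩ := hs ⟨hsab.1, lt_of_le_of_ne hsab.2 hsb⟩
    simpa [hFd.deriv] using hd
  rw [intervalIntegral.integral_neg] at hnonneg
  linarith

section Decay

variable {E : Type*} [NormedAddCommGroup E] [NormedSpace ℝ E]

/-- The indefinite integral of a bounded function is Lipschitz. -/
theorem lipschitzOnWith_of_eq_add_intervalIntegral {y g : ℝ → E} {a t : ℝ} {B : NNReal}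
    (hat : a ≤ t) (hg : IntervalIntegrable g volume a t) (hB : ∀ s ∈ Icc a t, ‖g s‖ ≤ B)
    (hy : ∀ s ∈ Icc a t, y s = y a + ∫ r in a..s, g r) : LipschitzOnWith B y (Icc a t) := by
  refine LipschitzOnWith.of_dist_le_mul fun s hs r hr => ?_
  have hint : ∀ s ∈ Icc a t, IntervalIntegrable g volume a s := fun s hs =>
    hg.mono_set (by rw [uIcc_of_le hs.1, uIcc_of_le hat]; exact Icc_subset_Icc_right hs.2)
  rw [dist_eq_norm, hy s hs, hy r hr, add_sub_add_left_eq_sub,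
    intervalIntegral.integral_interval_sub_left (hint s hs) (hint r hr), Real.dist_eq]
  refine intervalIntegral.norm_integral_le_of_norm_le_const fun q hq => hB q ?_
  have := uIoc_subset_uIcc hq
  exact uIcc_subset_Icc hr hs this

/-- A dissipation inequality along an absolutely continuous curve, with an input term decaying
at a slower exponential rate, yields a bound with the slower rate. -/
theorem exp_weighted_le_of_dissipation [CompleteSpace E] {P : E → ℝ} (hP : ContDiff ℝ 1 P)
    (hPnonneg : ∀ x, 0 ≤ P x) {y g : ℝ → E}
    {a t σ c : ℝ} {B : NNReal} (hat : a ≤ t) (hσ : 0 < σ) (hc : 0 ≤ c)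
    (hg : IntervalIntegrable g volume a t) (hB : ∀ s ∈ Icc a t, ‖g s‖ ≤ B)
    (hy : ∀ s ∈ Icc a t, y s = y a + ∫ r in a..s, g r)
    (hdiss : ∀ s ∈ Icc a t,
      fderiv ℝ P (y s) (g s) ≤ -(4 * σ) * P (y s) + c * Real.exp (-(2 * σ * s))) :
    P (y t) * Real.exp (2 * σ * t) ≤ P (y a) * Real.exp (2 * σ * a) + c / (2 * σ) := by
  have hlip := lipschitzOnWith_of_eq_add_intervalIntegral hat hg hB hy
  have hPlip : LocallyLipschitzOn (y '' Icc a t) P := hP.locallyLipschitz.locallyLipschitzOn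
  obtain ⟨K, hK⟩ := hPlip.exists_lipschitzOnWith_of_compact
    (isCompact_Icc.image_of_continuousOn hlip.continuousOn)
  have hPy : AbsolutelyContinuousOnInterval (fun s => P (y s)) a t := by
    have := hK.comp hlip (mapsTo_image y _)
    rw [← uIcc_of_le hat] at this
    exact this.absolutelyContinuousOnInterval
  have hexp : ∀ γ : ℝ, AbsolutelyContinuousOnInterval (fun s => Real.exp (γ * s)) a t := fun γ =>
    ContDiffOn.absolutelyContinuousOnInterval (by fun_prop)
  have hF := (hPy.fun_mul (hexp (4 * σ))).fun_sub ((hexp (2 * σ)).const_mul (c / (2 * σ)))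
  have key := hF.le_of_ae_hasDerivAt_nonpos hat (by
    filter_upwards [hg.ae_hasDerivAt_integral] with s hs hsat
    have hsI : s ∈ Icc a t := Ioo_subset_Icc_self hsat
    have hyd : HasDerivAt y (g s) s := by
      refine ((hs (by rwa [uIcc_of_le hat]) a left_mem_uIcc).const_add (y a)).congr_of_eventuallyEq
        ?_
      filter_upwards [Icc_mem_nhds hsat.1 hsat.2] with r hr using hy r hr
    have hPd : HasDerivAt (fun s => P (y s)) (fderiv ℝ P (y s) (g s)) s :=
      (hP.differentiable one_ne_zero (y s)).hasFDerivAt.comp_hasDerivAt s hyd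
    have hed : ∀ γ : ℝ, HasDerivAt (fun s => Real.exp (γ * s)) (Real.exp (γ * s) * (γ * 1)) s :=
      fun γ => ((hasDerivAt_id s).const_mul γ).exp
    refine ⟨_, ?_, (hPd.mul (hed (4 * σ))).sub ((hed (2 * σ)).const_mul (c / (2 * σ)))⟩
    have h1 := mul_le_mul_of_nonneg_right (hdiss s hsI) (Real.exp_pos (4 * σ * s)).le
    have h2 : Real.exp (-(2 * σ * s)) * Real.exp (4 * σ * s) = Real.exp (2 * σ * s) := by
      rw [← Real.exp_add]; ring_nf
    have h3 : c / (2 * σ) * (Real.exp (2 * σ * s) * (2 * σ * 1)) = c * Real.exp (2 * σ * s) := by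
      field_simp
    rw [h3, ← h2]
    linarith)
  have hsplit : ∀ s, Real.exp (4 * σ * s) = Real.exp (2 * σ * s) * Real.exp (2 * σ * s) := by
    intro s
    rw [← Real.exp_add]; ring_nf
  simp only [hsplit] at key
  have hmono : Real.exp (2 * σ * a) ≤ Real.exp (2 * σ * t) := by gcongr
  have h0 : 0 ≤ c / (2 * σ) * Real.exp (2 * σ * a) := by positivity
  have h1 := mul_le_mul_of_nonneg_left hmono
    (mul_nonneg (hPnonneg (y a)) (Real.exp_pos (2 * σ * a)).le)
  refine le_of_mul_le_mul_right ?_ (Real.exp_pos (2 * σ * t))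
  linarith

end Decay

/-- A `C²` function with a zero minimum at the origin is quadratically bounded on balls. -/
theorem exists_quadratic_bound_of_isMinOn_zero {E : Type*} [NormedAddCommGroup E]
    [NormedSpace ℝ E] [ProperSpace E] {P : E → ℝ} (hP : ContDiff ℝ 2 P) (hP0 : P 0 = 0)
    (hPnonneg : ∀ x, 0 ≤ P x) (ρ : ℝ) :
    ∃ C : ℝ, 0 < C ∧ ∀ x ∈ Metric.closedBall (0 : E) ρ,
      ‖fderiv ℝ P x‖ ≤ C * ‖x‖ ∧ P x ≤ C * ‖x‖ ^ 2 := by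
  have hD : ContDiff ℝ 1 (fderiv ℝ P) := hP.fderiv_right (by norm_num)
  have hD0 : fderiv ℝ P 0 = 0 :=
    IsLocalMin.fderiv_eq_zero (Eventually.of_forall fun x => by rw [hP0]; exact hPnonneg x)
  obtain ⟨K, hK⟩ := (hD.locallyLipschitz.locallyLipschitzOn
    (s := Metric.closedBall (0 : E) ρ)).exists_lipschitzOnWith_of_compact
      (isCompact_closedBall 0 ρ)
  have hbound : ∀ x ∈ Metric.closedBall (0 : E) ρ, ‖fderiv ℝ P x‖ ≤ (K + 1) * ‖x‖ := by
    intro x hx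
    have h0 : (0 : E) ∈ Metric.closedBall (0 : E) ρ := by
      simpa using (norm_nonneg x).trans (by simpa using hx)
    have := hK.norm_sub_le hx h0
    rw [hD0, sub_zero, sub_zero] at this
    nlinarith [norm_nonneg x]
  refine ⟨K + 1, by positivity, fun x hx => ⟨hbound x hx, ?_⟩⟩
  have hx' : ‖x‖ ≤ ρ := by simpa using hx
  have := (convex_closedBall (0 : E) ‖x‖).norm_image_sub_le_of_norm_fderiv_le (𝕜 := ℝ) (f := P)
    (C := (K + 1) * ‖x‖) (x := 0) (y := x)
    (fun z _ => hP.differentiable two_ne_zero z)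
    (fun z hz => by
      have hz' : ‖z‖ ≤ ‖x‖ := by simpa using hz
      refine (hbound z (by simpa using hz'.trans hx')).trans ?_
      gcongr) (by simp) (by simp)
  rw [hP0, sub_zero, sub_zero, Real.norm_of_nonneg (hPnonneg x)] at this
  linarith [this, sq ‖x‖]

/-- Under a sampled-and-held feedback with sampling period `T`, the mismatch between the input and
the continuous feedback decays at the exponential rate of the weighted bounds on the state and on
the sampled mismatch. -/
theorem norm_sub_feedback_le_of_sampled {E F : Type*} [NormedAddCommGroup E] [NormedSpace ℝ E]
    [NormedAddCommGroup F] {y g : ℝ → E} {u : ℝ → F} {k : E → F} {S : Set E}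
    {a s σ T L N X ε : ℝ} {q : ℝ → ℝ} (hσ : 0 ≤ σ) (hT1 : T ≤ 1) (hL : 0 ≤ L)
    (hN : 0 ≤ N) (has : a ≤ s)
    (hq : ∀ r ∈ Icc a s, a ≤ q r ∧ q r ≤ r ∧ r - q r ≤ T)
    (hqs : ∀ r ∈ Icc (q s) s, q r = q s)
    (hg : IntervalIntegrable g volume a s)
    (hy : ∀ r ∈ Icc a s, y r = y a + ∫ v in a..r, g v)
    (hyS : ∀ r ∈ Icc a s, y r ∈ S)
    (hk0 : k 0 = 0) (h0S : (0 : E) ∈ S)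
    (hk : ∀ v ∈ S, ∀ w ∈ S, ‖k v - k w‖ ≤ N * ‖v - w‖)
    (hgL : ∀ r ∈ Icc a s, ‖g r‖ ≤ L * (‖y r‖ + ‖u r‖))
    (hX : ∀ r ∈ Icc a s, ‖y r‖ * Real.exp (σ * r) ≤ X)
    (hε : ∀ r ∈ Icc a s, ‖u r - k (y (q r))‖ * Real.exp (σ * r) ≤ ε) :
    ‖u s - k (y s)‖ ≤
      (ε + T * (N * L * Real.exp σ * (1 + N)) * (X + ε)) * Real.exp (-(σ * s)) := by
  have hs : s ∈ Icc a s := right_mem_Icc.2 has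
  obtain ⟨haq, hqle, hqT⟩ := hq s hs
  have hqI : q s ∈ Icc a s := ⟨haq, hqle⟩
  have hdiv : ∀ {p r C : ℝ}, 0 ≤ p → q s ≤ r → p * Real.exp (σ * r) ≤ C →
      p ≤ C * (Real.exp σ * Real.exp (-(σ * s))) := by
    intro p r C hp hr h
    have hC : 0 ≤ C := (mul_nonneg hp (Real.exp_pos _).le).trans h
    have h1 : p ≤ C * Real.exp (-(σ * r)) := by
      rw [Real.exp_neg, ← div_eq_mul_inv, le_div_iff₀ (Real.exp_pos _)]; exact h
    refine h1.trans (mul_le_mul_of_nonneg_left ?_ hC)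
    rw [← Real.exp_add]
    exact Real.exp_le_exp.2 (by nlinarith)
  set w := Real.exp σ * Real.exp (-(σ * s)) with hw
  have hw0 : 0 ≤ w := by positivity
  have hgbound : ∀ r ∈ Icc (q s) s, ‖g r‖ ≤ L * ((1 + N) * (X + ε) * w) := by
    intro r hr
    have hrI : r ∈ Icc a s := ⟨haq.trans hr.1, hr.2⟩
    have h1 : ‖y r‖ ≤ X * w := hdiv (norm_nonneg _) hr.1 (hX r hrI)
    have h2 : ‖y (q s)‖ ≤ X * w := hdiv (norm_nonneg _) le_rfl (hX _ hqI)
    have h3 : ‖u r - k (y (q s))‖ ≤ ε * w := by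
      have := hε r hrI
      rw [hqs r hr] at this
      exact hdiv (norm_nonneg _) hr.1 this
    have h4 : ‖k (y (q s))‖ ≤ N * ‖y (q s)‖ := by
      simpa [hk0] using hk _ (hyS _ hqI) 0 h0S
    have h5 : ‖u r‖ ≤ ε * w + N * (X * w) := by
      calc ‖u r‖ = ‖(u r - k (y (q s))) + k (y (q s))‖ := by rw [sub_add_cancel]
        _ ≤ _ := norm_add_le _ _
        _ ≤ _ := add_le_add h3 (h4.trans (mul_le_mul_of_nonneg_left h2 hN))
    refine (hgL r hrI).trans (mul_le_mul_of_nonneg_left ?_ hL)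
    have : 0 ≤ N * (ε * w) := mul_nonneg hN ((norm_nonneg _).trans h3)
    linarith
  have hXε : 0 ≤ L * ((1 + N) * (X + ε) * w) :=
    (norm_nonneg _).trans (hgbound s ⟨hqle, le_rfl⟩)
  have hdiff : ‖y s - y (q s)‖ ≤ L * ((1 + N) * (X + ε) * w) * T := by
    rw [hy s hs, hy _ hqI, add_sub_add_left_eq_sub,
      intervalIntegral.integral_interval_sub_left hg
        (hg.mono_set (by rw [uIcc_of_le haq, uIcc_of_le has]; exact Icc_subset_Icc_right hqle))]
    refine (intervalIntegral.norm_integral_le_of_norm_le_const fun r hr => hgbound r ?_).trans ?_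
    · rw [uIoc_of_le hqle] at hr
      exact Ioc_subset_Icc_self hr
    · rw [abs_of_nonneg (sub_nonneg.2 hqle)]
      exact mul_le_mul_of_nonneg_left hqT hXε
  have hεs : ‖u s - k (y (q s))‖ ≤ ε * Real.exp (-(σ * s)) := by
    rw [Real.exp_neg, ← div_eq_mul_inv, le_div_iff₀ (Real.exp_pos _)]
    exact hε s hs
  have hks := hk _ (hyS _ hqI) _ (hyS _ hs)
  rw [norm_sub_rev (y (q s))] at hks
  calc ‖u s - k (y s)‖ = ‖(u s - k (y (q s))) + (k (y (q s)) - k (y s))‖ := by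
        rw [sub_add_sub_cancel]
    _ ≤ _ := norm_add_le _ _
    _ ≤ ε * Real.exp (-(σ * s)) + N * (L * ((1 + N) * (X + ε) * w) * T) :=
        add_le_add hεs (hks.trans (mul_le_mul_of_nonneg_left hdiff hN))
    _ = _ := by rw [hw]; ring

/-- Input-to-state estimate with exponential weights from a quadratically bounded Lyapunov
function. -/
theorem norm_mul_exp_le_of_lyapunov {E : Type*} [NormedAddCommGroup E] [NormedSpace ℝ E]
    [CompleteSpace E] {P : E → ℝ} (hP : ContDiff ℝ 1 P) (hPnonneg : ∀ x, 0 ≤ P x) {y g : ℝ → E}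
    {a s μ C K H L A : ℝ} {B : NNReal} (has : a ≤ s) (hμ : 0 < μ) (hC : 0 < C) (hK : 0 < K)
    (hA : 0 ≤ A)
    (hg : IntervalIntegrable g volume a s) (hB : ∀ r ∈ Icc a s, ‖g r‖ ≤ B)
    (hy : ∀ r ∈ Icc a s, y r = y a + ∫ v in a..r, g v)
    (hPlower : ∀ r ∈ Icc a s, K * ‖y r‖ ^ 2 ≤ P (y r))
    (hPupper : ∀ r ∈ Icc a s, P (y r) ≤ C * ‖y r‖ ^ 2)
    (hdiss : ∀ r ∈ Icc a s, fderiv ℝ P (y r) (g r) ≤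
      -2 * μ * ‖y r‖ ^ 2 + C * ‖y r‖ * (L * (A * Real.exp (-(μ / (4 * C) * r)))))
    (hH : H = 1 + C / K + C ^ 3 * L ^ 2 / (2 * μ ^ 2 * K)) :
    ‖y s‖ * Real.exp (μ / (4 * C) * s) ≤ H * (‖y a‖ * Real.exp (μ / (4 * C) * a) + A) := by
  set σ := μ / (4 * C) with hσ
  have hσ0 : 0 < σ := by positivity
  have hexp2 : ∀ r, Real.exp (2 * σ * r) = Real.exp (σ * r) ^ 2 := fun r => by
    rw [sq, ← Real.exp_add]; ring_nf
  have hexp2' : ∀ r, Real.exp (-(2 * σ * r)) = Real.exp (-(σ * r)) ^ 2 := fun r => by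
    rw [sq, ← Real.exp_add]; ring_nf
  have hmain := exp_weighted_le_of_dissipation hP hPnonneg (c := (C * L * A) ^ 2 / (4 * μ)) has hσ0
    (by positivity) hg hB hy (fun r hr => by
      refine (hdiss r hr).trans ?_
      have hsq : C * ‖y r‖ * (L * (A * Real.exp (-(σ * r)))) ≤
          μ * ‖y r‖ ^ 2 + (C * L * A) ^ 2 / (4 * μ) * Real.exp (-(σ * r)) ^ 2 := by
        have : μ * ‖y r‖ ^ 2 + (C * L * A) ^ 2 / (4 * μ) * Real.exp (-(σ * r)) ^ 2 -
            C * ‖y r‖ * (L * (A * Real.exp (-(σ * r)))) =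
            (2 * μ * ‖y r‖ - C * L * A * Real.exp (-(σ * r))) ^ 2 / (4 * μ) := by
          field_simp
          ring
        have hpos : 0 ≤ (2 * μ * ‖y r‖ - C * L * A * Real.exp (-(σ * r))) ^ 2 / (4 * μ) := by
          positivity
        linarith
      have hPle : 4 * σ * P (y r) ≤ μ * ‖y r‖ ^ 2 := by
        calc 4 * σ * P (y r) ≤ 4 * σ * (C * ‖y r‖ ^ 2) := by
              gcongr
              exact hPupper r hr
          _ = _ := by rw [hσ]; field_simp
      rw [hexp2']
      linarith)
  rw [hexp2, hexp2] at hmain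
  have ha : a ∈ Icc a s := left_mem_Icc.2 has
  have hs : s ∈ Icc a s := right_mem_Icc.2 has
  have h1 := mul_le_mul_of_nonneg_right (hPlower s hs) (sq_nonneg (Real.exp (σ * s)))
  have h2 := mul_le_mul_of_nonneg_right (hPupper a ha) (sq_nonneg (Real.exp (σ * a)))
  set w := ‖y s‖ * Real.exp (σ * s) with hw
  set z := ‖y a‖ * Real.exp (σ * a) with hz
  have hz0 : 0 ≤ z := by positivity
  have hc : (C * L * A) ^ 2 / (4 * μ) / (2 * σ) =
      K * (C ^ 3 * L ^ 2 / (2 * μ ^ 2 * K) * A ^ 2) := by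
    rw [hσ]; field_simp
  have hCK : C * z ^ 2 = K * (C / K * z ^ 2) := by field_simp
  have h3 : w ^ 2 ≤ C / K * z ^ 2 + C ^ 3 * L ^ 2 / (2 * μ ^ 2 * K) * A ^ 2 := by
    refine le_of_mul_le_mul_left ?_ hK
    rw [hc] at hmain
    rw [mul_add, ← hCK]
    have e1 : K * w ^ 2 = K * ‖y s‖ ^ 2 * Real.exp (σ * s) ^ 2 := by rw [hw]; ring
    have e2 : C * z ^ 2 = C * ‖y a‖ ^ 2 * Real.exp (σ * a) ^ 2 := by rw [hz]; ring
    linarith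
  have hp1 : 0 ≤ C / K := by positivity
  have hp2 : 0 ≤ C ^ 3 * L ^ 2 / (2 * μ ^ 2 * K) := by positivity
  have hH1 : C / K ≤ H ^ 2 := by nlinarith
  have hH2 : C ^ 3 * L ^ 2 / (2 * μ ^ 2 * K) ≤ H ^ 2 := by nlinarith
  have hH0 : 0 ≤ H := by linarith
  refine (sq_le_sq₀ (by positivity) (by positivity)).1 ?_
  have h4 := mul_le_mul_of_nonneg_right hH1 (sq_nonneg z)
  have h5 := mul_le_mul_of_nonneg_right hH2 (sq_nonneg A)
  have h6 : 0 ≤ H ^ 2 * (2 * z * A) := by positivity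
  calc w ^ 2 ≤ H ^ 2 * z ^ 2 + H ^ 2 * A ^ 2 := by linarith
    _ ≤ (H * (z + A)) ^ 2 := by linarith

/-- The right-hand side of a controlled equation is integrable along continuous trajectories for
measurable inputs with values in a compact set. -/
theorem intervalIntegrable_controlled {n m : ℕ}
    {f : EuclideanSpace ℝ (Fin n) → EuclideanSpace ℝ (Fin m) → EuclideanSpace ℝ (Fin n)}
    (hf : Continuous (fun p : EuclideanSpace ℝ (Fin n) × EuclideanSpace ℝ (Fin m) => f p.1 p.2))
    {U : Set (EuclideanSpace ℝ (Fin m))} (hU : IsCompact U)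
    {x : ℝ → EuclideanSpace ℝ (Fin n)} {u : ℝ → EuclideanSpace ℝ (Fin m)} {p q : ℝ} (hpq : p ≤ q)
    (hx : ContinuousOn x (Icc p q)) (hu : Measurable u) (huU : ∀ s ∈ Icc p q, u s ∈ U) :
    IntervalIntegrable (fun s => f (x s) (u s)) volume p q := by
  rw [intervalIntegrable_iff_integrableOn_Icc_of_le hpq]
  obtain ⟨C, hC⟩ :=
    (((isCompact_Icc.image_of_continuousOn hx).prod hU).image hf).isBounded.exists_norm_le
  refine Integrable.of_bound ?_ C ?_
  · exact hf.comp_aestronglyMeasurable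
      ((hx.aestronglyMeasurable measurableSet_Icc).prodMk hu.aestronglyMeasurable)
  · filter_upwards [ae_restrict_mem measurableSet_Icc] with s hs
    exact hC _ ⟨(x s, u s), ⟨mem_image_of_mem x hs, huU s hs⟩, rfl⟩

/-- Lemma 3.2: under (H1), (H2), there exist constants `σ, T_H, M₂, M₃ > 0`
such that for every integer `j ≥ 0`, every admissible input `u` and every solution `x` of
`ẋ(t) = f(x(t), u(t−τ))` with `x(t) ∈ S₁` for all `t ≥ τ + jT_H`, one has for all
`t ≥ jT_H`:
`sup_{jT_H ≤ s ≤ t} (|x(s+τ)|e^{σs}) ≤ M₂ e^{σjT_H}|x(jT_H+τ)| + M₃ sup_{jT_H ≤ s ≤ t} (|u(s) − k(x(τ + ⌊s/T_H⌋T_H))| e^{σs})`. -/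
theorem stmt_5
    (n m : ℕ)
    (f : EuclideanSpace ℝ (Fin n) → EuclideanSpace ℝ (Fin m) → EuclideanSpace ℝ (Fin n))
    (hf : ContDiff ℝ (⊤ : ℕ∞) (fun p : EuclideanSpace ℝ (Fin n) × EuclideanSpace ℝ (Fin m) => f p.1 p.2))
    (hf0 : f 0 0 = 0)
    (U : Set (EuclideanSpace ℝ (Fin m))) (hUcomp : IsCompact U) (hU0 : (0 : EuclideanSpace ℝ (Fin m)) ∈ U)
    (τ : ℝ) (hτ : 0 ≤ τ)
    -- (H1)
    (V : EuclideanSpace ℝ (Fin n) → ℝ) (hV : ContDiff ℝ 2 V) (hVnonneg : ∀ x, 0 ≤ V x)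
    (hVradial : ∀ M : ℝ, Bornology.IsBounded {x | V x ≤ M})
    (W : EuclideanSpace ℝ (Fin n) → ℝ) (hW : ContDiff ℝ 1 W)
    (hWpos : W 0 = 0 ∧ ∀ x ≠ 0, 0 < W x)
    (R : ℝ) (hR : 0 < R)
    (hH1 : ∀ x u, u ∈ U → R ≤ V x → ⟪gradient V x, f x u⟫ ≤ -W x)
    (hS1nhds : {x | V x ≤ R} ∈ 𝓝 (0 : EuclideanSpace ℝ (Fin n)))
    -- (H2)
    (P : EuclideanSpace ℝ (Fin n) → ℝ) (hP : ContDiff ℝ 2 P)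
    (hPpos : P 0 = 0 ∧ ∀ x ≠ 0, 0 < P x)
    (μ K₁ : ℝ) (hμ : 0 < μ) (hK₁ : 0 < K₁)
    (hPlower : ∀ x, V x ≤ R → K₁ * ‖x‖ ^ 2 ≤ P x)
    (kctrl : EuclideanSpace ℝ (Fin n) → EuclideanSpace ℝ (Fin m))
    (hkU : ∀ x, kctrl x ∈ U) (hk0 : kctrl 0 = 0) (hklip : LocallyLipschitz kctrl)
    (hH2 : ∀ x, V x ≤ R → ⟪gradient P x, f x (kctrl x)⟫ ≤ -2 * μ * ‖x‖ ^ 2)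
    -- `S₂ = {V ≤ b}` with `b > R` from (H3)
    (b : ℝ) (hbR : R < b) :
    ∃ σ : ℝ, 0 < σ ∧ ∃ TH : ℝ, 0 < TH ∧ ∃ M₂ M₃ : ℝ, 0 < M₂ ∧ 0 < M₃ ∧
      ∀ j : ℕ,
        ∀ u : ℝ → EuclideanSpace ℝ (Fin m), Measurable u → (∀ t, -τ ≤ t → u t ∈ U) →
          ∀ x : ℝ → EuclideanSpace ℝ (Fin n), ContinuousOn x (Ici 0) →
            (∀ t, 0 ≤ t → x t = x 0 + ∫ s in (0:ℝ)..t, f (x s) (u (s - τ))) →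
            (∀ t, τ + (j : ℝ) * TH ≤ t → V (x t) ≤ R) →
            ∀ t, (j : ℝ) * TH ≤ t →
              (⨆ s : Icc ((j : ℝ) * TH) t, ‖x ((s : ℝ) + τ)‖ * Real.exp (σ * s)) ≤
                M₂ * Real.exp (σ * ((j : ℝ) * TH)) * ‖x ((j : ℝ) * TH + τ)‖ +
                  M₃ * ⨆ s : Icc ((j : ℝ) * TH) t,
                    ‖u s - kctrl (x (τ + (⌊(s : ℝ) / TH⌋ : ℝ) * TH))‖ * Real.exp (σ * s) := by
  obtain ⟨ρ, hρS⟩ := (hVradial R).subset_closedBall 0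
  obtain ⟨ρ', hρU⟩ := hUcomp.isBounded.subset_closedBall 0
  set S : Set (EuclideanSpace ℝ (Fin n)) := Metric.closedBall 0 ρ with hS
  have hScomp : IsCompact S := isCompact_closedBall 0 ρ
  have h0S : (0 : EuclideanSpace ℝ (Fin n)) ∈ S := hρS (mem_of_mem_nhds hS1nhds)
  have hPnonneg : ∀ x, 0 ≤ P x := fun x => by
    by_cases hx : x = 0
    · rw [hx, hPpos.1]
    · exact (hPpos.2 x hx).le
  obtain ⟨C, hC, hCbound⟩ := exists_quadratic_bound_of_isMinOn_zero hP hPpos.1 hPnonneg ρ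
  obtain ⟨N, hN⟩ := (hklip.locallyLipschitzOn (s := S)).exists_lipschitzOnWith_of_compact hScomp
  obtain ⟨L, hL⟩ := ((hf.of_le (by exact_mod_cast le_top)).locallyLipschitz.locallyLipschitzOn
    (s := S ×ˢ U)).exists_lipschitzOnWith_of_compact (hScomp.prod hUcomp)
  have hLu : ∀ v ∈ S, ∀ w ∈ U, ∀ w' ∈ U, ‖f v w - f v w'‖ ≤ L * ‖w - w'‖ := by
    intro v hv w hw w' hw'
    simpa [Prod.norm_def] using hL.norm_sub_le (mk_mem_prod hv hw) (mk_mem_prod hv hw')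
  have hL0 : ∀ v ∈ S, ∀ w ∈ U, ‖f v w‖ ≤ L * (‖v‖ + ‖w‖) := by
    intro v hv w hw
    have := hL.norm_sub_le (mk_mem_prod hv hw) (mk_mem_prod h0S hU0)
    simp only [hf0, sub_zero, Prod.mk_sub_mk] at this
    refine this.trans (mul_le_mul_of_nonneg_left ?_ L.2)
    exact max_le (by simp) (by simp)
  set σ := μ / (4 * C) with hσ
  have hσ0 : 0 < σ := by positivity
  obtain ⟨H, hH⟩ : ∃ H : ℝ, H = 1 + C / K₁ + C ^ 3 * (L : ℝ) ^ 2 / (2 * μ ^ 2 * K₁) := ⟨_, rfl⟩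
  have hH0 : 0 < H := by rw [hH]; positivity
  obtain ⟨D, hD⟩ : ∃ D : ℝ, D = N * L * Real.exp σ * (1 + N) := ⟨_, rfl⟩
  have hD0 : 0 ≤ D := by rw [hD]; positivity
  set T := 1 / (1 + 2 * H * D) with hT
  have hT0 : 0 < T := by positivity
  have hT1 : T ≤ 1 := by
    rw [hT, div_le_one (by positivity)]
    linarith [mul_nonneg hH0.le hD0]
  have hHTD : H * T * D ≤ 1 / 2 := by
    rw [hT, mul_one_div, div_mul_eq_mul_div, div_le_div_iff₀ (by positivity) two_pos]
    linarith
  refine ⟨σ, hσ0, T, hT0, 2 * H, 2 * H * (1 + D), by positivity, by positivity, ?_⟩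
  intro j u hu huU x hx hxint hxV t hat
  set a := (j : ℝ) * T with ha
  have ha0 : 0 ≤ a := by positivity
  have : Nonempty (Icc a t) := ⟨⟨a, left_mem_Icc.2 hat⟩⟩
  have hyV : ∀ s, a ≤ s → V (x (s + τ)) ≤ R := fun s hs => hxV _ (by linarith)
  have hyS : ∀ s, a ≤ s → x (s + τ) ∈ S := fun s hs => hρS (hyV s hs)
  have huU' : ∀ s, a ≤ s → u s ∈ U := fun s hs => huU s (by linarith)
  have hycont : ContinuousOn (fun s => x (s + τ)) (Icc a t) :=
    hx.comp (by fun_prop) fun s hs => add_nonneg (ha0.trans hs.1) hτ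
  have hg : IntervalIntegrable (fun s => f (x (s + τ)) (u s)) volume a t :=
    intervalIntegrable_controlled hf.continuous hUcomp hat hycont hu fun s hs => huU' s hs.1
  have hg' : ∀ s ∈ Icc a t, IntervalIntegrable (fun s => f (x (s + τ)) (u s)) volume a s :=
    fun s hs => hg.mono_set (by
      rw [uIcc_of_le hs.1, uIcc_of_le hat]; exact Icc_subset_Icc_right hs.2)
  have hy : ∀ s ∈ Icc a t, x (s + τ) = x (a + τ) + ∫ r in a..s, f (x (r + τ)) (u r) := by
    intro s hs
    have hint : ∀ p, 0 ≤ p → IntervalIntegrable (fun s => f (x s) (u (s - τ))) volume 0 p :=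
      fun p hp => intervalIntegrable_controlled (u := fun s => u (s - τ)) hf.continuous hUcomp hp
        (hx.mono Icc_subset_Ici_self) (hu.comp (measurable_id.sub_const τ))
        fun r hr => huU _ (by linarith [hr.1])
    have hshift := intervalIntegral.integral_comp_add_right (a := a) (b := s)
      (fun r => f (x r) (u (r - τ))) τ
    simp only [add_sub_cancel_right] at hshift
    have ha' : 0 ≤ a + τ := add_nonneg ha0 hτ
    have hs' : 0 ≤ s + τ := add_nonneg (ha0.trans hs.1) hτ
    rw [hshift, ← intervalIntegral.integral_interval_sub_left (hint _ hs') (hint _ ha'),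
      hxint _ hs', hxint _ ha']
    abel
  have hfloor : ∀ s, a ≤ s →
      a ≤ (⌊s / T⌋ : ℝ) * T ∧ (⌊s / T⌋ : ℝ) * T ≤ s ∧ s - (⌊s / T⌋ : ℝ) * T ≤ T := by
    intro s hs
    have h1 : (j : ℤ) ≤ ⌊s / T⌋ := Int.le_floor.2 (by
      rw [le_div_iff₀ hT0]; exact_mod_cast hs)
    have h2 := Int.floor_le (s / T)
    have h3 := Int.lt_floor_add_one (s / T)
    rw [le_div_iff₀ hT0] at h2
    rw [div_lt_iff₀ hT0] at h3
    refine ⟨mul_le_mul_of_nonneg_right (by exact_mod_cast h1) hT0.le, h2, by linarith⟩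
  have hexple : ∀ s ∈ Icc a t, Real.exp (σ * s) ≤ Real.exp (σ * t) := fun s hs =>
    Real.exp_le_exp.2 (mul_le_mul_of_nonneg_left hs.2 hσ0.le)
  have hXbdd : BddAbove (range fun s : Icc a t => ‖x ((s : ℝ) + τ)‖ * Real.exp (σ * s)) := by
    refine ⟨ρ * Real.exp (σ * t), ?_⟩
    rintro _ ⟨s, rfl⟩
    have h1 : ‖x ((s : ℝ) + τ)‖ ≤ ρ := by simpa [hS] using hyS s s.2.1
    exact mul_le_mul h1 (hexple s s.2) (Real.exp_pos _).le ((norm_nonneg _).trans h1)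
  have hEbdd : BddAbove (range fun s : Icc a t =>
      ‖u s - kctrl (x (τ + (⌊(s : ℝ) / T⌋ : ℝ) * T))‖ * Real.exp (σ * s)) := by
    refine ⟨(ρ' + ρ') * Real.exp (σ * t), ?_⟩
    rintro _ ⟨s, rfl⟩
    have h1 : ‖u s‖ ≤ ρ' := by simpa using hρU (huU' s s.2.1)
    have h2 : ‖kctrl (x (τ + (⌊(s : ℝ) / T⌋ : ℝ) * T))‖ ≤ ρ' := by simpa using hρU (hkU _)
    have h3 := (norm_sub_le (u s) (kctrl (x (τ + (⌊(s : ℝ) / T⌋ : ℝ) * T)))).trans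
      (add_le_add h1 h2)
    exact mul_le_mul h3 (hexple s s.2) (Real.exp_pos _).le ((norm_nonneg _).trans h3)
  set X := ⨆ s : Icc a t, ‖x ((s : ℝ) + τ)‖ * Real.exp (σ * s) with hX
  set ε := ⨆ s : Icc a t,
    ‖u s - kctrl (x (τ + (⌊(s : ℝ) / T⌋ : ℝ) * T))‖ * Real.exp (σ * s) with hε
  have hXle : ∀ s ∈ Icc a t, ‖x (s + τ)‖ * Real.exp (σ * s) ≤ X := fun s hs =>
    le_ciSup hXbdd ⟨s, hs⟩
  have hεle : ∀ s ∈ Icc a t,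
      ‖u s - kctrl (x ((⌊s / T⌋ : ℝ) * T + τ))‖ * Real.exp (σ * s) ≤ ε := fun s hs => by
    rw [add_comm _ τ]
    exact le_ciSup hEbdd ⟨s, hs⟩
  have hX0 : 0 ≤ X := le_trans (by positivity) (hXle a (left_mem_Icc.2 hat))
  have hε0 : 0 ≤ ε := le_trans (by positivity) (hεle a (left_mem_Icc.2 hat))
  obtain ⟨A, hA⟩ : ∃ A : ℝ, A = ε + T * D * (X + ε) := ⟨_, rfl⟩
  have hA0 : 0 ≤ A := by rw [hA]; positivity
  have hmismatch : ∀ s ∈ Icc a t, ‖u s - kctrl (x (s + τ))‖ ≤ A * Real.exp (-(σ * s)) := by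
    intro s hs
    have hsub : Icc a s ⊆ Icc a t := Icc_subset_Icc_right hs.2
    rw [hA, hD]
    refine norm_sub_feedback_le_of_sampled (y := fun s => x (s + τ)) (k := kctrl) (S := S)
      (q := fun r => (⌊r / T⌋ : ℝ) * T) hσ0.le hT1 L.2 N.2 hs.1 (fun r hr => hfloor r hr.1) ?_
      (hg' s hs) (fun r hr => hy r (hsub hr)) (fun r hr => hyS r hr.1) hk0 h0S
      (fun v hv w hw => hN.norm_sub_le hv hw) (fun r hr => hL0 _ (hyS r hr.1) _ (huU' r hr.1))
      (fun r hr => hXle r (hsub hr)) (fun r hr => hεle r (hsub hr))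
    intro r hr
    have h1 : ⌊s / T⌋ ≤ ⌊r / T⌋ := Int.le_floor.2 ((le_div_iff₀ hT0).2 hr.1)
    have h2 : ⌊r / T⌋ ≤ ⌊s / T⌋ := Int.floor_le_floor (by gcongr; exact hr.2)
    simp only [le_antisymm h2 h1]
  have hgB : ∀ s ∈ Icc a t, ‖f (x (s + τ)) (u s)‖ ≤ L * (ρ + ρ') := fun s hs => by
    refine (hL0 _ (hyS s hs.1) _ (huU' s hs.1)).trans (mul_le_mul_of_nonneg_left ?_ L.2)
    exact add_le_add (by simpa [hS] using hyS s hs.1) (by simpa using hρU (huU' s hs.1))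
  have hbound : ∀ s ∈ Icc a t,
      ‖x (s + τ)‖ * Real.exp (σ * s) ≤ H * (‖x (a + τ)‖ * Real.exp (σ * a) + A) := by
    intro s hs
    have hsub : Icc a s ⊆ Icc a t := Icc_subset_Icc_right hs.2
    refine norm_mul_exp_le_of_lyapunov (y := fun s => x (s + τ)) (B := Real.toNNReal (L * (ρ + ρ')))
      (hP.of_le one_le_two) hPnonneg hs.1 hμ hC hK₁ hA0 (hg' s hs)
      (fun r hr => (hgB r (hsub hr)).trans (Real.le_coe_toNNReal _))
      (fun r hr => hy r (hsub hr)) (fun r hr => hPlower _ (hyV r hr.1))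
      (fun r hr => (hCbound _ (hyS r hr.1)).2) ?_ hH
    intro r hr
    have h1 := hH2 _ (hyV r hr.1)
    rw [inner_gradient_left] at h1
    have h2 : fderiv ℝ P (x (r + τ))
        (f (x (r + τ)) (u r) - f (x (r + τ)) (kctrl (x (r + τ)))) ≤
        C * ‖x (r + τ)‖ * (L * (A * Real.exp (-(σ * r)))) := by
      refine (Real.le_norm_self _).trans ((ContinuousLinearMap.le_opNorm _ _).trans ?_)
      refine mul_le_mul (hCbound _ (hyS r hr.1)).1 ?_ (norm_nonneg _) (by positivity)
      exact (hLu _ (hyS r hr.1) _ (huU' r hr.1) _ (hkU _)).trans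
        (mul_le_mul_of_nonneg_left (hmismatch r (hsub hr)) L.2)
    rw [map_sub] at h2
    exact (sub_le_iff_le_add'.1 h2).trans (add_le_add h1 le_rfl)
  have hXH : X ≤ H * (‖x (a + τ)‖ * Real.exp (σ * a) + A) := ciSup_le fun s => hbound s s.2
  have h1 := mul_le_mul_of_nonneg_right hHTD hX0
  have h2 : H * (T * D * ε) ≤ H * (D * ε) := by
    have : T * (D * ε) ≤ 1 * (D * ε) := mul_le_mul_of_nonneg_right hT1 (mul_nonneg hD0 hε0)
    exact mul_le_mul_of_nonneg_left (by linarith) hH0.le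
  rw [hA] at hXH
  linarith
end

section
/- There exist an integer N* > 0 and a constant M₄ > 0 such that for every integer N ≥ N*, every x_0 ∈ S₂ and every measurable essentially bounded input u : [−r−τ, 0) → U, the solution x(t) of ẋ(t) = f(x(t), u(t−τ)) with initial condition x(−r) = x_0 satisfies |x(τ) − Φ_N(x_0, u)| ≤ (M₄/N)(|x_0| + ‖u‖), and moreover all Euler iterates satisfy x_i ∈ S₂ for i = 0, 1, …, N, where ‖u‖ = ess sup_{−r−τ ≤ s < 0} |u(s)|. -/
open MeasureTheory Set Filter
open scoped RealInnerProductSpace Topology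

/-- Euler iterates for the approximate predictor: `x_{i+1} = x_i + ∫_{i h}^{(i+1) h} f(x_i, u(s−r−τ)) ds`
with step `h = (τ+r)/N`. -/
noncomputable def eulerIter {E F : Type*} [NormedAddCommGroup E] [NormedSpace ℝ E]
    (f : E → F → E) (r τ : ℝ) (N : ℕ) (x0 : E) (v : ℝ → F) : ℕ → E
  | 0 => x0
  | (i + 1) =>
      eulerIter f r τ N x0 v i +
        ∫ s in ((i : ℝ) * ((τ + r) / N))..(((i : ℝ) + 1) * ((τ + r) / N)),
          f (eulerIter f r τ N x0 v i) (v (s - r - τ))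

/-- The approximate predictor mapping `Φ_N(x₀, u) = x_N`. -/
noncomputable def PhiN {E F : Type*} [NormedAddCommGroup E] [NormedSpace ℝ E]
    (f : E → F → E) (r τ : ℝ) (N : ℕ) (x0 : E) (v : ℝ → F) : E :=
  eulerIter f r τ N x0 v N

/-- A `C¹` map is Lipschitz on closed balls of a finite-dimensional space. -/
theorem exists_lipschitz_on_ball {A B : Type*} [NormedAddCommGroup A] [NormedSpace ℝ A]
    [ProperSpace A] [NormedAddCommGroup B] [NormedSpace ℝ B] {g : A → B} (hg : ContDiff ℝ 1 g)
    (ρ : ℝ) :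
    ∃ L : ℝ, 0 ≤ L ∧ ∀ x y, ‖x‖ ≤ ρ → ‖y‖ ≤ ρ → ‖g x - g y‖ ≤ L * ‖x - y‖ := by
  obtain ⟨C, hC⟩ := (isCompact_closedBall (0 : A) ρ).exists_bound_of_continuousOn
    (hg.continuous_fderiv one_ne_zero).continuousOn
  refine ⟨max C 0, le_max_right _ _, fun x y hx hy => ?_⟩
  exact (convex_closedBall (0 : A) ρ).norm_image_sub_le_of_norm_fderiv_le (𝕜 := ℝ)
    (fun z _ => hg.differentiable one_ne_zero z) (fun z hz => (hC z hz).trans (le_max_left _ _))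
    (by simpa using hy) (by simpa using hx)

/-- An integral curve whose speed is at most `C` while it stays within distance `1` of its starting
point cannot move farther than `1` in a time shorter than `1 / C`. -/
theorem dist_le_one_of_conditional_speed_bound {E : Type*} [NormedAddCommGroup E] [NormedSpace ℝ E]
    {z g : ℝ → E} {a c C : ℝ} (hz : ContinuousOn z (Icc a c))
    (hint : ∀ t ∈ Icc a c, z t = z a + ∫ s in a..t, g s)
    (hg : ∀ᵐ s, s ∈ Ioc a c → ‖z s - z a‖ ≤ 1 → ‖g s‖ ≤ C) (hC : 0 ≤ C)
    (hlt : C * (c - a) < 1) : ∀ t ∈ Icc a c, ‖z t - z a‖ ≤ 1 := by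
  by_contra! hcon
  obtain ⟨t, ht, hgt⟩ := hcon
  have hcont : ContinuousOn (fun t => ‖z t - z a‖) (Icc a c) := (hz.sub continuousOn_const).norm
  have hclosed : IsCompact (Icc a c ∩ (fun t => ‖z t - z a‖) ⁻¹' Ici 1) :=
    isCompact_Icc.of_isClosed_subset (hcont.preimage_isClosed_of_isClosed isClosed_Icc isClosed_Ici)
      inter_subset_left
  obtain ⟨p, ⟨hp, hp1⟩, hmin⟩ := hclosed.exists_isLeast ⟨t, ht, hgt.le⟩
  have hbound : ‖∫ s in a..p, g s‖ ≤ C * |p - a| := by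
    apply intervalIntegral.norm_integral_le_of_norm_le_const_ae
    have hne : ∀ᵐ s : ℝ, s ≠ p := by simp [ae_iff]
    filter_upwards [hg, hne] with s hs hsp hmem
    rw [uIoc_of_le hp.1] at hmem
    have hsIcc : s ∈ Icc a c := ⟨hmem.1.le, hmem.2.trans hp.2⟩
    refine hs ⟨hmem.1, hmem.2.trans hp.2⟩ ?_
    by_contra! h1
    exact hsp (le_antisymm hmem.2 (hmin ⟨hsIcc, h1.le⟩))
  have hzp : z p - z a = ∫ s in a..p, g s := by rw [hint p hp]; abel
  rw [← hzp, abs_of_nonneg (sub_nonneg.2 hp.1)] at hbound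
  have hp1' : 1 ≤ ‖z p - z a‖ := hp1
  have := mul_le_mul_of_nonneg_left (sub_le_sub_right hp.2 a) hC
  linarith

/-- The displacement of a trajectory over a short step, under a linear growth bound. -/
theorem displacement_le_of_linear_growth {E : Type*} [NormedAddCommGroup E] [NormedSpace ℝ E]
    {z g : ℝ → E} {a c L μ : ℝ} (hz : ContinuousOn z (Icc a c))
    (hint : ∀ t ∈ Icc a c, z t = z a + ∫ s in a..t, g s)
    (hg : ∀ᵐ s, s ∈ Ioc a c → ‖g s‖ ≤ L * (‖z s‖ + μ)) (hL : 0 ≤ L) (hμ : 0 ≤ μ)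
    (hsmall : 2 * (L * (c - a)) ≤ 1) :
    ∀ t ∈ Icc a c, ‖z t - z a‖ ≤ 2 * (L * (c - a)) * (‖z a‖ + μ) := by
  intro t ht
  obtain ⟨p, hp, hmax⟩ := isCompact_Icc.exists_isMaxOn ⟨t, ht⟩ (hz.sub continuousOn_const).norm
  have hmax' : ∀ s ∈ Icc a c, ‖z s - z a‖ ≤ ‖z p - z a‖ := fun s hs => hmax hs
  refine (hmax' t ht).trans ?_
  set δ := ‖z p - z a‖ with hδ
  have hbound : ‖∫ s in a..p, g s‖ ≤ L * (‖z a‖ + δ + μ) * |p - a| := by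
    apply intervalIntegral.norm_integral_le_of_norm_le_const_ae
    filter_upwards [hg] with s hs hmem
    rw [uIoc_of_le hp.1] at hmem
    refine (hs ⟨hmem.1, hmem.2.trans hp.2⟩).trans ?_
    have h1 := hmax' s ⟨hmem.1.le, hmem.2.trans hp.2⟩
    have h2 : ‖z s‖ ≤ ‖z a‖ + ‖z s - z a‖ := by
      simpa using norm_add_le (z a) (z s - z a)
    gcongr
    linarith
  have hzp : z p - z a = ∫ s in a..p, g s := by rw [hint p hp]; abel
  rw [← hzp, abs_of_nonneg (sub_nonneg.2 hp.1), ← hδ] at hbound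
  have hδ0 : 0 ≤ δ := norm_nonneg _
  have h3 : L * (‖z a‖ + δ + μ) * (p - a) ≤ L * (‖z a‖ + δ + μ) * (c - a) := by
    gcongr
    exact hp.2
  nlinarith [mul_le_mul_of_nonneg_right hsmall hδ0]

/-- Composition of a continuous vector field with a continuous curve and a bounded measurable
input is integrable. -/
theorem intervalIntegrable_field_comp {E F : Type*} [NormedAddCommGroup E]
    [ProperSpace E] [NormedAddCommGroup F] [ProperSpace F]
    {f : E → F → E} (hf : Continuous fun p : E × F => f p.1 p.2)
    {z : ℝ → E} {v : ℝ → F} {a c μ : ℝ} (hac : a ≤ c) (hz : ContinuousOn z (Icc a c))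
    (hv : StronglyMeasurable v) (hvμ : ∀ᵐ s, s ∈ Ioc a c → ‖v s‖ ≤ μ) :
    IntervalIntegrable (fun s => f (z s) (v s)) volume a c := by
  obtain ⟨ρ, hρ⟩ := isCompact_Icc.exists_bound_of_continuousOn hz
  obtain ⟨C, hC⟩ := ((isCompact_closedBall (0 : E) ρ).prod
    (isCompact_closedBall (0 : F) μ)).exists_bound_of_continuousOn hf.continuousOn
  rw [intervalIntegrable_iff_integrableOn_Ioc_of_le hac]
  refine Integrable.of_bound (C := C) ?_ ?_
  · have hz' : AEStronglyMeasurable z (volume.restrict (Ioc a c)) :=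
      (hz.mono Ioc_subset_Icc_self).aestronglyMeasurable measurableSet_Ioc
    exact hf.comp_aestronglyMeasurable (hz'.prodMk hv.aestronglyMeasurable)
  · rw [ae_restrict_iff' measurableSet_Ioc]
    filter_upwards [hvμ] with s hs hmem
    exact hC (z s, v s) ⟨by simpa using hρ s (Ioc_subset_Icc_self hmem), by simpa using hs hmem⟩

/-- Local error of one Euler step. -/
theorem euler_step_error {E F : Type*} [NormedAddCommGroup E] [NormedSpace ℝ E]
    [ProperSpace E] [NormedAddCommGroup F] [ProperSpace F]
    {f : E → F → E} (hf : Continuous fun p : E × F => f p.1 p.2) {ρ σ L μ : ℝ} (hL : 0 ≤ L)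
    (hlip : ∀ x y u, ‖x‖ ≤ ρ + 2 → ‖y‖ ≤ ρ + 2 → ‖u‖ ≤ σ → ‖f x u - f y u‖ ≤ L * ‖x - y‖)
    (hgrow : ∀ x u, ‖x‖ ≤ ρ + 2 → ‖u‖ ≤ σ → ‖f x u‖ ≤ L * (‖x‖ + ‖u‖))
    (hμ0 : 0 ≤ μ) (hμσ : μ ≤ σ) (hρ : 0 ≤ ρ)
    {z : ℝ → E} {v : ℝ → F} {a c : ℝ} (hac : a ≤ c) (hz : ContinuousOn z (Icc a c))
    (hint : ∀ t ∈ Icc a c, z t = z a + ∫ s in a..t, f (z s) (v s))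
    (hv : StronglyMeasurable v) (hvμ : ∀ᵐ s, s ∈ Ioc a c → ‖v s‖ ≤ μ)
    (hsmall : 2 * (L * (c - a)) ≤ 1) (hsmall' : L * (ρ + 2 + σ) * (c - a) < 1)
    (hza : ‖z a‖ ≤ ρ + 1) {y : E} (hy : ‖y‖ ≤ ρ) :
    ‖z c - (y + ∫ s in a..c, f y (v s))‖ ≤
      ‖z a - y‖ + L * (c - a) * (‖z a - y‖ + 2 * (L * (c - a)) * (‖z a‖ + μ)) := by
  have htri : ∀ s, ‖z s‖ ≤ ‖z a‖ + ‖z s - z a‖ := fun s => by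
    simpa using norm_add_le (z a) (z s - z a)
  have hnear : ∀ t ∈ Icc a c, ‖z t - z a‖ ≤ 1 := by
    have hσ : 0 ≤ σ := hμ0.trans hμσ
    refine dist_le_one_of_conditional_speed_bound hz hint ?_ (by positivity) hsmall'
    filter_upwards [hvμ] with s hs hmem h1
    have hzs : ‖z s‖ ≤ ρ + 2 := by linarith [htri s]
    have hvs : ‖v s‖ ≤ σ := (hs hmem).trans hμσ
    refine (hgrow _ _ hzs hvs).trans ?_
    gcongr
  have hball : ∀ t ∈ Icc a c, ‖z t‖ ≤ ρ + 2 := fun t ht => by linarith [htri t, hnear t ht]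
  have hdisp : ∀ t ∈ Icc a c, ‖z t - z a‖ ≤ 2 * (L * (c - a)) * (‖z a‖ + μ) := by
    refine displacement_le_of_linear_growth hz hint ?_ hL hμ0 hsmall
    filter_upwards [hvμ] with s hs hmem
    refine (hgrow _ _ (hball s (Ioc_subset_Icc_self hmem)) ((hs hmem).trans hμσ)).trans ?_
    gcongr
    exact hs hmem
  have hI1 := intervalIntegrable_field_comp hf hac hz hv hvμ
  have hI2 := intervalIntegrable_field_comp hf hac (continuousOn_const (c := y)) hv hvμ
  have hsplit : z c - (y + ∫ s in a..c, f y (v s)) =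
      (z a - y) + ∫ s in a..c, (f (z s) (v s) - f y (v s)) := by
    rw [intervalIntegral.integral_sub hI1 hI2, hint c (right_mem_Icc.2 hac)]
    abel
  have hbound : ‖∫ s in a..c, (f (z s) (v s) - f y (v s))‖ ≤
      L * (‖z a - y‖ + 2 * (L * (c - a)) * (‖z a‖ + μ)) * |c - a| := by
    apply intervalIntegral.norm_integral_le_of_norm_le_const_ae
    filter_upwards [hvμ] with s hs hmem
    rw [uIoc_of_le hac] at hmem
    have hsI := Ioc_subset_Icc_self hmem
    refine (hlip _ _ _ (hball s hsI) (by linarith) ((hs hmem).trans hμσ)).trans ?_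
    have h2 : ‖z s - y‖ ≤ ‖z s - z a‖ + ‖z a - y‖ := norm_sub_le_norm_sub_add_norm_sub _ _ _
    gcongr
    linarith [hdisp s hsI]
  rw [abs_of_nonneg (sub_nonneg.2 hac)] at hbound
  rw [hsplit]
  refine (norm_add_le _ _).trans ?_
  linarith

/-- Sublevel sets of a Lyapunov function that decreases outside a smaller sublevel set are
invariant under sufficiently short Euler steps. -/
theorem exists_step_sublevel_invariant {E F : Type*} [NormedAddCommGroup E] [InnerProductSpace ℝ E]
    [FiniteDimensional ℝ E] [NormedAddCommGroup F] [ProperSpace F]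
    {f : E → F → E} (hf : Continuous fun p : E × F => f p.1 p.2)
    {U : Set F} (hU : IsCompact U) {V W : E → ℝ} (hV : ContDiff ℝ 2 V)
    (hVradial : ∀ M : ℝ, Bornology.IsBounded {x | V x ≤ M}) (hW : Continuous W)
    (hWpos : ∀ x ≠ 0, 0 < W x) {R b : ℝ} (hV0 : V 0 ≤ R) (hbR : R < b)
    (hdec : ∀ x u, u ∈ U → R ≤ V x → ⟪gradient V x, f x u⟫ ≤ -W x) :
    ∃ h₀ : ℝ, 0 < h₀ ∧ ∀ (x : E) (v : ℝ → F) (a c : ℝ), V x ≤ b → StronglyMeasurable v →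
      (∀ᵐ s, s ∈ Ioc a c → v s ∈ U) → a ≤ c → c - a ≤ h₀ →
      V (x + ∫ s in a..c, f x (v s)) ≤ b := by
  have hVc : Continuous V := hV.continuous
  obtain ⟨ρ, hρ⟩ := (hVradial b).exists_norm_le
  have hK : IsCompact {x | V x ≤ b} :=
    Metric.isCompact_of_isClosed_isBounded (isClosed_le hVc continuous_const) (hVradial b)
  obtain ⟨C, hC⟩ := (hK.prod hU).exists_bound_of_continuousOn hf.continuousOn
  obtain ⟨μ, hμ⟩ := hU.isBounded.exists_norm_le
  obtain ⟨L₁, hL₁, hL₁V⟩ := exists_lipschitz_on_ball (hV.of_le one_le_two) (ρ + 1)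
  obtain ⟨L₂, hL₂, hL₂V⟩ := exists_lipschitz_on_ball
    (hV.fderiv_right (m := 1) (by norm_num)) (ρ + 1)
  obtain ⟨w, hw0, hw⟩ : ∃ w : ℝ, 0 < w ∧ ∀ x, (R + b) / 2 ≤ V x → V x ≤ b → w ≤ W x := by
    have hA : IsCompact {x | (R + b) / 2 ≤ V x ∧ V x ≤ b} :=
      hK.of_isClosed_subset ((isClosed_le continuous_const hVc).inter
        (isClosed_le hVc continuous_const)) fun x hx => hx.2
    rcases Set.eq_empty_or_nonempty {x | (R + b) / 2 ≤ V x ∧ V x ≤ b} with h | h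
    · exact ⟨1, one_pos, fun x h1 h2 => absurd (show x ∈ (∅ : Set E) from h ▸ ⟨h1, h2⟩) (by simp)⟩
    · obtain ⟨p, hp, hmin⟩ := hA.exists_isMinOn h hW.continuousOn
      refine ⟨W p, hWpos p ?_, fun x h1 h2 => hmin (show x ∈ {x | _} from ⟨h1, h2⟩)⟩
      rintro rfl
      have := hp.1
      linarith
  set D := max C 1 with hD
  have hD1 : 1 ≤ D := le_max_right _ _
  refine ⟨min (1 / D) (min ((b - R) / 2 / (L₁ * D + 1)) (w / (L₂ * D ^ 2 + 1))), ?_, ?_⟩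
  · have : 0 < (b - R) / 2 := by linarith
    positivity
  intro x v a c hx hv hvU hac hstep
  have hh1 : (c - a) * D ≤ 1 := by
    rw [← le_div_iff₀ (by positivity)]
    exact hstep.trans (min_le_left _ _)
  have hh2 : (c - a) * (L₁ * D + 1) ≤ (b - R) / 2 := by
    rw [← le_div_iff₀ (by positivity)]
    exact hstep.trans ((min_le_right _ _).trans (min_le_left _ _))
  have hh3 : (c - a) * (L₂ * D ^ 2 + 1) ≤ w := by
    rw [← le_div_iff₀ (by positivity)]
    exact hstep.trans ((min_le_right _ _).trans (min_le_right _ _))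
  have hca : 0 ≤ c - a := sub_nonneg.2 hac
  set d := ∫ s in a..c, f x (v s) with hd
  have hdn : ‖d‖ ≤ D * (c - a) := by
    rw [← abs_of_nonneg hca]
    apply intervalIntegral.norm_integral_le_of_norm_le_const_ae
    filter_upwards [hvU] with s hs hmem
    rw [uIoc_of_le hac] at hmem
    exact (hC (x, v s) ⟨hx, hs hmem⟩).trans (le_max_left _ _)
  have hxρ : ‖x‖ ≤ ρ + 1 := (hρ x hx).trans (by linarith)
  have hxd : ‖x + d‖ ≤ ρ + 1 := by linarith [norm_add_le x d, hρ x hx]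
  rcases lt_or_ge (V x) ((R + b) / 2) with hlow | hhigh
  · have h1 := hL₁V (x + d) x hxd hxρ
    rw [add_sub_cancel_left, Real.norm_eq_abs] at h1
    have h2 := le_of_abs_le h1
    have h3 : L₁ * ‖d‖ ≤ L₁ * (D * (c - a)) := by gcongr
    nlinarith
  · have hI : IntervalIntegrable (fun s => f x (v s)) volume a c :=
      intervalIntegrable_field_comp hf hac (continuousOn_const (c := x)) hv
        (hvU.mono fun s hs hmem => hμ _ (hs hmem))
    have hinner : ⟪gradient V x, d⟫ ≤ -w * (c - a) := by
      have e1 : ⟪gradient V x, d⟫ = ∫ s in a..c, ⟪gradient V x, f x (v s)⟫ :=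
        ((innerSL ℝ (gradient V x)).intervalIntegral_comp_comm hI).symm
      have hI' : IntervalIntegrable (fun s => ⟪gradient V x, f x (v s)⟫) volume a c :=
        ⟨(innerSL ℝ (gradient V x)).integrable_comp hI.1,
          (innerSL ℝ (gradient V x)).integrable_comp hI.2⟩
      have e2 : ∫ _ in a..c, -w = -w * (c - a) := by
        rw [intervalIntegral.integral_const, smul_eq_mul, mul_comm]
      rw [e1, ← e2]
      refine intervalIntegral.integral_mono_ae_restrict hac hI' (by simp) ?_
      have hne : ∀ᵐ s : ℝ, s ≠ a := by simp [ae_iff]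
      rw [EventuallyLE, ae_restrict_iff' measurableSet_Icc]
      filter_upwards [hvU, hne] with s hs hsa hmem
      have hmem' : s ∈ Ioc a c := ⟨lt_of_le_of_ne hmem.1 hsa.symm, hmem.2⟩
      have := hdec x (v s) (hs hmem') (by linarith)
      linarith [hw x hhigh hx]
    have hfd : fderiv ℝ V x d = ⟪gradient V x, d⟫ := by
      rw [gradient, InnerProductSpace.toDual_symm_apply]
    have htaylor : ‖V (x + d) - V x - fderiv ℝ V x (x + d - x)‖ ≤
        L₂ * ‖d‖ * ‖x + d - x‖ := by
      refine (convex_segment x (x + d)).norm_image_sub_le_of_norm_fderiv_le' (𝕜 := ℝ)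
        (fun z _ => hV.differentiable two_ne_zero z) (fun z hz => ?_)
        (left_mem_segment ℝ _ _) (right_mem_segment ℝ _ _)
      have hzρ : ‖z‖ ≤ ρ + 1 := by
        have := (convex_closedBall (0 : E) (ρ + 1)).segment_subset
          (by simpa using hxρ) (by simpa using hxd) hz
        simpa using this
      refine (hL₂V z x hzρ hxρ).trans ?_
      gcongr
      have := norm_sub_le_of_mem_segment hz
      simpa using this
    rw [add_sub_cancel_left, hfd, Real.norm_eq_abs] at htaylor
    have h2 := le_of_abs_le htaylor
    have h3 : L₂ * ‖d‖ * ‖d‖ ≤ L₂ * (D * (c - a)) * (D * (c - a)) := by gcongr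
    nlinarith [mul_le_mul_of_nonneg_left hh3 hca, mul_nonneg hca hca]

/-- Linear growth of the Euler iterates. -/
theorem eulerIter_growth {E F : Type*} [NormedAddCommGroup E] [NormedSpace ℝ E]
    [NormedAddCommGroup F] {f : E → F → E} {r τ ρ σ L μ : ℝ} {N : ℕ} (hL : 0 ≤ L)
    (hgrow : ∀ x u, ‖x‖ ≤ ρ → ‖u‖ ≤ σ → ‖f x u‖ ≤ L * (‖x‖ + ‖u‖))
    (hμ0 : 0 ≤ μ) (hμσ : μ ≤ σ) (hT : 0 ≤ τ + r) (hN : 0 < N) {x₀ : E} {u : ℝ → F}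
    (hu : ∀ᵐ s, s ∈ Ioc 0 (τ + r) → ‖u (s - r - τ)‖ ≤ μ)
    (hy : ∀ i ≤ N, ‖eulerIter f r τ N x₀ u i‖ ≤ ρ) :
    ∀ i ≤ N, ‖eulerIter f r τ N x₀ u i‖ + μ ≤ Real.exp (L * (τ + r)) * (‖x₀‖ + μ) := by
  have hN' : (0 : ℝ) < N := Nat.cast_pos.2 hN
  set h := (τ + r) / N with hh
  have hh0 : 0 ≤ h := by positivity
  have hNh : N * h = τ + r := by rw [hh]; field_simp
  have hS : 0 ≤ ‖x₀‖ + μ := by positivity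
  have key : ∀ i ≤ N, ‖eulerIter f r τ N x₀ u i‖ + μ ≤ (1 + L * h) ^ i * (‖x₀‖ + μ) := by
    intro i
    induction i with
    | zero => intro _; simp [eulerIter]
    | succ i ih =>
      intro hi
      have hi' : i ≤ N := by omega
      have hiN : (i : ℝ) + 1 ≤ N := by exact_mod_cast hi
      specialize ih hi'
      have hle : (i : ℝ) * h ≤ (i + 1) * h := by nlinarith
      have hbound : ‖∫ s in ((i : ℝ) * h)..((i + 1) * h),
          f (eulerIter f r τ N x₀ u i) (u (s - r - τ))‖ ≤
          L * (‖eulerIter f r τ N x₀ u i‖ + μ) * |(i + 1) * h - i * h| := by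
        apply intervalIntegral.norm_integral_le_of_norm_le_const_ae
        filter_upwards [hu] with s hs hmem
        rw [uIoc_of_le hle] at hmem
        have hsμ := hs ⟨lt_of_le_of_lt (by positivity) hmem.1, hmem.2.trans (by rw [← hNh]; gcongr)⟩
        refine (hgrow _ _ (hy i hi') (hsμ.trans hμσ)).trans ?_
        gcongr
      rw [abs_of_nonneg (sub_nonneg.2 hle)] at hbound
      have h1 : ‖eulerIter f r τ N x₀ u (i + 1)‖ ≤ _ := norm_add_le _ _
      have h2 : (1 + L * h) * (‖eulerIter f r τ N x₀ u i‖ + μ) ≤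
          (1 + L * h) * ((1 + L * h) ^ i * (‖x₀‖ + μ)) := by gcongr
      rw [pow_succ]
      linarith
  intro i hi
  refine (key i hi).trans ?_
  gcongr
  calc (1 + L * h) ^ i ≤ (1 + L * h) ^ N := pow_le_pow_right₀ (by nlinarith [mul_nonneg hL hh0]) hi
    _ ≤ Real.exp (L * h) ^ N := by
      gcongr
      linarith [Real.add_one_le_exp (L * h)]
    _ = Real.exp (L * (τ + r)) := by rw [← Real.exp_nat_mul, ← hNh]; ring_nf

/-- Global error of the Euler scheme with bounded iterates. -/
theorem eulerIter_error {E F : Type*} [NormedAddCommGroup E] [NormedSpace ℝ E]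
    [ProperSpace E] [NormedAddCommGroup F] [ProperSpace F]
    {f : E → F → E} (hf : Continuous fun p : E × F => f p.1 p.2) {r τ ρ σ L μ : ℝ} {N : ℕ}
    (hL : 0 ≤ L)
    (hlip : ∀ x y u, ‖x‖ ≤ ρ + 2 → ‖y‖ ≤ ρ + 2 → ‖u‖ ≤ σ → ‖f x u - f y u‖ ≤ L * ‖x - y‖)
    (hgrow : ∀ x u, ‖x‖ ≤ ρ + 2 → ‖u‖ ≤ σ → ‖f x u‖ ≤ L * (‖x‖ + ‖u‖))
    (hμ0 : 0 ≤ μ) (hμσ : μ ≤ σ) (hρ : 0 ≤ ρ) (hT : 0 ≤ τ + r) (hN : 0 < N)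
    {x₀ : E} {u : ℝ → F} (hum : StronglyMeasurable fun s => u (s - r - τ))
    (hu : ∀ᵐ s, s ∈ Ioc 0 (τ + r) → ‖u (s - r - τ)‖ ≤ μ)
    (hy : ∀ i ≤ N, ‖eulerIter f r τ N x₀ u i‖ ≤ ρ)
    {z : ℝ → E} (hz : ContinuousOn z (Icc 0 (τ + r)))
    (hint : ∀ t ∈ Icc 0 (τ + r), z t = x₀ + ∫ s in 0..t, f (z s) (u (s - r - τ)))
    (hsmall : 2 * (L * (τ + r)) ≤ N) (hsmall' : L * (ρ + 2 + σ) * (τ + r) < N)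
    (hsmall'' : 2 * L ^ 2 * (τ + r) ^ 2 * Real.exp (L * (τ + r)) ^ 3 * (ρ + σ) ≤ N) :
    ‖z (τ + r) - eulerIter f r τ N x₀ u N‖ ≤
      2 * L ^ 2 * (τ + r) ^ 2 * Real.exp (L * (τ + r)) ^ 3 / N * (‖x₀‖ + μ) := by
  have hN' : (0 : ℝ) < N := Nat.cast_pos.2 hN
  have hgrowth := eulerIter_growth (r := r) (τ := τ) (x₀ := x₀) (u := u) hL
    (fun x u hx => hgrow x u (hx.trans (by linarith))) hμ0 hμσ hT hN hu hy
  set e := Real.exp (L * (τ + r)) with he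
  set h := (τ + r) / N with hh
  have hh0 : 0 ≤ h := by positivity
  have hNh : N * h = τ + r := by rw [hh]; field_simp
  have he0 : 0 < e := Real.exp_pos _
  set S := ‖x₀‖ + μ with hS
  have hS0 : 0 ≤ S := by positivity
  have hSle : S ≤ ρ + σ := add_le_add (hy 0 (Nat.zero_le _)) hμσ
  have hLh : 2 * (L * h) ≤ 1 := by
    rw [← hNh] at hsmall
    exact le_of_mul_le_mul_left (by linarith) hN'
  have hLh' : L * (ρ + 2 + σ) * h < 1 := by
    rw [← hNh] at hsmall'
    exact lt_of_mul_lt_mul_left (by linarith) hN'.le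
  have hLh0 : 0 ≤ L * h := mul_nonneg hL hh0
  set q := 1 + 2 * (L * h) with hq
  have hq1 : 1 ≤ q := by linarith
  set K := 2 * (L * h) ^ 2 * (e * S) with hK
  have hK0 : 0 ≤ K := by positivity
  have htotal : ∀ i ≤ N, i * q ^ i * K ≤ 2 * L ^ 2 * (τ + r) ^ 2 * e ^ 3 / N * S := by
    intro i hi
    have h1 : q ^ i ≤ e ^ 2 := by
      calc q ^ i ≤ q ^ N := pow_le_pow_right₀ hq1 hi
        _ ≤ Real.exp (2 * (L * h)) ^ N := by
          gcongr
          linarith [Real.add_one_le_exp (2 * (L * h))]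
        _ = e ^ 2 := by
          rw [he, ← Real.exp_nat_mul, ← Real.exp_nat_mul, ← hNh]
          push_cast
          ring_nf
    calc i * q ^ i * K ≤ N * e ^ 2 * K := by gcongr
      _ = 2 * L ^ 2 * (N * h) ^ 2 * e ^ 3 / N * S := by rw [hK]; field_simp
      _ = _ := by rw [hNh]
  have hone : 2 * L ^ 2 * (τ + r) ^ 2 * e ^ 3 / N * S ≤ 1 := by
    rw [div_mul_eq_mul_div, div_le_one hN']
    refine le_trans ?_ hsmall''
    gcongr
  have key : ∀ i ≤ N, ‖z (i * h) - eulerIter f r τ N x₀ u i‖ ≤ i * q ^ i * K := by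
    intro i
    induction i with
    | zero =>
      intro _
      have := hint 0 ⟨le_rfl, hT⟩
      simp [eulerIter, this]
    | succ i ih =>
      intro hi
      have hi' : i ≤ N := by omega
      have hiN : (i : ℝ) + 1 ≤ N := by exact_mod_cast hi
      specialize ih hi'
      have hle : (i : ℝ) * h ≤ (i + 1) * h := by nlinarith
      have h0 : 0 ≤ (i : ℝ) * h := by positivity
      have hend : ((i : ℝ) + 1) * h ≤ τ + r := by rw [← hNh]; gcongr
      have hlen : ((i : ℝ) + 1) * h - i * h = h := by ring
      have hsub : Icc ((i : ℝ) * h) ((i + 1) * h) ⊆ Icc 0 (τ + r) := Icc_subset_Icc h0 hend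
      have hI := intervalIntegrable_field_comp hf hT hz hum hu
      have hyi := hy i hi'
      have hgi := hgrowth i hi'
      set y := eulerIter f r τ N x₀ u i with hydef
      have htri : ‖z (i * h)‖ ≤ ‖z (i * h) - y‖ + ‖y‖ := by
        simpa using norm_add_le (z (i * h) - y) y
      have hclose : ‖z (i * h) - y‖ ≤ 1 := (ih.trans (htotal i hi')).trans hone
      have hstep := euler_step_error (z := z) (v := fun s => u (s - r - τ))
        (a := i * h) (c := (i + 1) * h) hf hL hlip hgrow hμ0 hμσ hρ hle (hz.mono hsub)
        (fun t ht => by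
          have hmem : ∀ p ∈ Icc 0 (τ + r), p ∈ uIcc 0 (τ + r) := fun p hp => by
            rwa [uIcc_of_le hT]
          have ha := hsub (left_mem_Icc.2 hle)
          rw [hint t (hsub ht), hint _ ha, add_assoc,
            intervalIntegral.integral_add_adjacent_intervals
              (hI.mono_set (uIcc_subset_uIcc (hmem 0 ⟨le_rfl, hT⟩) (hmem _ ha)))
              (hI.mono_set (uIcc_subset_uIcc (hmem _ ha) (hmem _ (hsub ht))))])
        hum
        (hu.mono fun s hs hmem => hs ⟨lt_of_le_of_lt h0 hmem.1, hmem.2.trans hend⟩)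
        (by rwa [hlen]) (by rwa [hlen]) (by linarith) hyi
      rw [hlen] at hstep
      push_cast
      refine le_trans hstep ?_
      set α := ‖z (i * h) - y‖ with hα
      have hα0 : 0 ≤ α := norm_nonneg _
      have h1 : L * h * (2 * (L * h) * (‖z (i * h)‖ + μ)) ≤
          L * h * (2 * (L * h) * (α + e * S)) := by
        gcongr L * h * (2 * (L * h) * ?_)
        linarith
      have h2 : L * h * (2 * (L * h)) * α ≤ L * h * 1 * α := by gcongr
      have h3 : q * α ≤ q * (i * q ^ i * K) := by gcongr
      have h4 : K ≤ q ^ (i + 1) * K := le_mul_of_one_le_left hK0 (one_le_pow₀ hq1)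
      calc α + L * h * (α + 2 * (L * h) * (‖z (i * h)‖ + μ)) ≤ q * α + K := by
            rw [hq, hK]
            linarith
        _ ≤ q * (i * q ^ i * K) + q ^ (i + 1) * K := add_le_add h3 h4
        _ = (i + 1) * q ^ (i + 1) * K := by ring
  have := (key N le_rfl).trans (htotal N le_rfl)
  rwa [hNh] at this

/-- Lemma 3.3: there exist an integer `N* > 0` and a constant `M₄ > 0`
such that for every `N ≥ N*`, every `x₀ ∈ S₂` and every measurable essentially bounded
input `u : [−r−τ, 0) → U`, the solution `x(t)` of `ẋ(t) = f(x(t), u(t−τ))` with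
`x(−r) = x₀` satisfies `|x(τ) − Φ_N(x₀, u)| ≤ (M₄/N)(|x₀| + ‖u‖)`, and moreover all
Euler iterates satisfy `x_i ∈ S₂` for `i = 0, 1, …, N`, where
`‖u‖ = ess sup_{−r−τ ≤ s < 0} |u(s)|`. -/
theorem stmt_6
    (n m : ℕ)
    (f : EuclideanSpace ℝ (Fin n) → EuclideanSpace ℝ (Fin m) → EuclideanSpace ℝ (Fin n))
    (hf : ContDiff ℝ (⊤ : ℕ∞) (fun p : EuclideanSpace ℝ (Fin n) × EuclideanSpace ℝ (Fin m) => f p.1 p.2))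
    (hf0 : f 0 0 = 0)
    (U : Set (EuclideanSpace ℝ (Fin m))) (hUcomp : IsCompact U) (hUne : U.Nonempty)
    (hU0 : (0 : EuclideanSpace ℝ (Fin m)) ∈ U)
    (τ r : ℝ) (hτ : 0 ≤ τ) (hr : 0 ≤ r) (hτr : 0 < τ + r)
    -- (H1)
    (V : EuclideanSpace ℝ (Fin n) → ℝ) (hV : ContDiff ℝ 2 V) (hVnonneg : ∀ x, 0 ≤ V x)
    (hVradial : ∀ M : ℝ, Bornology.IsBounded {x | V x ≤ M})
    (W : EuclideanSpace ℝ (Fin n) → ℝ) (hW : ContDiff ℝ 1 W)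
    (hWpos : W 0 = 0 ∧ ∀ x ≠ 0, 0 < W x)
    (R : ℝ) (hR : 0 < R)
    (hH1 : ∀ x u, u ∈ U → R ≤ V x → ⟪gradient V x, f x u⟫ ≤ -W x)
    (hS1nhds : {x | V x ≤ R} ∈ 𝓝 (0 : EuclideanSpace ℝ (Fin n)))
    (b : ℝ) (hbR : R < b) :
    ∃ Nstar : ℕ, 0 < Nstar ∧ ∃ M₄ : ℝ, 0 < M₄ ∧
      ∀ N : ℕ, Nstar ≤ N →
        ∀ x₀ : EuclideanSpace ℝ (Fin n), V x₀ ≤ b →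
          ∀ u : ℝ → EuclideanSpace ℝ (Fin m), Measurable u →
            (∀ s ∈ Ico (-(r + τ)) (0:ℝ), u s ∈ U) →
            (∀ x : ℝ → EuclideanSpace ℝ (Fin n), ContinuousOn x (Icc (-r) τ) →
              x (-r) = x₀ →
              (∀ t ∈ Icc (-r) τ, x t = x₀ + ∫ s in (-r)..t, f (x s) (u (s - τ))) →
              ‖x τ - PhiN f r τ N x₀ u‖ ≤
                (M₄ / N) *
                  (‖x₀‖ + essSup (fun s => ‖u s‖) (volume.restrict (Ico (-(r + τ)) (0:ℝ)))))
            ∧ ∀ i : ℕ, i ≤ N → V (eulerIter f r τ N x₀ u i) ≤ b := by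
  set T := τ + r with hT
  obtain ⟨ρ₀, hρ₀⟩ := (hVradial b).exists_norm_le
  obtain ⟨σ₀, hσ₀⟩ := hUcomp.isBounded.exists_norm_le
  set ρ := max ρ₀ 0
  set σ := max σ₀ 0
  have hρ0 : 0 ≤ ρ := le_max_right _ _
  have hσ0 : 0 ≤ σ := le_max_right _ _
  have hρ : ∀ x, V x ≤ b → ‖x‖ ≤ ρ := fun x hx => (hρ₀ x hx).trans (le_max_left _ _)
  have hσ : ∀ v ∈ U, ‖v‖ ≤ σ := fun v hv => (hσ₀ v hv).trans (le_max_left _ _)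
  obtain ⟨L, hL, hLf⟩ := exists_lipschitz_on_ball (hf.of_le (by exact_mod_cast le_top))
    (max (ρ + 2) σ)
  have hlip : ∀ x y v, ‖x‖ ≤ ρ + 2 → ‖y‖ ≤ ρ + 2 → ‖v‖ ≤ σ →
      ‖f x v - f y v‖ ≤ L * ‖x - y‖ := by
    intro x y v hx hy hv
    have := hLf (x, v) (y, v) (max_le_max hx hv) (max_le_max hy hv)
    simpa [Prod.norm_def] using this
  have hgrow : ∀ x v, ‖x‖ ≤ ρ + 2 → ‖v‖ ≤ σ → ‖f x v‖ ≤ L * (‖x‖ + ‖v‖) := by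
    intro x v hx hv
    have h1 := hLf (x, v) (0, 0) (max_le_max hx hv) (by simp [hσ0])
    simp only [hf0, sub_zero, Prod.mk_zero_zero] at h1
    refine h1.trans ?_
    gcongr
    exact max_le_add_of_nonneg (norm_nonneg _) (norm_nonneg _)
  have hV0 : (0 : EuclideanSpace ℝ (Fin n)) ∈ {x | V x ≤ R} := mem_of_mem_nhds hS1nhds
  obtain ⟨h₀, hh₀, hinv⟩ := exists_step_sublevel_invariant hf.continuous hUcomp hV hVradial
    hW.continuous hWpos.2 hV0 hbR hH1
  set M := 2 * L ^ 2 * T ^ 2 * Real.exp (L * T) ^ 3 with hM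
  have hM0 : 0 ≤ M := by positivity
  obtain ⟨N₁, hN₁⟩ := exists_nat_gt
    (max (T / h₀) (max (2 * (L * T)) (max (L * (ρ + 2 + σ) * T) (M * (ρ + σ)))))
  refine ⟨N₁ + 1, Nat.succ_pos _, M + 1, by positivity, ?_⟩
  intro N hN x₀ hx₀ u hum huU
  have hNpos : 0 < N := by omega
  have hNR : (0 : ℝ) < N := Nat.cast_pos.2 hNpos
  have hN₁N : (N₁ : ℝ) ≤ N := by exact_mod_cast (by omega : N₁ ≤ N)
  have hbig := hN₁.trans_le hN₁N
  simp only [max_lt_iff] at hbig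
  obtain ⟨hb1, hb2, hb3, hb4⟩ := hbig
  have hshift : ∀ {s : ℝ}, s ∈ Ioc 0 T → s ≠ T → s - r - τ ∈ Ico (-(r + τ)) (0 : ℝ) :=
    fun {s} hs hsT => by
      have := lt_of_le_of_ne hs.2 hsT
      exact ⟨by linarith [hs.1], by linarith⟩
  have hne : ∀ᵐ s : ℝ, s ≠ T := by simp [ae_iff]
  have hvm : StronglyMeasurable fun s => u (s - r - τ) := by
    have : Measurable fun s => u (s - r - τ) := by fun_prop
    exact this.stronglyMeasurable
  have hvU : ∀ᵐ s, s ∈ Ioc 0 T → u (s - r - τ) ∈ U := by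
    filter_upwards [hne] with s hs hmem
    exact huU _ (hshift hmem hs)
  have hstep : T / N ≤ h₀ := by
    rw [div_lt_iff₀ hh₀] at hb1
    rw [div_le_iff₀ hNR]
    linarith
  have hNT : N * (T / N) = T := by field_simp
  have hVy : ∀ i : ℕ, i ≤ N → V (eulerIter f r τ N x₀ u i) ≤ b := by
    intro i
    induction i with
    | zero => intro _; exact hx₀
    | succ i ih =>
      intro hi
      have hiN : (i : ℝ) + 1 ≤ N := by exact_mod_cast hi
      have hTN : 0 ≤ T / N := by positivity
      refine hinv _ (fun s => u (s - r - τ)) _ _ (ih (by omega)) hvm ?_ ?_ ?_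
      · filter_upwards [hvU] with s hs hmem
        refine hs ⟨lt_of_le_of_lt (by positivity) hmem.1, hmem.2.trans ?_⟩
        calc ((i : ℝ) + 1) * (T / N) ≤ N * (T / N) := by gcongr
          _ = T := hNT
      · nlinarith
      · linarith
  refine ⟨fun x hxc hx0 hxint => ?_, hVy⟩
  set ν := volume.restrict (Ico (-(r + τ)) (0 : ℝ)) with hν
  have hνne : ν ≠ 0 := by
    rw [hν, Ne, Measure.restrict_eq_zero, Real.volume_Ico, ENNReal.ofReal_eq_zero]
    linarith
  have : NeBot (ae ν) := ae_neBot.2 hνne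
  have hule : ∀ᵐ s ∂ν, ‖u s‖ ≤ σ :=
    (ae_restrict_iff' measurableSet_Ico).2 (Eventually.of_forall fun s hs => hσ _ (huU s hs))
  have hbdd : IsBoundedUnder (· ≤ ·) (ae ν) fun s => ‖u s‖ := ⟨σ, by simpa using hule⟩
  set μ := essSup (fun s => ‖u s‖) ν with hμ
  have hae : ∀ᵐ s ∂ν, ‖u s‖ ≤ μ := ae_le_essSup hbdd
  have hμ0 : 0 ≤ μ := by
    obtain ⟨s, hs⟩ := hae.exists
    exact (norm_nonneg _).trans hs
  have hμσ : μ ≤ σ := by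
    have hbelow : IsBoundedUnder (· ≥ ·) (ae ν) fun s => ‖u s‖ :=
      ⟨0, by simp⟩
    exact limsup_le_of_le hbelow.isCoboundedUnder_le hule
  have hvμ : ∀ᵐ s, s ∈ Ioc 0 T → ‖u (s - r - τ)‖ ≤ μ := by
    rw [hν, ae_restrict_iff' measurableSet_Ico] at hae
    have hae' := (measurePreserving_sub_right volume (r + τ)).quasiMeasurePreserving.ae hae
    filter_upwards [hae', hne] with s hs hsT hmem
    rw [← sub_sub] at hs
    exact hs (hshift hmem hsT)
  have herr := eulerIter_error (r := r) (τ := τ) (x₀ := x₀) (u := u) (z := fun s => x (s - r))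
    hf.continuous hL hlip hgrow hμ0 hμσ hρ0 hτr.le hNpos hvm hvμ (fun i hi => hρ _ (hVy i hi))
    (hxc.comp (by fun_prop) fun s hs => ⟨by linarith [hs.1], by linarith [hs.2]⟩)
    (fun t ht => by
      have h1 := hxint (t - r) ⟨by linarith [ht.1], by linarith [ht.2]⟩
      have h2 := intervalIntegral.integral_comp_sub_right (a := 0) (b := t)
        (fun s => f (x s) (u (s - τ))) r
      rw [zero_sub] at h2
      rw [h1, ← h2])
    hb2.le hb3 hb4.le
  simp only [add_sub_cancel_right] at herr
  refine herr.trans ?_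
  gcongr
  exact le_add_of_nonneg_right zero_le_one
end

section
/- For all (z, w, u) ∈ ℝ^n × ℝ^k × U with V(z) ≥ b, one has ∇V(z) · (f(z, u) + k̂(z, w, u)) ≤ −W(z). -/
open MeasureTheory Set Filter
open scoped RealInnerProductSpace Topology

/-- Under (H1), with the observer correction term
`k̂(z,y,u) = L(h(z)−y)` for `V(z) ≤ R` and
`k̂(z,y,u) = L(h(z)−y) − (φ(z,y,u)/|∇V(z)|²)(∇V(z))ᵀ` for `V(z) > R`, where
`φ(z,y,u) = max(0, ∇V(z)f(z,u) + W(z) + p(V(z))∇V(z)L(h(z)−y))`, one has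
`∇V(z)·(f(z,u) + k̂(z,w,u)) ≤ −W(z)` for all `(z,w,u) ∈ ℝⁿ × ℝᵏ × U` with `V(z) ≥ b`. -/
theorem stmt_8
    (n m k : ℕ)
    (f : EuclideanSpace ℝ (Fin n) → EuclideanSpace ℝ (Fin m) → EuclideanSpace ℝ (Fin n))
    (hf : ContDiff ℝ (⊤ : ℕ∞) (fun p : EuclideanSpace ℝ (Fin n) × EuclideanSpace ℝ (Fin m) => f p.1 p.2))
    (hf0 : f 0 0 = 0)
    (U : Set (EuclideanSpace ℝ (Fin m))) (hUcomp : IsCompact U) (hU0 : (0 : EuclideanSpace ℝ (Fin m)) ∈ U)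
    (h : EuclideanSpace ℝ (Fin n) → EuclideanSpace ℝ (Fin k)) (hh : ContDiff ℝ (⊤ : ℕ∞) h) (hh0 : h 0 = 0)
    -- (H1)
    (V : EuclideanSpace ℝ (Fin n) → ℝ) (hV : ContDiff ℝ 2 V) (hVnonneg : ∀ x, 0 ≤ V x)
    (hVradial : ∀ M : ℝ, Bornology.IsBounded {x | V x ≤ M})
    (W : EuclideanSpace ℝ (Fin n) → ℝ) (hW : ContDiff ℝ 1 W)
    (hWpos : W 0 = 0 ∧ ∀ x ≠ 0, 0 < W x)
    (R : ℝ) (hR : 0 < R)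
    (hH1 : ∀ x u, u ∈ U → R ≤ V x → ⟪gradient V x, f x u⟫ ≤ -W x)
    (hS1nhds : {x | V x ≤ R} ∈ 𝓝 (0 : EuclideanSpace ℝ (Fin n)))
    (hgradV : ∀ z, R < V z → gradient V z ≠ 0)
    -- the gain matrix `L` and the constants `a, b`
    (L : EuclideanSpace ℝ (Fin k) →L[ℝ] EuclideanSpace ℝ (Fin n))
    (a b : ℝ) (hab : a < b) (haR : R ≤ a)
    -- the function `p`
    (p : ℝ → ℝ) (hp : LocallyLipschitz p) (hp01 : ∀ s, p s ∈ Icc (0:ℝ) 1)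
    (hpb : ∀ s, b ≤ s → p s = 1) (hpa : ∀ s, s ≤ a → p s = 0)
    -- the functions `φ` and `k̂`
    (φ : EuclideanSpace ℝ (Fin n) → EuclideanSpace ℝ (Fin k) → EuclideanSpace ℝ (Fin m) → ℝ)
    (hφ : ∀ z y u, φ z y u =
      max 0 (⟪gradient V z, f z u⟫ + W z + p (V z) * ⟪gradient V z, L (h z - y)⟫))
    (khat : EuclideanSpace ℝ (Fin n) → EuclideanSpace ℝ (Fin k) → EuclideanSpace ℝ (Fin m) →
      EuclideanSpace ℝ (Fin n))
    (hkhat1 : ∀ z y u, V z ≤ R → khat z y u = L (h z - y))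
    (hkhat2 : ∀ z y u, R < V z →
      khat z y u = L (h z - y) - (φ z y u / ‖gradient V z‖ ^ 2) • gradient V z) :
    ∀ z w u, u ∈ U → b ≤ V z → ⟪gradient V z, f z u + khat z w u⟫ ≤ -W z := by
  intro z w u _ hbz
  have hRz : R < V z := by linarith
  have hne : ‖gradient V z‖ ^ 2 ≠ 0 := pow_ne_zero 2 (norm_ne_zero_iff.mpr (hgradV z hRz))
  have hle : ⟪gradient V z, f z u⟫ + W z + ⟪gradient V z, L (h z - w)⟫ ≤ φ z w u := by
    rw [hφ, hpb _ hbz, one_mul]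
    exact le_max_right _ _
  rw [hkhat2 z w u hRz, inner_add_right, inner_sub_right, inner_smul_right,
    real_inner_self_eq_norm_sq, div_mul_cancel₀ _ hne]
  linarith
end

section
/- For all x ∈ S₁, z ∈ S₂ and u ∈ U, one has (z − x)ᵀ Q (f(z, u) + k̂(z, h(x), u) − f(x, u)) ≤ −c ω |z − x|². -/
open MeasureTheory Set Filter
open scoped RealInnerProductSpace Topology

/-- If `φ` is at most `(1 - c) * G * A / B` with `B < 0 < G`, then correcting `A`
by `-(φ / G) * B` gives at most `c * A`. -/
lemma sub_div_mul_le_mul_of_le {A B G c φ : ℝ} (hB : B < 0) (hG : 0 < G)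
    (hφ : φ ≤ (1 - c) * G * A / B) : A - φ / G * B ≤ c * A := by
  have h₁ : φ / G ≤ (1 - c) * A / B := by
    rw [div_le_iff₀ hG]
    exact hφ.trans_eq (by ring)
  have h₂ : (1 - c) * A / B * B ≤ φ / G * B := mul_le_mul_of_nonpos_right h₁ hB.le
  rw [div_mul_cancel₀ _ hB.ne] at h₂
  linarith

/-- Under (H1), (H3), (H4), with the observer correction term `k̂` built
from `L`, `p`, `φ` as in the paper, the global observer inequality
`(z − x)ᵀQ(f(z,u) + k̂(z,h(x),u) − f(x,u)) ≤ −cω|z − x|²` holds for all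
`x ∈ S₁ = {V ≤ R}`, `z ∈ S₂ = {V ≤ b}` and `u ∈ U`. -/
theorem stmt_9
    (n m k : ℕ)
    (f : EuclideanSpace ℝ (Fin n) → EuclideanSpace ℝ (Fin m) → EuclideanSpace ℝ (Fin n))
    (hf : ContDiff ℝ (⊤ : ℕ∞) (fun p : EuclideanSpace ℝ (Fin n) × EuclideanSpace ℝ (Fin m) => f p.1 p.2))
    (hf0 : f 0 0 = 0)
    (U : Set (EuclideanSpace ℝ (Fin m))) (hUcomp : IsCompact U) (hU0 : (0 : EuclideanSpace ℝ (Fin m)) ∈ U)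
    (h : EuclideanSpace ℝ (Fin n) → EuclideanSpace ℝ (Fin k)) (hh : ContDiff ℝ (⊤ : ℕ∞) h) (hh0 : h 0 = 0)
    -- (H1)
    (V : EuclideanSpace ℝ (Fin n) → ℝ) (hV : ContDiff ℝ 2 V) (hVnonneg : ∀ x, 0 ≤ V x)
    (hVradial : ∀ M : ℝ, Bornology.IsBounded {x | V x ≤ M})
    (W : EuclideanSpace ℝ (Fin n) → ℝ) (hW : ContDiff ℝ 1 W)
    (hWpos : W 0 = 0 ∧ ∀ x ≠ 0, 0 < W x)
    (R : ℝ) (hR : 0 < R)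
    (hH1 : ∀ x u, u ∈ U → R ≤ V x → ⟪gradient V x, f x u⟫ ≤ -W x)
    (hS1nhds : {x | V x ≤ R} ∈ 𝓝 (0 : EuclideanSpace ℝ (Fin n)))
    (hgradV : ∀ z, R < V z → gradient V z ≠ 0)
    -- (H3)
    (Q : EuclideanSpace ℝ (Fin n) →L[ℝ] EuclideanSpace ℝ (Fin n))
    (hQsym : ∀ v w : EuclideanSpace ℝ (Fin n), ⟪Q v, w⟫ = ⟪v, Q w⟫)
    (hQpos : ∀ v : EuclideanSpace ℝ (Fin n), v ≠ 0 → 0 < ⟪v, Q v⟫)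
    (ω : ℝ) (hω : 0 < ω) (b : ℝ) (hbR : R < b)
    (L : EuclideanSpace ℝ (Fin k) →L[ℝ] EuclideanSpace ℝ (Fin n))
    (hH3 : ∀ u z x, u ∈ U → V z ≤ b → V x ≤ R →
      ⟪z - x, Q (f z u + L (h z - h x) - f x u)⟫ ≤ -ω * ‖z - x‖ ^ 2)
    -- (H4)
    (c : ℝ) (hc : c ∈ Ioo (0:ℝ) 1) (a : ℝ) (haR : R ≤ a) (hab : a < b)
    (hH4 : ∀ u z x, u ∈ U → a < V z → V z ≤ b → ⟪gradient V z, Q (z - x)⟫ < 0 → V x ≤ R →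
      ⟪gradient V z, f z u + L (h z - h x)⟫ ≤ -W z +
        (1 - c) * ‖gradient V z‖ ^ 2 *
          ⟪z - x, Q (f z u + L (h z - h x) - f x u)⟫ / ⟪gradient V z, Q (z - x)⟫)
    -- the function `p`
    (p : ℝ → ℝ) (hp : LocallyLipschitz p) (hp01 : ∀ s, p s ∈ Icc (0:ℝ) 1)
    (hpb : ∀ s, b ≤ s → p s = 1) (hpa : ∀ s, s ≤ a → p s = 0)
    -- the functions `φ` and `k̂`
    (φ : EuclideanSpace ℝ (Fin n) → EuclideanSpace ℝ (Fin k) → EuclideanSpace ℝ (Fin m) → ℝ)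
    (hφ : ∀ z y u, φ z y u =
      max 0 (⟪gradient V z, f z u⟫ + W z + p (V z) * ⟪gradient V z, L (h z - y)⟫))
    (khat : EuclideanSpace ℝ (Fin n) → EuclideanSpace ℝ (Fin k) → EuclideanSpace ℝ (Fin m) →
      EuclideanSpace ℝ (Fin n))
    (hkhat1 : ∀ z y u, V z ≤ R → khat z y u = L (h z - y))
    (hkhat2 : ∀ z y u, R < V z →
      khat z y u = L (h z - y) - (φ z y u / ‖gradient V z‖ ^ 2) • gradient V z) :
    ∀ x z u, V x ≤ R → V z ≤ b → u ∈ U →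
      ⟪z - x, Q (f z u + khat z (h x) u - f x u)⟫ ≤ -(c * ω) * ‖z - x‖ ^ 2 := by
  intro x z u hx hz hu
  have hA := hH3 u z x hu hz hx
  have hd : 0 ≤ ω * ‖z - x‖ ^ 2 := by positivity
  have hcA : ∀ A : ℝ, A ≤ -ω * ‖z - x‖ ^ 2 → c * A ≤ -(c * ω) * ‖z - x‖ ^ 2 := fun A h =>
    (mul_le_mul_of_nonneg_left h hc.1.le).trans_eq (by ring)
  have hAc : ∀ A : ℝ, A ≤ -ω * ‖z - x‖ ^ 2 → A ≤ c * A := fun A h => by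
    nlinarith [hc.2]
  rcases le_or_gt (V z) R with hzR | hzR
  · rw [hkhat1 z (h x) u hzR]
    exact (hAc _ hA).trans (hcA _ hA)
  have hG : 0 < ‖gradient V z‖ ^ 2 := by
    have := norm_pos_iff.2 (hgradV z hzR)
    positivity
  have hsplit : ⟪z - x, Q (f z u + khat z (h x) u - f x u)⟫ =
      ⟪z - x, Q (f z u + L (h z - h x) - f x u)⟫ -
        φ z (h x) u / ‖gradient V z‖ ^ 2 * ⟪gradient V z, Q (z - x)⟫ := by
    rw [hkhat2 z (h x) u hzR, ← add_sub_assoc, sub_right_comm, map_sub, map_smul, inner_sub_right,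
      inner_smul_right, ← hQsym (z - x) (gradient V z), real_inner_comm (Q (z - x))]
  rw [hsplit]
  refine le_trans ?_ (hcA _ hA)
  have hDW := hH1 z u hu hzR.le
  have hφ_nonneg : 0 ≤ φ z (h x) u := by
    rw [hφ]
    exact le_max_left _ _
  rcases le_or_gt 0 ⟪gradient V z, Q (z - x)⟫ with hB | hB
  · have : 0 ≤ φ z (h x) u / ‖gradient V z‖ ^ 2 * ⟪gradient V z, Q (z - x)⟫ := by positivity
    linarith [hAc _ hA]
  refine sub_div_mul_le_mul_of_le hB hG ?_
  have hK : 0 ≤ (1 - c) * ‖gradient V z‖ ^ 2 *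
      ⟪z - x, Q (f z u + L (h z - h x) - f x u)⟫ / ⟪gradient V z, Q (z - x)⟫ :=
    div_nonneg_of_nonpos
      (mul_nonpos_of_nonneg_of_nonpos (mul_nonneg (sub_nonneg.2 hc.2.le) hG.le) (by linarith)) hB.le
  rw [hφ]
  refine max_le hK ?_
  rcases le_or_gt (V z) a with hza | hza
  · rw [hpa _ hza]
    linarith
  · have h4 := hH4 u z x hu hza hz hB hx
    rw [inner_add_right] at h4
    obtain ⟨hp0, hp1⟩ := hp01 (V z)
    nlinarith
end

section
/- Let x_0 ∈ S₂, let u ∈ L^∞([−r−τ, 0); U), let x(t) be the solution of ẋ(t) = f(x(t), u(t−τ)) on [−r, τ] with x(−r) = x_0, and let x_0, x_1, …, x_N be the Euler iterates x_{i+1} = x_i + ∫_{i h_step}^{(i+1) h_step} f(x_i, u(s−r−τ)) ds with step h_step = (τ+r)/N. Define the errors e_i := x_i − x(i·h_step − r). If h_step ≤ min( r+τ, h̄, (2/(ā² P̄)) · min{W(x) : R ≤ V(x) ≤ b} ), then for all i ∈ {1, …, N}: |e_i| ≤ (h_step²/2) · L_X · L · (1 + exp(L(r+τ))) · (|x_0|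 + ‖u‖) · (exp(i·h_step·L_X) − 1)/(exp(h_step·L_X) − 1), where ‖u‖ = ess sup_{−r−τ ≤ s < 0} |u(s)|. -/
open MeasureTheory Set Filter
open scoped RealInnerProductSpace Topology

section SecondOrder

variable {E : Type*} [NormedAddCommGroup E] [NormedSpace ℝ E]

/-- Second-order Taylor upper bound along a segment issued from the centre of a ball. -/
lemma ContDiff.le_taylor_two_of_norm_iteratedFDeriv_le {V : E → ℝ} (hV : ContDiff ℝ 2 V)
    {x d : E} {P ρ : ℝ} (hP : ∀ ξ, ‖ξ - x‖ ≤ ρ → ‖iteratedFDeriv ℝ 2 V ξ‖ ≤ P) (hd : ‖d‖ ≤ ρ) :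
    V (x + d) ≤ V x + fderiv ℝ V x d + P / 2 * ‖d‖ ^ 2 := by
  have hρ : 0 ≤ ρ := (norm_nonneg d).trans hd
  have hV1 : Differentiable ℝ V := hV.differentiable (by norm_num)
  have hV2 : Differentiable ℝ (fderiv ℝ V) :=
    (hV.fderiv_right (m := 1) (by norm_num)).differentiable (by norm_num)
  have hlip : ∀ ξ, ‖ξ - x‖ ≤ ρ → ‖fderiv ℝ V ξ - fderiv ℝ V x‖ ≤ P * ‖ξ - x‖ := by
    intro ξ hξ
    refine Convex.norm_image_sub_le_of_norm_fderiv_le (𝕜 := ℝ) (s := Metric.closedBall x ρ)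
      (fun z _ => hV2 z) (fun z hz => ?_) (convex_closedBall x ρ)
      (Metric.mem_closedBall_self hρ) (by simpa [dist_eq_norm] using hξ)
    have := hP z (by simpa [dist_eq_norm] using hz)
    rwa [← norm_iteratedFDeriv_fderiv, ← zero_add 1, ← norm_iteratedFDeriv_fderiv,
      norm_iteratedFDeriv_zero] at this
  have hline : ∀ t : ℝ, HasDerivAt (fun t : ℝ => V (x + t • d)) (fderiv ℝ V (x + t • d) d) t := by
    intro t
    have h1 : HasDerivAt (fun t : ℝ => x + t • d) d t := by
      simpa using ((hasDerivAt_id t).smul_const d).const_add x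
    exact (hV1 (x + t • d)).hasFDerivAt.comp_hasDerivAt t h1
  have hB : ∀ t : ℝ, HasDerivAt
      (fun t : ℝ => V x + fderiv ℝ V x d * t + P / 2 * ‖d‖ ^ 2 * t ^ 2)
      (fderiv ℝ V x d + P * ‖d‖ ^ 2 * t) t := by
    intro t
    have h1 := (((hasDerivAt_id t).const_mul (fderiv ℝ V x d)).const_add (V x)).add
      ((hasDerivAt_pow 2 t).const_mul (P / 2 * ‖d‖ ^ 2))
    refine h1.congr_deriv ?_
    norm_num
    ring
  have key := image_le_of_deriv_right_le_deriv_boundary (a := 0) (b := 1)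
    (fun t _ => (hline t).continuousAt.continuousWithinAt)
    (fun t _ => (hline t).hasDerivWithinAt) (by simp)
    (fun t _ => (hB t).continuousAt.continuousWithinAt)
    (fun t _ => (hB t).hasDerivWithinAt)
    (fun t ht => by
      have ht0 : (0 : ℝ) ≤ t := ht.1
      have hn : ‖x + t • d - x‖ = t * ‖d‖ := by
        rw [add_sub_cancel_left, norm_smul, Real.norm_of_nonneg ht0]
      have h1 := hlip (x + t • d) (by rw [hn]; nlinarith [norm_nonneg d, ht.2])
      have h2 : (fderiv ℝ V (x + t • d) - fderiv ℝ V x) d ≤ P * (t * ‖d‖) * ‖d‖ := by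
        rw [hn] at h1
        exact (le_abs_self _).trans
          (((fderiv ℝ V (x + t • d) - fderiv ℝ V x).le_opNorm d).trans (by gcongr))
      rw [_root_.sub_apply] at h2
      nlinarith)
    (show (1 : ℝ) ∈ Icc 0 1 by simp)
  simpa using key

end SecondOrder

section Integrals

lemma exists_pos_bound_along {E F : Type*} [NormedAddCommGroup E] [NormedAddCommGroup F]
    {f : E → F → E} (hf : Continuous (fun p : E × F => f p.1 p.2))
    {U : Set F} (hU : IsCompact U) {y : ℝ → E} (hy : Continuous y) (a b : ℝ) :
    ∃ M > 0, ∀ s ∈ uIcc a b, ∀ v ∈ U, ‖f (y s) v‖ ≤ M := by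
  obtain ⟨M, hM⟩ := ((isCompact_uIcc (a := a) (b := b)).prod hU).exists_bound_of_continuousOn
    (f := fun p : ℝ × F => f (y p.1) p.2)
    (hf.comp ((hy.comp continuous_fst).prodMk continuous_snd)).continuousOn
  exact ⟨max M 1, by positivity, fun s hs v hv => (hM (s, v) ⟨hs, hv⟩).trans (le_max_left _ _)⟩

lemma intervalIntegrable_control {E F : Type*}
    [NormedAddCommGroup E] [NormedSpace ℝ E] [FiniteDimensional ℝ E]
    [MeasurableSpace E] [BorelSpace E]
    [NormedAddCommGroup F] [NormedSpace ℝ F] [FiniteDimensional ℝ F]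
    [MeasurableSpace F] [BorelSpace F]
    {f : E → F → E} (hf : Continuous (fun p : E × F => f p.1 p.2))
    {U : Set F} (hU : IsCompact U) {y : ℝ → E} (hy : Continuous y)
    {w : ℝ → F} (hw : Measurable w) (hwU : ∀ s, w s ∈ U) (a b : ℝ) :
    IntervalIntegrable (fun s => f (y s) (w s)) volume a b := by
  obtain ⟨M, _, hM⟩ := exists_pos_bound_along hf hU hy a b
  have hproper : ProperSpace E := FiniteDimensional.proper ℝ E
  have hproper' : ProperSpace F := FiniteDimensional.proper ℝ F
  have hmeas : Measurable (fun s => f (y s) (w s)) := hf.measurable.comp (hy.measurable.prodMk hw)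
  refine (intervalIntegrable_const (c := M)).mono_fun hmeas.aestronglyMeasurable ?_
  refine (ae_restrict_iff' measurableSet_uIoc).2 (Eventually.of_forall fun s hs => ?_)
  exact (hM s (uIoc_subset_uIcc hs) _ (hwU s)).trans (le_abs_self M)

lemma ContinuousLinearMap.intervalIntegral_le_of_le {E : Type*} [NormedAddCommGroup E] [NormedSpace ℝ E]
    [CompleteSpace E] (ℓ : E →L[ℝ] ℝ)
    {g : ℝ → E} {a b c : ℝ}
    (hab : a ≤ b) (hg : IntervalIntegrable g volume a b) (hc : ∀ s ∈ Icc a b, ℓ (g s) ≤ c) :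
    ℓ (∫ s in a..b, g s) ≤ c * (b - a) := by
  rw [← ℓ.intervalIntegral_comp_comm hg]
  refine (intervalIntegral.integral_mono_on hab
    ⟨ℓ.integrable_comp hg.1, ℓ.integrable_comp hg.2⟩ intervalIntegrable_const hc).trans ?_
  simp [mul_comm]

end Integrals

/-- Grönwall estimate for solutions of an equation with linear growth along the solution. -/
lemma norm_solution_le {E : Type*} [NormedAddCommGroup E] [NormedSpace ℝ E]
    {y g : ℝ → E} {x₀ : E} {T : ℝ} (hy : Continuous y)
    (hsol : ∀ t ∈ Icc 0 T, y t = x₀ + ∫ s in (0 : ℝ)..t, g s)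
    {L μ : ℝ} (hL : 0 ≤ L) (hμ : 0 ≤ μ)
    (hgrowth : ∀ s ∈ Icc 0 T, ‖g s‖ ≤ L * (‖y s‖ + μ)) :
    ∀ t ∈ Icc 0 T, ‖y t‖ + μ ≤ (‖x₀‖ + μ) * Real.exp (L * t) := by
  have hcont : Continuous (fun s => L * (‖y s‖ + μ)) := by fun_prop
  set G : ℝ → ℝ := fun t => ‖x₀‖ + μ + ∫ s in (0 : ℝ)..t, L * (‖y s‖ + μ) with hG
  have hGderiv : ∀ t, HasDerivAt G (L * (‖y t‖ + μ)) t := fun t =>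
    (intervalIntegral.integral_hasDerivAt_right (hcont.intervalIntegrable _ _)
      hcont.stronglyMeasurable.stronglyMeasurableAtFilter hcont.continuousAt).const_add _
  have hyG : ∀ t ∈ Icc 0 T, ‖y t‖ + μ ≤ G t := by
    intro t ht
    rw [hsol t ht, hG]
    have h1 := intervalIntegral.norm_integral_le_of_norm_le (μ := volume) ht.1
      (Eventually.of_forall fun s (hs : s ∈ Ioc 0 t) => hgrowth s ⟨hs.1.le, hs.2.trans ht.2⟩)
      (hcont.intervalIntegrable 0 t)
    have h2 := norm_add_le x₀ (∫ s in (0 : ℝ)..t, g s)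
    simp only
    linarith
  intro t ht
  have hgr := norm_le_gronwallBound_of_norm_deriv_right_le (f := G)
    (f' := fun t => L * (‖y t‖ + μ)) (δ := ‖x₀‖ + μ) (K := L) (ε := 0) (a := 0) (b := T)
    (fun s _ => (hGderiv s).continuousAt.continuousWithinAt)
    (fun s _ => (hGderiv s).hasDerivWithinAt)
    (by simp [hG, abs_of_nonneg (add_nonneg (norm_nonneg x₀) hμ)])
    (fun s hs => by
      rw [Real.norm_of_nonneg (by positivity), add_zero]
      exact mul_le_mul_of_nonneg_left
        ((hyG s ⟨hs.1, hs.2.le⟩).trans (le_abs_self _)) hL) t ht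
  rw [gronwallBound_ε0, sub_zero] at hgr
  exact (hyG t ht).trans ((le_abs_self _).trans hgr)

section Trajectories

variable {E F : Type*} [NormedAddCommGroup E] [NormedSpace ℝ E] [FiniteDimensional ℝ E]
  [MeasurableSpace E] [BorelSpace E]
  [NormedAddCommGroup F] [NormedSpace ℝ F] [FiniteDimensional ℝ F]
  [MeasurableSpace F] [BorelSpace F]
  {f : E → F → E} {U : Set F} {y : ℝ → E} {w : ℝ → F} {x₀ : E} {T : ℝ}

lemma solution_sub_eq_integral (hf : Continuous (fun p : E × F => f p.1 p.2)) (hU : IsCompact U)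
    (hy : Continuous y) (hw : Measurable w) (hwU : ∀ s, w s ∈ U)
    (hsol : ∀ t ∈ Icc 0 T, y t = x₀ + ∫ s in (0 : ℝ)..t, f (y s) (w s))
    {t z : ℝ} (ht : t ∈ Icc 0 T) (hz : z ∈ Icc 0 T) :
    y z - y t = ∫ s in t..z, f (y s) (w s) := by
  have hint := intervalIntegrable_control hf hU hy hw hwU
  rw [hsol z hz, hsol t ht, add_sub_add_left_eq_sub,
    intervalIntegral.integral_interval_sub_left (hint _ _) (hint _ _)]

/-- If all admissible velocities at `y t` give `V` a rate at most `c`, so does the solution. -/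
lemma frequently_slope_lt_of_fderiv_le (hf : Continuous (fun p : E × F => f p.1 p.2))
    (hU : IsCompact U) (hy : Continuous y) (hw : Measurable w) (hwU : ∀ s, w s ∈ U)
    (hsol : ∀ t ∈ Icc 0 T, y t = x₀ + ∫ s in (0 : ℝ)..t, f (y s) (w s))
    {V : E → ℝ} (hV : Differentiable ℝ V) {t c r : ℝ} (ht : t ∈ Ico 0 T)
    (hc : ∀ v ∈ U, fderiv ℝ V (y t) (f (y t) v) ≤ c) (hcr : c < r) :
    ∃ᶠ z in 𝓝[>] t, slope (fun s => V (y s)) t z < r := by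
  obtain ⟨M, hM0, hM⟩ := exists_pos_bound_along hf hU hy 0 T
  have hT : 0 ≤ T := ht.1.trans ht.2.le
  rw [uIcc_of_le hT] at hM
  set ε := (r - c) / 3 with hε
  have hε0 : 0 < ε := by rw [hε]; linarith
  set ℓ := fderiv ℝ V (y t) with hℓ
  have hnear : ∀ᶠ s in 𝓝 t, ∀ v ∈ U, ℓ (f (y s) v) < c + ε := by
    refine hU.eventually_forall_of_forall_eventually fun v hv => ?_
    have hcont : Continuous (fun p : ℝ × F => ℓ (f (y p.1) p.2)) :=
      ℓ.continuous.comp (hf.comp ((hy.comp continuous_fst).prodMk continuous_snd))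
    exact hcont.continuousAt.eventually_lt continuousAt_const
      (by have := hc v hv; simp only; linarith)
  have hlin : ∀ᶠ z in 𝓝 t, ‖V (y z) - V (y t) - ℓ (y z - y t)‖ ≤ ε / M * ‖y z - y t‖ :=
    hy.continuousAt.eventually ((hV (y t)).hasFDerivAt.isLittleO.def (by positivity))
  obtain ⟨δ, hδ, hball⟩ := Metric.eventually_nhds_iff_ball.1 (hnear.and hlin)
  have hz : ∀ᶠ z in 𝓝[>] t, z ∈ Ioo t (min (t + δ) T) :=
    Ioo_mem_nhdsGT (lt_min (by linarith) ht.2)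
  refine Eventually.frequently (hz.mono fun z hz => ?_)
  have hzδ : z < t + δ := hz.2.trans_le (min_le_left _ _)
  have hzT : z < T := hz.2.trans_le (min_le_right _ _)
  have hzI : z ∈ Icc 0 T := ⟨ht.1.trans hz.1.le, hzT.le⟩
  have hdiff := solution_sub_eq_integral hf hU hy hw hwU hsol ⟨ht.1, ht.2.le⟩ hzI
  have hmem : ∀ s ∈ Icc t z, s ∈ Metric.ball t δ := fun s hs => by
    rw [Metric.mem_ball, Real.dist_eq, abs_of_nonneg (by linarith [hs.1])]
    linarith [hs.2]
  have h1 : ℓ (y z - y t) ≤ (c + ε) * (z - t) := by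
    rw [hdiff]
    exact ℓ.intervalIntegral_le_of_le hz.1.le
      (intervalIntegrable_control hf hU hy hw hwU _ _)
      fun s hs => ((hball s (hmem s hs)).1 _ (hwU s)).le
  have h2 : ‖y z - y t‖ ≤ M * (z - t) := by
    rw [hdiff]
    have := intervalIntegral.norm_integral_le_of_norm_le_const (a := t) (b := z)
      (f := fun s => f (y s) (w s)) (C := M) fun s hs => by
        rw [uIoc_of_le hz.1.le] at hs
        exact hM s ⟨ht.1.trans hs.1.le, hs.2.trans hzT.le⟩ _ (hwU s)
    rwa [abs_of_nonneg (by linarith [hz.1])] at this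
  have h3 : V (y z) - V (y t) - ℓ (y z - y t) ≤ ε * (z - t) := by
    refine (le_abs_self _).trans (((hball z (hmem z ⟨hz.1.le, le_rfl⟩)).2).trans ?_)
    calc ε / M * ‖y z - y t‖ ≤ ε / M * (M * (z - t)) := by gcongr
      _ = ε * (z - t) := by field_simp
  rw [slope_def_field, div_lt_iff₀ (by linarith [hz.1])]
  have : 0 < ε * (z - t) := mul_pos hε0 (by linarith [hz.1])
  have hr : r = c + 3 * ε := by rw [hε]; ring
  rw [hr]
  linarith

/-- A sublevel set on whose boundary `V` strictly decreases is forward invariant. -/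
lemma solution_mem_sublevel (hf : Continuous (fun p : E × F => f p.1 p.2))
    (hU : IsCompact U) (hy : Continuous y) (hw : Measurable w) (hwU : ∀ s, w s ∈ U)
    (hsol : ∀ t ∈ Icc 0 T, y t = x₀ + ∫ s in (0 : ℝ)..t, f (y s) (w s))
    {V : E → ℝ} (hV : Differentiable ℝ V) {W : E → ℝ} {b : ℝ}
    (hW : ∀ x, V x = b → 0 < W x)
    (hdec : ∀ x, ∀ v ∈ U, V x = b → fderiv ℝ V x (f x v) ≤ -W x) (hx₀ : V x₀ ≤ b) :
    ∀ t ∈ Icc 0 T, V (y t) ≤ b := by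
  intro t ht
  have hT : 0 ≤ T := ht.1.trans ht.2
  obtain ⟨M, _, hM⟩ := exists_pos_bound_along hf hU hy 0 T
  rw [uIcc_of_le hT] at hM
  classical
  refine image_le_of_liminf_slope_right_lt_deriv_boundary (f := fun s => V (y s))
    (f' := fun s => if V (y s) = b then -W (y s) else ‖fderiv ℝ V (y s)‖ * M)
    (B := fun _ => b) (B' := fun _ => 0)
    (hV.continuous.comp hy).continuousOn (fun s hs r hr => ?_) ?_
    (fun _ => hasDerivAt_const _ _) (fun s _ hs => ?_) ht
  · refine frequently_slope_lt_of_fderiv_le hf hU hy hw hwU hsol hV hs (fun v hv => ?_) hr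
    split_ifs with h
    · exact hdec _ v hv h
    · exact (le_abs_self _).trans (((fderiv ℝ V (y s)).le_opNorm _).trans
        (mul_le_mul_of_nonneg_left (hM s ⟨hs.1, hs.2.le⟩ v hv) (norm_nonneg _)))
  · simpa [hsol 0 ⟨le_rfl, hT⟩] using hx₀
  · simp only [hs, if_true]
    linarith [hW _ hs]

/-- One explicit Euler step keeps the sublevel set `{V ≤ b}` invariant. -/
lemma euler_step_mem_sublevel (hf : Continuous (fun p : E × F => f p.1 p.2))
    (hU : IsCompact U) (hw : Measurable w) (hwU : ∀ s, w s ∈ U)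
    {V : E → ℝ} (hV : ContDiff ℝ 2 V) {W : E → ℝ} {R b A h hbar P Wmin : ℝ}
    (hA : 0 < A) (hfA : ∀ x, ∀ v ∈ U, V x ≤ b → ‖f x v‖ ≤ A)
    (hdec : ∀ x, ∀ v ∈ U, R ≤ V x → fderiv ℝ V x (f x v) ≤ -W x)
    (hWmin : ∀ x, R ≤ V x → V x ≤ b → Wmin ≤ W x)
    (hhbar0 : 0 < hbar)
    (hhbar : ∀ ξ, (∃ x, V x ≤ R ∧ ‖ξ - x‖ ≤ A * T) → R + hbar * A * ‖fderiv ℝ V ξ‖ ≤ b)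
    (hP0 : 0 < P)
    (hP : ∀ ξ, (∃ x, V x ≤ b ∧ ‖ξ - x‖ ≤ A * min T hbar) → ‖iteratedFDeriv ℝ 2 V ξ‖ ≤ P)
    (hh : 0 ≤ h) (hhT : h ≤ T) (hhh : h ≤ hbar) (hhW : h ≤ 2 / (A ^ 2 * P) * Wmin)
    {x : E} (hx : V x ≤ b) (a : ℝ) :
    V (x + ∫ s in a..(a + h), f x (w s)) ≤ b := by
  have hint : IntervalIntegrable (fun s => f x (w s)) volume a (a + h) :=
    intervalIntegrable_control hf hU continuous_const hw hwU a (a + h)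
  set d := ∫ s in a..(a + h), f x (w s) with hd
  have hdn : ‖d‖ ≤ A * h := by
    have := intervalIntegral.norm_integral_le_of_norm_le_const (a := a) (b := a + h)
      (f := fun s => f x (w s)) (C := A) fun s _ => hfA x _ (hwU s) hx
    rwa [add_sub_cancel_left, abs_of_nonneg hh] at this
  rcases le_total (V x) R with hxR | hxR
  · have hball : ∀ ξ ∈ Metric.closedBall x (A * T), ‖fderiv ℝ V ξ‖ ≤ (b - R) / (hbar * A) := by
      intro ξ hξ
      have := hhbar ξ ⟨x, hxR, by simpa [dist_eq_norm] using hξ⟩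
      rw [le_div_iff₀ (by positivity)]
      linarith
    have hT : 0 ≤ T := hh.trans hhT
    have hxm : x ∈ Metric.closedBall x (A * T) := Metric.mem_closedBall_self (by positivity)
    have hmv := Convex.norm_image_sub_le_of_norm_fderiv_le (𝕜 := ℝ) (f := V)
      (fun z _ => hV.differentiable (by norm_num) z) hball (convex_closedBall x (A * T)) hxm
      (y := x + d) (by
        rw [Metric.mem_closedBall, dist_eq_norm, add_sub_cancel_left]
        exact hdn.trans (by gcongr))
    have hK : 0 ≤ (b - R) / (hbar * A) := (norm_nonneg _).trans (hball x hxm)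
    rw [add_sub_cancel_left] at hmv
    have h2 : (b - R) / (hbar * A) * ‖d‖ ≤ b - R := by
      calc (b - R) / (hbar * A) * ‖d‖ ≤ (b - R) / (hbar * A) * (hbar * A) := by
            refine mul_le_mul_of_nonneg_left (hdn.trans ?_) hK
            rw [mul_comm]; gcongr
        _ = b - R := by field_simp
    linarith [(le_abs_self (V (x + d) - V x)).trans hmv]
  · have h1 := hV.le_taylor_two_of_norm_iteratedFDeriv_le (x := x) (d := d)
      (fun ξ hξ => hP ξ ⟨x, hx, hξ⟩) (hdn.trans (by gcongr; exact le_min hhT hhh))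
    have h2 : fderiv ℝ V x d ≤ -Wmin * h := by
      have := (fderiv ℝ V x).intervalIntegral_le_of_le (c := -Wmin)
        (by linarith : a ≤ a + h) hint fun s _ =>
          (hdec x _ (hwU s) hxR).trans (neg_le_neg (hWmin x hxR hx))
      rwa [add_sub_cancel_left] at this
    have h3 : P / 2 * ‖d‖ ^ 2 ≤ Wmin * h := by
      have h4 : h * (A ^ 2 * P / 2) ≤ Wmin := by
        calc h * (A ^ 2 * P / 2) ≤ 2 / (A ^ 2 * P) * Wmin * (A ^ 2 * P / 2) := by gcongr
          _ = Wmin := by field_simp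
      calc P / 2 * ‖d‖ ^ 2 ≤ P / 2 * (A * h) ^ 2 := by gcongr
        _ = h * (A ^ 2 * P / 2) * h := by ring
        _ ≤ Wmin * h := by gcongr
    linarith

/-- Propagation of the Euler error over one step. -/
lemma euler_error_step (hf : Continuous (fun p : E × F => f p.1 p.2))
    (hU : IsCompact U) (hy : Continuous y) (hw : Measurable w) (hwU : ∀ s, w s ∈ U)
    (hsol : ∀ t ∈ Icc 0 T, y t = x₀ + ∫ s in (0 : ℝ)..t, f (y s) (w s))
    {S : Set E} {K C : ℝ} (hK : 0 ≤ K)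
    (hlip : ∀ x ∈ S, ∀ z ∈ S, ∀ v ∈ U, ‖f x v - f z v‖ ≤ K * ‖x - z‖)
    (hyS : ∀ t ∈ Icc 0 T, y t ∈ S)
    (hC : ∀ s ∈ Icc 0 T, ‖f (y s) (w s)‖ ≤ C)
    {a h : ℝ} (ha : 0 ≤ a) (hh : 0 ≤ h) (hah : a + h ≤ T) {x : E} (hx : x ∈ S) :
    ‖x + (∫ s in a..(a + h), f x (w s)) - y (a + h)‖ ≤
      (1 + h * K) * ‖x - y a‖ + h ^ 2 / 2 * K * C := by
  have haI : a ∈ Icc 0 T := ⟨ha, by linarith⟩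
  have hsub := fun z hz => solution_sub_eq_integral hf hU hy hw hwU hsol (z := z) haI hz
  have heq : x + (∫ s in a..(a + h), f x (w s)) - y (a + h) =
      (x - y a) + ∫ s in a..(a + h), (f x (w s) - f (y s) (w s)) := by
    rw [intervalIntegral.integral_sub
      (intervalIntegrable_control hf hU continuous_const hw hwU _ _)
      (intervalIntegrable_control hf hU hy hw hwU _ _), ← hsub (a + h) ⟨by linarith, hah⟩]
    abel
  have hbound : ∀ s ∈ Ioc a (a + h),
      ‖f x (w s) - f (y s) (w s)‖ ≤ K * ‖x - y a‖ + K * C * (s - a) := by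
    intro s hs
    have hsI : s ∈ Icc 0 T := ⟨by linarith [hs.1], hs.2.trans hah⟩
    have h1 : ‖y s - y a‖ ≤ C * (s - a) := by
      rw [hsub s hsI]
      have := intervalIntegral.norm_integral_le_of_norm_le_const (a := a) (b := s)
        (f := fun s => f (y s) (w s)) (C := C) fun q hq => by
          rw [uIoc_of_le hs.1.le] at hq
          exact hC q ⟨by linarith [hq.1], hq.2.trans hsI.2⟩
      rwa [abs_of_nonneg (by linarith [hs.1])] at this
    have h2 : ‖x - y s‖ ≤ ‖x - y a‖ + C * (s - a) := by
      have := norm_sub_le_norm_sub_add_norm_sub x (y a) (y s)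
      rw [norm_sub_rev (y a)] at this
      linarith
    calc ‖f x (w s) - f (y s) (w s)‖ ≤ K * ‖x - y s‖ := hlip x hx _ (hyS s hsI) _ (hwU s)
      _ ≤ K * (‖x - y a‖ + C * (s - a)) := by gcongr
      _ = _ := by ring
  have hint := intervalIntegral.norm_integral_le_of_norm_le (μ := volume) (by linarith : a ≤ a + h)
    (Eventually.of_forall hbound) (by apply Continuous.intervalIntegrable; fun_prop)
  have hval : ∫ s in a..(a + h), (K * ‖x - y a‖ + K * C * (s - a)) =
      h * K * ‖x - y a‖ + h ^ 2 / 2 * K * C := by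
    rw [intervalIntegral.integral_comp_sub_right (fun s => K * ‖x - y a‖ + K * C * s) a,
      intervalIntegral.integral_add (by simp) (by apply Continuous.intervalIntegrable; fun_prop),
      intervalIntegral.integral_const, intervalIntegral.integral_const_mul, integral_id]
    simp
    ring
  rw [heq]
  refine (norm_add_le _ _).trans ?_
  rw [hval] at hint
  linarith

end Trajectories

/-- Discrete Grönwall inequality in exponential form; for `a = 0` both sides vanish. -/
lemma discrete_gronwall_exp {e : ℕ → ℝ} {a D : ℝ} {N : ℕ} (ha : 0 ≤ a) (he : ∀ i, 0 ≤ e i)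
    (he0 : e 0 = 0) (hstep : ∀ i < N, e (i + 1) ≤ (1 + a) * e i + a * D) :
    ∀ i ≤ N, e i ≤ a * D * ((Real.exp (i * a) - 1) / (Real.exp a - 1)) := by
  rcases ha.eq_or_lt with rfl | ha
  · intro i
    induction i with
    | zero => simp [he0]
    | succ k ih =>
      intro hk
      have h1 := hstep k hk
      have h2 := ih (by omega)
      simp at h1 h2 ⊢
      linarith
  · have hq : 0 < Real.exp a - 1 := by linarith [Real.add_one_lt_exp ha.ne']
    intro i
    induction i with
    | zero => simp [he0]
    | succ k ih =>
      intro hk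
      have h1 := hstep k hk
      have h2 := ih (by omega)
      have h3 : (1 + a) * e k ≤ Real.exp a * e k :=
        mul_le_mul_of_nonneg_right (by linarith [Real.add_one_le_exp a]) (he k)
      have h4 := mul_le_mul_of_nonneg_left h2 (Real.exp_pos a).le
      have h5 : Real.exp a * (a * D * ((Real.exp (k * a) - 1) / (Real.exp a - 1))) + a * D =
          a * D * ((Real.exp ((k + 1 : ℕ) * a) - 1) / (Real.exp a - 1)) := by
        have : Real.exp ((k + 1 : ℕ) * a) = Real.exp (k * a) * Real.exp a := by
          rw [← Real.exp_add]; congr 1; push_cast; ring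
        rw [this]
        field_simp
        ring
      linarith

/-- Claim 2 in the proof of Lemma 3.3: for `x₀ ∈ S₂`, input
`u ∈ L^∞([−r−τ,0); U)`, the solution `x(t)` of `ẋ = f(x, u(t−τ))` on `[−r, τ]` with
`x(−r) = x₀` and the Euler iterates `x_i` with step `h = (τ+r)/N`, the errors
`e_i = x_i − x(i·h − r)` satisfy, provided
`h ≤ min(r+τ, h̄, (2/(ā²P̄))·min{W : R ≤ V ≤ b})`, for all `i ∈ {1,…,N}`:
`|e_i| ≤ (h²/2)·L_X·L·(1 + exp(L(r+τ)))·(|x₀| + ‖u‖)·(exp(i·h·L_X) − 1)/(exp(h·L_X) − 1)`. -/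
theorem stmt_11
    (n m : ℕ)
    (f : EuclideanSpace ℝ (Fin n) → EuclideanSpace ℝ (Fin m) → EuclideanSpace ℝ (Fin n))
    (hf : ContDiff ℝ (⊤ : ℕ∞) (fun p : EuclideanSpace ℝ (Fin n) × EuclideanSpace ℝ (Fin m) => f p.1 p.2))
    (hf0 : f 0 0 = 0)
    (U : Set (EuclideanSpace ℝ (Fin m))) (hUcomp : IsCompact U) (hU0 : (0 : EuclideanSpace ℝ (Fin m)) ∈ U)
    (τ r : ℝ) (hτ : 0 ≤ τ) (hr : 0 ≤ r) (hτr : 0 < τ + r)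
    -- (H1)
    (V : EuclideanSpace ℝ (Fin n) → ℝ) (hV : ContDiff ℝ 2 V) (hVnonneg : ∀ x, 0 ≤ V x)
    (hVradial : ∀ M : ℝ, Bornology.IsBounded {x | V x ≤ M})
    (W : EuclideanSpace ℝ (Fin n) → ℝ) (hW : ContDiff ℝ 1 W)
    (hWpos : W 0 = 0 ∧ ∀ x ≠ 0, 0 < W x)
    (R : ℝ) (hR : 0 < R)
    (hH1 : ∀ x u, u ∈ U → R ≤ V x → ⟪gradient V x, f x u⟫ ≤ -W x)
    (hS1nhds : {x | V x ≤ R} ∈ 𝓝 (0 : EuclideanSpace ℝ (Fin n)))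
    (b : ℝ) (hbR : R < b)
    -- the Lipschitz constants on `S₂ = {V ≤ b}`
    (LX : ℝ)
    (hLX : IsLUB {c : ℝ | ∃ x z u, V x ≤ b ∧ V z ≤ b ∧ u ∈ U ∧ x ≠ z ∧
      c = ‖f x u - f z u‖ / ‖x - z‖} LX)
    (LU : ℝ)
    (hLU : IsLUB {c : ℝ | ∃ x u v, V x ≤ b ∧ u ∈ U ∧ v ∈ U ∧ u ≠ v ∧
      c = ‖f x u - f x v‖ / ‖u - v‖} LU)
    -- the constants `ā`, `h̄`, `P̄` and `min{W(x) : R ≤ V(x) ≤ b}`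
    (abar : ℝ)
    (habar : IsGreatest {c : ℝ | ∃ x u, V x ≤ b ∧ u ∈ U ∧ c = ‖f x u‖} abar)
    (hbar : ℝ) (hhbarpos : 0 < hbar)
    (hhbar : ∀ ξ : EuclideanSpace ℝ (Fin n), (∃ x, V x ≤ R ∧ ‖ξ - x‖ ≤ abar * (r + τ)) →
      R + hbar * abar * ‖gradient V ξ‖ ≤ b)
    (Pbar : ℝ) (hPbarpos : 0 < Pbar)
    (hPbar : ∀ ξ : EuclideanSpace ℝ (Fin n),
      (∃ x, V x ≤ b ∧ ‖ξ - x‖ ≤ abar * min (r + τ) hbar) → ‖iteratedFDeriv ℝ 2 V ξ‖ ≤ Pbar)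
    (Wmin : ℝ) (hWmin : IsLeast {c : ℝ | ∃ x, R ≤ V x ∧ V x ≤ b ∧ c = W x} Wmin)
    -- the input, the solution and the Euler iterates
    (x₀ : EuclideanSpace ℝ (Fin n)) (hx₀ : V x₀ ≤ b)
    (u : ℝ → EuclideanSpace ℝ (Fin m)) (humeas : Measurable u)
    (huU : ∀ s ∈ Ico (-(r + τ)) (0:ℝ), u s ∈ U)
    (x : ℝ → EuclideanSpace ℝ (Fin n)) (hxcont : ContinuousOn x (Icc (-r) τ))
    (hxinit : x (-r) = x₀)
    (hxsol : ∀ t ∈ Icc (-r) τ, x t = x₀ + ∫ s in (-r)..t, f (x s) (u (s - τ)))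
    (N : ℕ) (hN : 0 < N)
    (hstep : (τ + r) / N ≤ min (min (r + τ) hbar) (2 / (abar ^ 2 * Pbar) * Wmin)) :
    ∀ i : ℕ, 1 ≤ i → i ≤ N →
      ‖eulerIter f r τ N x₀ u i - x ((i : ℝ) * ((τ + r) / N) - r)‖ ≤
        (((τ + r) / N) ^ 2 / 2) * LX * max LX LU *
          (1 + Real.exp (max LX LU * (r + τ))) *
          (‖x₀‖ + essSup (fun s => ‖u s‖) (volume.restrict (Ico (-(r + τ)) (0:ℝ)))) *
          ((Real.exp ((i : ℝ) * ((τ + r) / N) * LX) - 1) /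
            (Real.exp (((τ + r) / N) * LX) - 1)) := by
  have hNpos : (0 : ℝ) < N := by exact_mod_cast hN
  set h : ℝ := (τ + r) / N with hdef
  have hh : 0 < h := by positivity
  have hNh : (N : ℝ) * h = r + τ := by rw [hdef]; field_simp; ring
  have hT : (0 : ℝ) < r + τ := by linarith
  have hhT : h ≤ r + τ := hstep.trans ((min_le_left _ _).trans (min_le_left _ _))
  have hhh : h ≤ hbar := hstep.trans ((min_le_left _ _).trans (min_le_right _ _))
  have hhW : h ≤ 2 / (abar ^ 2 * Pbar) * Wmin := hstep.trans (min_le_right _ _)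
  have habar0 : 0 < abar := by
    obtain ⟨z, v, -, -, hzv⟩ := habar.1
    refine lt_of_le_of_ne (hzv ▸ norm_nonneg _) fun h0 => ?_
    rw [← h0] at hhW
    norm_num at hhW
    linarith
  have hfc : Continuous (fun p : EuclideanSpace ℝ (Fin n) × EuclideanSpace ℝ (Fin m) =>
      f p.1 p.2) := hf.continuous
  have hV0 : (0 : EuclideanSpace ℝ (Fin n)) ∈ {x | V x ≤ R} := mem_of_mem_nhds hS1nhds
  rw [mem_ofPred_eq] at hV0
  have hgrad : ∀ z v, ⟪gradient V z, v⟫ = fderiv ℝ V z v := fun z v => inner_gradient_left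
  have hgradn : ∀ z, ‖gradient V z‖ = ‖fderiv ℝ V z‖ := fun z => by simp [gradient]
  -- Lipschitz bounds
  have hLX0 : 0 ≤ LX := by
    obtain ⟨c, hc⟩ := hLX.nonempty
    refine le_trans ?_ (hLX.1 hc)
    obtain ⟨_, _, _, _, _, _, _, rfl⟩ := hc
    positivity
  have hlipX : ∀ z ∈ {z | V z ≤ b}, ∀ z' ∈ {z | V z ≤ b}, ∀ v ∈ U,
      ‖f z v - f z' v‖ ≤ LX * ‖z - z'‖ := by
    intro z hz z' hz' v hv
    rcases eq_or_ne z z' with rfl | hne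
    · simp
    · exact (div_le_iff₀ (norm_pos_iff.2 (sub_ne_zero.2 hne))).1
        (hLX.1 ⟨z, z', v, hz, hz', hv, hne, rfl⟩)
  have hlipU : ∀ v ∈ U, ‖f 0 v‖ ≤ LU * ‖v‖ := by
    intro v hv
    rcases eq_or_ne v 0 with rfl | hne
    · simp [hf0]
    · have := (div_le_iff₀ (norm_pos_iff.2 (sub_ne_zero.2 hne))).1
        (hLU.1 ⟨0, v, 0, hV0.trans hbR.le, hv, hU0, hne, rfl⟩)
      simpa [hf0] using this
  set L := max LX LU with hL
  have hL0 : 0 ≤ L := hLX0.trans (le_max_left _ _)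
  have hgrowth : ∀ z, V z ≤ b → ∀ v ∈ U, ‖f z v‖ ≤ L * (‖z‖ + ‖v‖) := by
    intro z hz v hv
    have h1 := hlipX z hz 0 (hV0.trans hbR.le) v hv
    rw [sub_zero] at h1
    have h2 := norm_add_le (f z v - f 0 v) (f 0 v)
    rw [sub_add_cancel] at h2
    have h3 : LX * ‖z‖ ≤ L * ‖z‖ := by gcongr; exact le_max_left _ _
    have h4 : LU * ‖v‖ ≤ L * ‖v‖ := by gcongr; exact le_max_right _ _
    linarith [hlipU v hv]
  -- the essential supremum of the input
  set μ := essSup (fun s => ‖u s‖) (volume.restrict (Ico (-(r + τ)) (0 : ℝ))) with hμ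
  have huμ : ∀ᵐ s ∂(volume.restrict (Ico (-(r + τ)) (0 : ℝ))), ‖u s‖ ≤ μ := by
    obtain ⟨B, hB⟩ := hUcomp.isBounded.exists_norm_le
    exact ae_le_essSup ⟨B, eventually_map.2 ((ae_restrict_iff' measurableSet_Ico).2
      (Eventually.of_forall fun s hs => hB _ (huU s hs)))⟩
  have hμ0 : 0 ≤ μ := by
    have hne : (volume.restrict (Ico (-(r + τ)) (0 : ℝ))) ≠ 0 := by
      rw [Ne, Measure.restrict_eq_zero, Real.volume_Ico]
      simpa using hT
    have := ae_neBot.2 hne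
    obtain ⟨s, hs⟩ := huμ.exists
    exact (norm_nonneg _).trans hs
  -- the input, modified on a null set so that its constraints hold everywhere
  classical
  set w : ℝ → EuclideanSpace ℝ (Fin m) :=
    (fun s => if s ∈ Ico (-(r + τ)) (0 : ℝ) ∩ {s | ‖u s‖ ≤ μ} then u s else 0) ∘
      (fun s => s - (r + τ)) with hw
  have hwmeas : Measurable w := by
    refine Measurable.comp (Measurable.ite ?_ humeas measurable_const)
      (measurable_id.sub_const _)
    exact measurableSet_Ico.inter (measurableSet_le humeas.norm measurable_const)
  have hwU : ∀ s, w s ∈ U ∧ ‖w s‖ ≤ μ := by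
    intro s
    simp only [hw, Function.comp_apply]
    split_ifs with hs
    · exact ⟨huU _ hs.1, hs.2⟩
    · exact ⟨hU0, by simpa using hμ0⟩
  have hwae : ∀ᵐ s : ℝ, s ∈ Ioc 0 (r + τ) → w s = u (s - r - τ) := by
    have h1 := (measurePreserving_sub_right volume (r + τ)).quasiMeasurePreserving.ae
      ((ae_restrict_iff' measurableSet_Ico).1 huμ)
    have h2 : ∀ᵐ s : ℝ, s ≠ r + τ := compl_mem_ae_iff.2 (measure_singleton _)
    filter_upwards [h1, h2] with s hs hne hsI
    have hmem : s - (r + τ) ∈ Ico (-(r + τ)) (0 : ℝ) :=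
      ⟨by linarith [hsI.1], by linarith [lt_of_le_of_ne hsI.2 hne]⟩
    simp only [hw, Function.comp_apply]
    rw [if_pos ⟨hmem, hs hmem⟩, sub_sub]
  -- the solution, shifted in time and extended continuously
  have hle : -r ≤ τ := by linarith
  set y : ℝ → EuclideanSpace ℝ (Fin n) :=
    fun t => IccExtend hle ((Icc (-r) τ).domRestrict x) (t - r) with hy
  have hyx : ∀ t ∈ Icc 0 (r + τ), y t = x (t - r) := fun t ht =>
    IccExtend_of_mem hle _ ⟨by linarith [ht.1], by linarith [ht.2]⟩
  have hycont : Continuous y :=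
    (continuousOn_iff_continuous_domRestrict.1 hxcont).Icc_extend'.comp (continuous_sub_right r)
  have hsol : ∀ t ∈ Icc 0 (r + τ), y t = x₀ + ∫ s in (0 : ℝ)..t, f (y s) (w s) := by
    intro t ht
    rw [hyx t ht, hxsol (t - r) ⟨by linarith [ht.1], by linarith [ht.2]⟩, ← zero_sub r,
      ← intervalIntegral.integral_comp_sub_right (fun s => f (x s) (u (s - τ))) r]
    congr 1
    refine intervalIntegral.integral_congr_ae (hwae.mono fun s hs hsI => ?_)
    rw [uIoc_of_le ht.1] at hsI
    rw [hs ⟨hsI.1, hsI.2.trans ht.2⟩, hyx s ⟨hsI.1.le, hsI.2.trans ht.2⟩]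
  have hVy : ∀ t ∈ Icc 0 (r + τ), V (y t) ≤ b := by
    refine solution_mem_sublevel hfc hUcomp hycont hwmeas (fun s => (hwU s).1) hsol
      (hV.differentiable (by norm_num)) (W := W) (fun z hz => hWpos.2 z ?_)
      (fun z v hv hz => hgrad z _ ▸ hH1 z v hv (hz ▸ hbR.le)) hx₀
    rintro rfl
    linarith
  have hynorm := norm_solution_le hycont hsol hL0 hμ0 fun s hs =>
    (hgrowth _ (hVy s hs) _ (hwU s).1).trans (by gcongr; exact (hwU s).2)
  have hspeed : ∀ s ∈ Icc 0 (r + τ),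
      ‖f (y s) (w s)‖ ≤ L * ((‖x₀‖ + μ) * Real.exp (L * (r + τ))) := by
    intro s hs
    refine (hgrowth _ (hVy s hs) _ (hwU s).1).trans ?_
    gcongr
    calc ‖y s‖ + ‖w s‖ ≤ ‖y s‖ + μ := by gcongr; exact (hwU s).2
      _ ≤ (‖x₀‖ + μ) * Real.exp (L * s) := hynorm s hs
      _ ≤ _ := by gcongr; exact hs.2
  -- the Euler iterates
  set X := eulerIter f r τ N x₀ u with hX
  have hih : ∀ i < N, (i : ℝ) * h + h ≤ r + τ := by
    intro i hi
    have : ((i : ℝ) + 1) * h ≤ N * h := by gcongr; exact_mod_cast hi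
    linarith
  have hXsucc : ∀ i < N, X (i + 1) = X i + ∫ s in (i * h : ℝ)..(i * h + h), f (X i) (w s) := by
    intro i hi
    have h1 : X (i + 1) = X i +
        ∫ s in ((i : ℝ) * h)..(((i : ℝ) + 1) * h), f (X i) (u (s - r - τ)) := rfl
    rw [h1, add_one_mul]
    congr 1
    refine intervalIntegral.integral_congr_ae (hwae.mono fun s hs hsI => ?_)
    rw [uIoc_of_le (by linarith)] at hsI
    rw [hs ⟨lt_of_le_of_lt (by positivity) hsI.1, hsI.2.trans (hih i hi)⟩]
  have hXV : ∀ i ≤ N, V (X i) ≤ b := by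
    intro i
    induction i with
    | zero => exact fun _ => hx₀
    | succ k ih =>
      intro hk
      rw [hXsucc k hk]
      exact euler_step_mem_sublevel hfc hUcomp hwmeas (fun s => (hwU s).1) hV habar0
        (fun z v hv hz => habar.2 ⟨z, v, hz, hv, rfl⟩)
        (fun z v hv hz => hgrad z _ ▸ hH1 z v hv hz)
        (fun z hz hz' => hWmin.2 ⟨z, hz, hz', rfl⟩) hhbarpos
        (fun ξ hξ => hgradn ξ ▸ hhbar ξ hξ) hPbarpos hPbar hh.le hhT hhh hhW
        (ih (by omega)) _
  have herr := discrete_gronwall_exp (e := fun i => ‖X i - y (i * h)‖) (a := h * LX)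
    (D := h / 2 * (L * ((‖x₀‖ + μ) * Real.exp (L * (r + τ))))) (N := N) (by positivity)
    (fun _ => norm_nonneg _)
    (by
      have h0 : y 0 = x₀ := by simpa using hsol 0 ⟨le_rfl, hT.le⟩
      simp [h0, hX, eulerIter])
    (fun i hi => by
      have := euler_error_step hfc hUcomp hycont hwmeas (fun s => (hwU s).1) hsol hLX0 hlipX
        hVy hspeed (a := i * h) (by positivity) hh.le (hih i hi) (hXV i hi.le)
      rw [← hXsucc i hi] at this
      push_cast
      rw [add_one_mul]
      linarith)
  intro i _ hi
  have hiI : (i : ℝ) * h ∈ Icc 0 (r + τ) :=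
    ⟨by positivity, by rw [← hNh]; gcongr⟩
  have hei := herr i hi
  rw [hyx _ hiI, ← mul_assoc (i : ℝ) h LX] at hei
  refine hei.trans (mul_le_mul_of_nonneg_right ?_ ?_)
  · have h1 : 0 ≤ h ^ 2 / 2 * LX * L * (‖x₀‖ + μ) := by positivity
    nlinarith
  · exact div_nonneg (sub_nonneg.2 (Real.one_le_exp (by positivity)))
      (sub_nonneg.2 (Real.one_le_exp (by positivity)))
end

section
/- Let T_s > 0, let {τ_i}_{i=0}^∞ be a partition of [0,∞) with sup_{i≥0}(τ_{i+1} − τ_i) ≤ T_s, let u : [−r−τ,∞) → U be measurable and essentially bounded, and let x : [−r,∞) → ℝ^n, z : [0,∞) → ℝ^n, w : [0,∞) → ℝ^k satisfy: ẋ(t) = f(x(t), u(t−τ)) for t ≥ 0 a.e.; ẇ(t) = ∇h(z(t)) f(z(t), u(t−r−τ)) on each [τ_i, τ_{i+1}) a.e. with w(τ_i) = h(x(τ_i − r)); and x(t−r) ∈ S₁, z(t) ∈ S₂ for all t ≥ τ_l, where l > 0 is an integer with τ_l ≥ r. Then for every integer i ≥ l and every t ∈ [τ_i, τ_{i+1}):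 |w(t) − h(x(t−r))| ≤ T_s · G₁ · sup_{τ_i ≤ s ≤ t} |z(s) − x(s−r)|, where G₁ := sup{ |∇h(x)f(x,u) − ∇h(z)f(z,u)| / |x−z| : x ∈ S₁, z ∈ S₂, u ∈ U, x ≠ z }. -/
open MeasureTheory Set Filter
open scoped RealInnerProductSpace Topology

section AbsolutelyContinuous

variable {E F : Type*} [NormedAddCommGroup E] [NormedSpace ℝ E]
  [NormedAddCommGroup F] [NormedSpace ℝ F]

theorem intervalIntegral_lipschitzOnWith_of_norm_le {v : ℝ → E} {a b : ℝ} {C : NNReal}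
    (hab : a ≤ b) (hv : IntervalIntegrable v volume a b) (hC : ∀ s ∈ Icc a b, ‖v s‖ ≤ C) :
    LipschitzOnWith C (fun t => ∫ s in a..t, v s) (Icc a b) := by
  have hint : ∀ t ∈ Icc a b, IntervalIntegrable v volume a t := fun t ht =>
    hv.mono_set (by rw [uIcc_of_le hab, uIcc_of_le ht.1]; exact Icc_subset_Icc_right ht.2)
  refine LipschitzOnWith.of_dist_le_mul fun t ht t' ht' => ?_
  rw [dist_eq_norm, intervalIntegral.integral_interval_sub_left (hint t ht) (hint t' ht'),
    Real.dist_eq]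
  refine intervalIntegral.norm_integral_le_of_norm_le_const fun s hs => hC s ?_
  exact uIcc_subset_Icc ht' ht (uIoc_subset_uIcc hs)

/-- The fundamental theorem of calculus for `h ∘ X`, where `h` is `C¹` and `X` is the indefinite
integral of a bounded function. -/
theorem sub_eq_integral_fderiv_comp_of_bounded [CompleteSpace E] [CompleteSpace F]
    {h : E → F} (hh : ContDiff ℝ 1 h) {X v : ℝ → E} {a b C C' : ℝ} (hab : a ≤ b)
    (hv : IntervalIntegrable v volume a b) (hC : ∀ s ∈ Icc a b, ‖v s‖ ≤ C)
    (hX : ∀ t ∈ Icc a b, X t = X a + ∫ s in a..t, v s)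
    (hw : IntervalIntegrable (fun s => fderiv ℝ h (X s) (v s)) volume a b)
    (hC' : ∀ s ∈ Icc a b, ‖fderiv ℝ h (X s) (v s)‖ ≤ C') :
    h (X b) - h (X a) = ∫ s in a..b, fderiv ℝ h (X s) (v s) := by
  have hlip := intervalIntegral_lipschitzOnWith_of_norm_le (C := C.toNNReal) hab hv
    fun s hs => (hC s hs).trans (Real.le_coe_toNNReal C)
  have hlip' := intervalIntegral_lipschitzOnWith_of_norm_le (C := C'.toNNReal) hab hw
    fun s hs => (hC' s hs).trans (Real.le_coe_toNNReal C')
  have hXlip : LipschitzOnWith C.toNNReal X (Icc a b) := by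
    refine LipschitzOnWith.of_dist_le_mul fun t ht t' ht' => ?_
    rw [hX t ht, hX t' ht', dist_add_left]
    exact hlip.dist_le_mul t ht t' ht'
  obtain ⟨K, hK⟩ := (hh.locallyLipschitz.locallyLipschitzOn
    (s := X '' Icc a b)).exists_lipschitzOnWith_of_compact
      (isCompact_Icc.image_of_continuousOn hXlip.continuousOn)
  have hcomp := hK.comp hXlip (mapsTo_image X (Icc a b))
  rw [← uIcc_of_le hab] at hcomp hlip'
  have hac := hcomp.absolutelyContinuousOnInterval.sub hlip'.absolutelyContinuousOnInterval
  have hae : ∀ᵐ t, t ∈ uIcc a b →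
      HasDerivAt (h ∘ X - fun t => ∫ s in a..t, fderiv ℝ h (X s) (v s)) 0 t := by
    have hne : ∀ c : ℝ, ∀ᵐ t : ℝ, t ≠ c := fun c => by simp [ae_iff, measure_singleton]
    filter_upwards [hv.ae_hasDerivAt_integral, hw.ae_hasDerivAt_integral, hne a, hne b]
      with t h₁ h₂ hta htb ht
    have ht' : t ∈ Icc a b := by rwa [uIcc_of_le hab] at ht
    have hXd : HasDerivAt X (v t) t := by
      refine ((h₁ ht a left_mem_uIcc).const_add (X a)).congr_of_eventuallyEq ?_
      filter_upwards [Icc_mem_nhds (lt_of_le_of_ne ht'.1 hta.symm) (lt_of_le_of_ne ht'.2 htb)]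
        with s hs using hX s hs
    have hd := ((hh.differentiable one_ne_zero (X t)).hasFDerivAt.comp_hasDerivAt t hXd).sub
      (h₂ ht a left_mem_uIcc)
    rwa [sub_self] at hd
  obtain ⟨c, hc⟩ := hac.const_of_ae_hasDerivAt_zero hae
  have hca := hc a left_mem_uIcc
  have hcb := hc b right_mem_uIcc
  simp only [Pi.sub_apply, Function.comp_apply, intervalIntegral.integral_same, sub_zero]
    at hca hcb
  rw [hca, ← hcb, sub_sub_cancel]

end AbsolutelyContinuous

theorem exists_bound_and_intervalIntegrable_comp_prodMk {E M F : Type*} [NormedAddCommGroup E]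
    [NormedAddCommGroup M] [NormedAddCommGroup F]
    {φ : E × M → F} (hφ : Continuous φ) {U : Set M} (hU : IsCompact U)
    {X : ℝ → E} {u : ℝ → M} {a b : ℝ} (hab : a ≤ b) (hX : ContinuousOn X (Icc a b))
    (hu : StronglyMeasurable u) (huU : ∀ t, u t ∈ U) :
    (∃ C, ∀ s ∈ Icc a b, ‖φ (X s, u s)‖ ≤ C) ∧
      IntervalIntegrable (fun s => φ (X s, u s)) volume a b := by
  obtain ⟨C, hC⟩ := ((isCompact_Icc.image_of_continuousOn hX).prod hU).exists_bound_of_continuousOn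
    hφ.continuousOn
  have hb : ∀ s ∈ Icc a b, ‖φ (X s, u s)‖ ≤ C := fun s hs =>
    hC _ ⟨mem_image_of_mem X hs, huU s⟩
  refine ⟨⟨C, hb⟩, ?_⟩
  rw [intervalIntegrable_iff_integrableOn_Icc_of_le hab]
  refine IntegrableOn.of_bound measure_Icc_lt_top ?_ C
    ((ae_restrict_iff' measurableSet_Icc).2 (Eventually.of_forall hb))
  exact hφ.comp_aestronglyMeasurable
    ((hX.aestronglyMeasurable measurableSet_Icc).prodMk hu.aestronglyMeasurable)

/-- Under (H1), with `S₁ = {V ≤ R}`, `S₂ = {V ≤ b}` and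
`G₁ = sup{ |∇h(x)f(x,u) − ∇h(z)f(z,u)|/|x−z| : x ∈ S₁, z ∈ S₂, u ∈ U, x ≠ z }`,
for every partition `{τ_i}` with steps `≤ T_s`, every admissible input `u`, every
plant trajectory `x`, observer trajectory `z` and inter-sample predictor `w` (resets
`w(τ_i) = h(x(τ_i − r))`), with `x(t−r) ∈ S₁` and `z(t) ∈ S₂` for `t ≥ τ_l`, one has for
all `i ≥ l` and `t ∈ [τ_i, τ_{i+1})`:
`|w(t) − h(x(t−r))| ≤ T_s · G₁ · sup_{τ_i ≤ s ≤ t} |z(s) − x(s−r)|`. -/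
theorem stmt_12
    (n m k : ℕ)
    (f : EuclideanSpace ℝ (Fin n) → EuclideanSpace ℝ (Fin m) → EuclideanSpace ℝ (Fin n))
    (hf : ContDiff ℝ (⊤ : ℕ∞) (fun p : EuclideanSpace ℝ (Fin n) × EuclideanSpace ℝ (Fin m) => f p.1 p.2))
    (hf0 : f 0 0 = 0)
    (U : Set (EuclideanSpace ℝ (Fin m))) (hUcomp : IsCompact U) (hU0 : (0 : EuclideanSpace ℝ (Fin m)) ∈ U)
    (h : EuclideanSpace ℝ (Fin n) → EuclideanSpace ℝ (Fin k)) (hh : ContDiff ℝ (⊤ : ℕ∞) h) (hh0 : h 0 = 0)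
    (τ r : ℝ) (hτ : 0 ≤ τ) (hr : 0 ≤ r)
    -- (H1)
    (V : EuclideanSpace ℝ (Fin n) → ℝ) (hV : ContDiff ℝ 2 V) (hVnonneg : ∀ x, 0 ≤ V x)
    (hVradial : ∀ M : ℝ, Bornology.IsBounded {x | V x ≤ M})
    (W : EuclideanSpace ℝ (Fin n) → ℝ) (hW : ContDiff ℝ 1 W)
    (hWpos : W 0 = 0 ∧ ∀ x ≠ 0, 0 < W x)
    (R : ℝ) (hR : 0 < R)
    (hH1 : ∀ x u, u ∈ U → R ≤ V x → ⟪gradient V x, f x u⟫ ≤ -W x)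
    (hS1nhds : {x | V x ≤ R} ∈ 𝓝 (0 : EuclideanSpace ℝ (Fin n)))
    (b : ℝ) (hbR : R < b)
    -- the constant `G₁`
    (G₁ : ℝ)
    (hG₁ : IsLUB {c : ℝ | ∃ x z u, V x ≤ R ∧ V z ≤ b ∧ u ∈ U ∧ x ≠ z ∧
      c = ‖fderiv ℝ h x (f x u) - fderiv ℝ h z (f z u)‖ / ‖x - z‖} G₁)
    -- the partition
    (Ts : ℝ) (hTs : 0 < Ts)
    (π : ℕ → ℝ) (hπ0 : π 0 = 0) (hπmono : StrictMono π)
    (hπtop : Tendsto π atTop atTop) (hπstep : ∀ i, π (i + 1) - π i ≤ Ts)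
    -- the input
    (u : ℝ → EuclideanSpace ℝ (Fin m)) (humeas : Measurable u)
    (huU : ∀ t, u t ∈ U)
    -- the trajectories
    (x : ℝ → EuclideanSpace ℝ (Fin n)) (hxcont : ContinuousOn x (Ici (-r)))
    (hxsol : ∀ t, 0 ≤ t → x t = x 0 + ∫ s in (0:ℝ)..t, f (x s) (u (s - τ)))
    (z : ℝ → EuclideanSpace ℝ (Fin n)) (hzcont : ContinuousOn z (Ici 0))
    (w : ℝ → EuclideanSpace ℝ (Fin k))
    (hwsol : ∀ i : ℕ, ∀ t ∈ Ico (π i) (π (i + 1)),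
      w t = h (x (π i - r)) +
        ∫ s in (π i)..t, fderiv ℝ h (z s) (f (z s) (u (s - r - τ))))
    -- the compact-absorbing-set conditions
    (l : ℕ) (hl : 0 < l) (hτl : r ≤ π l)
    (hxS1 : ∀ t, π l ≤ t → V (x (t - r)) ≤ R)
    (hzS2 : ∀ t, π l ≤ t → V (z t) ≤ b) :
    ∀ i : ℕ, l ≤ i → ∀ t ∈ Ico (π i) (π (i + 1)),
      ‖w t - h (x (t - r))‖ ≤
        Ts * G₁ * ⨆ s : Icc (π i) t, ‖z s - x ((s : ℝ) - r)‖ := by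
  intro i hi t ht
  have hit : π i ≤ t := ht.1
  have hli : π l ≤ π i := hπmono.monotone hi
  have hri : r ≤ π i := hτl.trans hli
  have hfc : Continuous fun p : EuclideanSpace ℝ (Fin n) × EuclideanSpace ℝ (Fin m) =>
    f p.1 p.2 := hf.continuous
  have hDfc : Continuous fun p : EuclideanSpace ℝ (Fin n) × EuclideanSpace ℝ (Fin m) =>
      fderiv ℝ h p.1 (f p.1 p.2) :=
    ((hh.continuous_fderiv (by simp)).comp continuous_fst).clm_apply hfc
  have hzc : ContinuousOn z (Icc (π i) t) :=
    hzcont.mono fun s hs => (hr.trans hri).trans hs.1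
  have hxc : ContinuousOn (fun s => x (s - r)) (Icc (π i) t) :=
    hxcont.comp (by fun_prop) fun s hs => by
      simp only [mem_Ici, mem_Icc] at hs ⊢
      linarith
  have hum : StronglyMeasurable fun s => u (s - r - τ) :=
    (humeas.comp (by fun_prop)).stronglyMeasurable
  obtain ⟨⟨C, hC⟩, hv⟩ := exists_bound_and_intervalIntegrable_comp_prodMk hfc hUcomp hit hxc hum
    fun s => huU _
  obtain ⟨⟨C', hC'⟩, hDx⟩ := exists_bound_and_intervalIntegrable_comp_prodMk hDfc hUcomp hit hxc
    hum fun s => huU _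
  obtain ⟨-, hDz⟩ := exists_bound_and_intervalIntegrable_comp_prodMk hDfc hUcomp hit hzc hum
    fun s => huU _
  have hX : ∀ s ∈ Icc (π i) t,
      x (s - r) = x (π i - r) + ∫ q in (π i)..s, f (x (q - r)) (u (q - r - τ)) := by
    intro s hs
    have hint : ∀ T, 0 ≤ T → IntervalIntegrable (fun q => f (x q) (u (q - τ))) volume 0 T :=
      fun T hT => (exists_bound_and_intervalIntegrable_comp_prodMk hfc hUcomp hT
        (hxcont.mono fun q hq => (neg_nonpos.2 hr).trans hq.1)
        (humeas.comp (measurable_id.sub_const τ)).stronglyMeasurable fun s => huU _).2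
    have hs0 : 0 ≤ s - r := by linarith [hs.1]
    have hi0 : 0 ≤ π i - r := by linarith
    rw [intervalIntegral.integral_comp_sub_right (fun q => f (x q) (u (q - τ))),
      ← intervalIntegral.integral_interval_sub_left (hint _ hs0) (hint _ hi0),
      hxsol _ hs0, hxsol _ hi0]
    abel
  have hftc := sub_eq_integral_fderiv_comp_of_bounded (hh.of_le (by exact_mod_cast le_top)) hit
    hv hC hX hDx hC'
  have hdiff : w t - h (x (t - r)) = ∫ s in (π i)..t,
      (fderiv ℝ h (z s) (f (z s) (u (s - r - τ)))
        - fderiv ℝ h (x (s - r)) (f (x (s - r)) (u (s - r - τ)))) := by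
    rw [intervalIntegral.integral_sub hDz hDx, ← hftc, hwsol i t ht]
    abel
  have hG₁0 : 0 ≤ G₁ := by
    obtain ⟨c, hc⟩ := hG₁.nonempty
    refine le_trans ?_ (hG₁.1 hc)
    obtain ⟨_, _, _, _, _, _, _, rfl⟩ := hc
    positivity
  have hbdd : BddAbove (range fun s : Icc (π i) t => ‖z s - x ((s : ℝ) - r)‖) := by
    have := isCompact_Icc.bddAbove_image (hzc.sub hxc).norm
    rwa [image_eq_range] at this
  have hsup0 : 0 ≤ ⨆ s : Icc (π i) t, ‖z s - x ((s : ℝ) - r)‖ :=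
    Real.iSup_nonneg fun _ => norm_nonneg _
  have hbound : ∀ s ∈ uIoc (π i) t, ‖fderiv ℝ h (z s) (f (z s) (u (s - r - τ)))
      - fderiv ℝ h (x (s - r)) (f (x (s - r)) (u (s - r - τ)))‖
        ≤ G₁ * ⨆ s : Icc (π i) t, ‖z s - x ((s : ℝ) - r)‖ := by
    intro s hs
    have hs' : s ∈ Icc (π i) t := by
      rw [uIoc_of_le hit] at hs
      exact Ioc_subset_Icc_self hs
    refine le_trans ?_ (mul_le_mul_of_nonneg_left (le_ciSup hbdd ⟨s, hs'⟩) hG₁0)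
    by_cases hne : x (s - r) = z s
    · simp [hne]
    · have hle := hG₁.1 ⟨x (s - r), z s, u (s - r - τ), hxS1 s (hli.trans hs'.1),
        hzS2 s (hli.trans hs'.1), huU _, hne, rfl⟩
      rwa [div_le_iff₀ (norm_pos_iff.2 (sub_ne_zero.2 hne)), norm_sub_rev,
        norm_sub_rev (x (s - r))] at hle
  rw [hdiff]
  refine (intervalIntegral.norm_integral_le_of_norm_le_const hbound).trans ?_
  rw [abs_of_nonneg (sub_nonneg.2 hit), mul_comm, mul_assoc]
  refine mul_le_mul_of_nonneg_right ?_ (mul_nonneg hG₁0 hsup0)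
  linarith [ht.2, hπstep i]
end

section
/- For every x = (x₁, x₂) ∈ ℝ² with (x₁² + x₂²)/2 ≥ 1 and every u ∈ ℝ with |u| ≤ 50ζ√2, one has x₁(ζx₁ − 10x₁³ + x₂) + x₂(−(13/4)x₂ + u) ≤ −(x₁² + x₂²)/8; i.e. the planar system satisfies assumption (H1) with V(x) = (x₁² + x₂²)/2, R = 1 and W(x) = V(x)/4. -/
/-- For the planar system `ẋ₁ = ζx₁ − 10x₁³ + x₂`, `ẋ₂ = −(13/4)x₂ + u`
with `ζ > 0` satisfying `25001ζ² + 2ζ ≤ 4` and inputs `|u| ≤ 50ζ√2`, the function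
`V(x) = (x₁² + x₂²)/2` satisfies `∇V(x)·f(x,u) ≤ −V(x)/4` whenever `V(x) ≥ 1`;
i.e. assumption (H1) holds with `R = 1` and `W = V/4`. -/
theorem stmt_14 (ζ : ℝ) (hζpos : 0 < ζ) (hζ : 25001 * ζ ^ 2 + 2 * ζ ≤ 4)
    (x₁ x₂ u : ℝ) (hV : (x₁ ^ 2 + x₂ ^ 2) / 2 ≥ 1) (hu : |u| ≤ 50 * ζ * Real.sqrt 2) :
    x₁ * (ζ * x₁ - 10 * x₁ ^ 3 + x₂) + x₂ * (-(13 / 4) * x₂ + u) ≤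
      -((x₁ ^ 2 + x₂ ^ 2) / 8) := by
  have hζ_le : ζ ≤ 1 / 8 := by nlinarith
  have hu_sq : u ^ 2 ≤ 4 / 5 := by
    have h := pow_le_pow_left₀ (abs_nonneg u) hu 2
    rw [sq_abs, mul_pow, Real.sq_sqrt zero_le_two] at h
    nlinarith
  have hζ_mul : ζ * x₁ ^ 2 ≤ 1 / 8 * x₁ ^ 2 := mul_le_mul_of_nonneg_right hζ_le (sq_nonneg x₁)
  nlinarith [sq_nonneg (x₁ - x₂), sq_nonneg (x₂ - u), sq_nonneg (x₁ ^ 2 - 1 / 7)]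
end

section
/- For every x = (x₁, x₂) ∈ ℝ² with x₁² + x₂² ≤ 2, one has ∇P(x) · f(x, k̃(x)) ≤ −2ζ P(x), where f(x,u) = (ζx₁ − 10x₁³ + x₂, −(13/4)x₂ + u), P(x) = x₁²/2 + (2/(ζ(13 − 4ζ)))(x₂ + 2ζx₁)² and k̃(x) = −(3ζ/4)(13 − 4ζ)x₁ + 20ζx₁³. -/
/-- For `ζ > 0` with `25001ζ² + 2ζ ≤ 4`, the Lyapunov function
`P(x) = x₁²/2 + (2/(ζ(13 − 4ζ)))(x₂ + 2ζx₁)²` satisfies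
`∇P(x)·f(x, k̃(x)) ≤ −2ζP(x)` for every `x = (x₁, x₂) ∈ ℝ²` with `x₁² + x₂² ≤ 2`,
where `f(x,u) = (ζx₁ − 10x₁³ + x₂, −(13/4)x₂ + u)` and
`k̃(x) = −(3ζ/4)(13 − 4ζ)x₁ + 20ζx₁³`.  Here `∇P` is written out explicitly:
`∂P/∂x₁ = x₁ + (8/(13 − 4ζ))(x₂ + 2ζx₁)` and `∂P/∂x₂ = (4/(ζ(13 − 4ζ)))(x₂ + 2ζx₁)`. -/
theorem stmt_17 (ζ : ℝ) (hζpos : 0 < ζ) (hζ : 25001 * ζ ^ 2 + 2 * ζ ≤ 4)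
    (x₁ x₂ : ℝ) (hx : x₁ ^ 2 + x₂ ^ 2 ≤ 2) :
    (x₁ + (8 / (13 - 4 * ζ)) * (x₂ + 2 * ζ * x₁)) * (ζ * x₁ - 10 * x₁ ^ 3 + x₂)
      + ((4 / (ζ * (13 - 4 * ζ))) * (x₂ + 2 * ζ * x₁)) *
          (-(13 / 4) * x₂ + (-(3 * ζ / 4) * (13 - 4 * ζ) * x₁ + 20 * ζ * x₁ ^ 3)) ≤
      -(2 * ζ) * (x₁ ^ 2 / 2 + (2 / (ζ * (13 - 4 * ζ))) * (x₂ + 2 * ζ * x₁) ^ 2) := by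
  have hζ1 : ζ < 1 := by nlinarith
  have hc : 0 < 13 - 4 * ζ := by linarith
  have hn : 0 ≤ 13 - 12 * ζ := by linarith
  have hne : ζ ≠ 0 := hζpos.ne'
  have hcne : 13 - 4 * ζ ≠ 0 := hc.ne'
  rw [← sub_nonneg]
  have key : -(2 * ζ) * (x₁ ^ 2 / 2 + (2 / (ζ * (13 - 4 * ζ))) * (x₂ + 2 * ζ * x₁) ^ 2)
      - ((x₁ + (8 / (13 - 4 * ζ)) * (x₂ + 2 * ζ * x₁)) * (ζ * x₁ - 10 * x₁ ^ 3 + x₂)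
      + ((4 / (ζ * (13 - 4 * ζ))) * (x₂ + 2 * ζ * x₁)) *
          (-(13 / 4) * x₂ + (-(3 * ζ / 4) * (13 - 4 * ζ) * x₁ + 20 * ζ * x₁ ^ 3)))
      = 10 * x₁ ^ 4 + (13 - 12 * ζ) / (ζ * (13 - 4 * ζ)) * (x₂ + 2 * ζ * x₁) ^ 2 := by
    obtain ⟨c, hcdef⟩ : ∃ c, c = 13 - 4 * ζ := ⟨_, rfl⟩
    rw [← hcdef] at hcne ⊢
    field_simp
    rw [hcdef]
    ring
  rw [key]
  positivity
end

section
/- For all z = (z₁, z₂), x = (x₁, x₂) ∈ ℝ² and all u ∈ ℝ, one has (z − x) · ( f(z, u) + L(z₁ − x₁) − f(x, u) ) ≤ −ζ |z − x|², where f(x,u) = (ζx₁ − 10x₁³ + x₂, −(13/4)x₂ + u) and L = (−2ζ, −1)ᵀ; i.e. the planar system satisfies assumption (H3) with Q = I, observer gain L = −(2ζ, 1)ᵀ and ω = ζ. -/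
/-- For `ζ > 0` with `25001ζ² + 2ζ ≤ 4`, the planar system
`f(x,u) = (ζx₁ − 10x₁³ + x₂, −(13/4)x₂ + u)` with output `h(x) = x₁` satisfies
assumption (H3) with `Q = I`, observer gain `L = −(2ζ, 1)ᵀ` and `ω = ζ`:
for all `z, x ∈ ℝ²` and all `u ∈ ℝ`,
`(z − x)·(f(z,u) + L(z₁ − x₁) − f(x,u)) ≤ −ζ|z − x|²`. -/
theorem stmt_18 (ζ : ℝ) (hζpos : 0 < ζ) (hζ : 25001 * ζ ^ 2 + 2 * ζ ≤ 4)
    (z₁ z₂ x₁ x₂ u : ℝ) :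
    (z₁ - x₁) * ((ζ * z₁ - 10 * z₁ ^ 3 + z₂) + (-(2 * ζ)) * (z₁ - x₁)
        - (ζ * x₁ - 10 * x₁ ^ 3 + x₂))
      + (z₂ - x₂) * ((-(13 / 4) * z₂ + u) + (-1 : ℝ) * (z₁ - x₁) - (-(13 / 4) * x₂ + u)) ≤
      -ζ * ((z₁ - x₁) ^ 2 + (z₂ - x₂) ^ 2) := by
  have hζ_le : ζ ≤ 13 / 4 := by nlinarith [sq_nonneg ζ]
  have hcubic : 0 ≤ (z₁ - x₁) ^ 2 * (z₁ ^ 2 + z₁ * x₁ + x₁ ^ 2) :=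
    mul_nonneg (sq_nonneg _) (by nlinarith [sq_nonneg (z₁ + x₁), sq_nonneg z₁, sq_nonneg x₁])
  have hlinear : 0 ≤ (13 / 4 - ζ) * (z₂ - x₂) ^ 2 :=
    mul_nonneg (sub_nonneg.mpr hζ_le) (sq_nonneg _)
  linarith
end
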